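/- Fix, for every pair (β,s)∈Δ⁺×ℤ, a choice of the parameters λ_k∈v^ℤ and of the decomposition of s used in the definition of the quantum root vector E_{β,s}. Then the ordered PBWD monomials {E_h}_{h∈H} form a basis of U_v^>(Lsp_{2n}) as a ℚ(v)-vector space. -/

import Mathlib

noncomputable section
open scoped BigOperators DirectSum

/-! ### Base field ℚ(v) and quantum numbers -/

/-- the base field `ℚ(v)`. -/
abbrev KK : Type := RatFunc ℚ
/-- the variable `v ∈ ℚ(v)`. -/
def vv : KK := RatFunc.X
/-- integer powers of `v`. -/
def vpow (m : ℤ) : KK := vv ^ m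
/-- the quantum integer `[m]_u = (uᵐ - u⁻ᵐ)/(u - u⁻¹)`. -/
def qInt (u : KK) (m : ℕ) : KK := (u ^ (m : ℤ) - u ^ (-(m : ℤ))) / (u - u⁻¹)
/-- the quantum factorial `[m]_u!`. -/
def qFact (u : KK) (m : ℕ) : KK := ∏ k ∈ Finset.range m, qInt u (k + 1)
/-- the quantum binomial coefficient. -/
def qBinom (u : KK) (m k : ℕ) : KK := qFact u m / (qFact u k * qFact u (m - k))
/-- `⟨m⟩_v = vᵐ - v⁻ᵐ`. -/
def qBrack (m : ℕ) : KK := vpow (m : ℤ) - vpow (-(m : ℤ))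
/-- `l` is an integer power of `v`. -/
def IsVpow (l : KK) : Prop := ∃ m : ℤ, l = vpow m

/-! ### Cartan data of types `C_n` and `D_n` (1-based indices) -/

/-- the Cartan matrix of type `C_n` (1-based indices). -/
def aC (n i j : ℕ) : ℤ :=
  if i = j then 2 else if i + 1 = n ∧ j = n then -2
  else if i + 1 = j ∨ j + 1 = i then -1 else 0
/-- the symmetrizing integers `d_i` of type `C_n`. -/
def dC (n i : ℕ) : ℕ := if i = n then 2 else 1
/-- the Cartan matrix of type `D_n` (1-based indices). -/
def aD (n i j : ℕ) : ℤ :=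
  if i = j then 2
  else if (i + 1 = j ∧ j + 1 ≤ n) ∨ (j + 1 = i ∧ i + 1 ≤ n) then -1
  else if (i + 2 = n ∧ j = n) ∨ (j + 2 = n ∧ i = n) then -1 else 0
/-- the symmetrizing integers `d_i` of type `D_n` (all equal to `1`). -/
def dD (n i : ℕ) : ℕ := 1

/-! ### The positive subalgebra of the quantum loop algebra, for Cartan data `(A, Dd)` -/

section Ualg
variable (n : ℕ) (A : ℕ → ℕ → ℤ) (Dd : ℕ → ℕ)

/-- the free `ℚ(v)`-algebra on generators `e_{i,r}`, `i ∈ I`, `r ∈ ℤ`. -/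
abbrev FA := FreeAlgebra KK (Fin n × ℤ)
/-- the free generator `e_{i,r}`. -/
def fg (i : Fin n) (r : ℤ) : FA n := FreeAlgebra.ι KK (i, r)

/-- the `z^{-r₁}⋯z^{-r_m}w^{-t}`-coefficient of the Serre relation between colors `i ≠ j`. -/
def serreElt (i j : Fin n) (m : ℕ) (r : Fin m → ℤ) (t : ℤ) : FA n :=
  ∑ σ : Equiv.Perm (Fin m), ∑ k ∈ Finset.range (m + 1),
    ((-1 : KK) ^ k * qBinom (vpow (Dd (i.1 + 1))) m k) •
      (((List.ofFn fun l => fg n i (r (σ l))).take k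
        ++ fg n j t :: (List.ofFn fun l => fg n i (r (σ l))).drop k).prod)

/-- the defining relations of `U_v^>(Lg)` in the new Drinfeld realization: the coefficients of
`(z - v_i^{a_ij} w) e_i(z) e_j(w) = (v_i^{a_ij} z - w) e_j(w) e_i(z)` and of the Serre relations. -/
inductive URel : FA n → FA n → Prop
  | loop (i j : Fin n) (r s : ℤ) :
      URel (fg n i (r + 1) * fg n j s
             - vpow ((Dd (i.1 + 1) : ℤ) * A (i.1 + 1) (j.1 + 1)) • (fg n i r * fg n j (s + 1)))
           (vpow ((Dd (i.1 + 1) : ℤ) * A (i.1 + 1) (j.1 + 1)) • (fg n j s * fg n i (r + 1))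
             - fg n j (s + 1) * fg n i r)
  | serre (i j : Fin n) (hij : i ≠ j) (r : Fin (1 - A (i.1 + 1) (j.1 + 1)).toNat → ℤ) (t : ℤ) :
      URel (serreElt n Dd i j _ r t) 0

/-- the positive subalgebra `U_v^>(Lg)` of the quantum loop algebra. -/
abbrev UA := RingQuot (URel n A Dd)
/-- the generator `e_{i,r}` of `U_v^>(Lg)`. -/
def ug (i : Fin n) (r : ℤ) : UA n A Dd := RingQuot.mkAlgHom KK (URel n A Dd) (fg n i r)
/-- the generator `e_{i,r}` with a 1-based index `1 ≤ i ≤ n` (and junk value `0` otherwise). -/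
def g1 (i : ℕ) (r : ℤ) : UA n A Dd := if h : 1 ≤ i ∧ i ≤ n then ug n A Dd ⟨i - 1, by omega⟩ r else 0

end Ualg

/-! ### `q`-brackets, ordered monomials, and ℤ[v,v⁻¹]-forms -/

section Aux
variable {B : Type} [Ring B] [Module KK B]

/-- the `u`-commutator `[x,y]_u = xy - u · yx`. -/
def qcm (u : KK) (x y : B) : B := x * y - u • (y * x)

/-- the iterated `q`-bracket `[⋯[[g i₁ s₁, g i₂ s₂]_{λ₁}, g i₃ s₃]_{λ₂}, ⋯]_{λ_{ℓ-1}}`. -/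
def chainE (g : ℕ → ℤ → B) (w : List ℕ) (ss : List ℤ) (ls : List KK) : B :=
  match w, ss with
  | i :: w', s :: ss' =>
      ((w'.zip ss').zip ls).foldl
        (fun acc p => acc * g p.1.1 p.1.2 - p.2 • (g p.1.1 p.1.2 * acc)) (g i s)
  | _, _ => 0
end Aux

section Mon
variable {B : Type} [Ring B] {ι : Type} [LinearOrder ι]
/-- the ordered monomial `∏→ (E p)^(h p)`, the product taken in increasing order of `p`. -/
def ordMon (E : ι → B) (h : ι →₀ ℕ) : B := ((h.support.sort (· ≤ ·)).map (fun p => E p ^ h p)).prod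
end Mon

/-- the subring `ℤ[v,v⁻¹] ⊆ ℚ(v)`. -/
def Rint : Subring KK := Subring.closure {vv, vv⁻¹}

section Forms
variable {B : Type} [Ring B] [Algebra KK B]
/-- the `ℤ[v,v⁻¹]`-subalgebra of a `ℚ(v)`-algebra generated by a set `X`, realized as the subring
generated by `X` together with the central scalars `v^{±1}`. -/
def zvForm (X : Set B) : Subring B :=
  Subring.closure ({algebraMap KK B vv, algebraMap KK B vv⁻¹} ∪ X)
end Forms

/-! ### Positive roots of type `C_n` with the fixed convex (lexicographic) order -/

section RootsC
variable (n : ℕ)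

/-- Positive roots of type `C_n`, encoded as lexicographically ordered pairs `(i,t)`:
`[i,i+t]` for `i+t<n` or `i=n`; `[i,n,i]` for `i+t=n`, `i<n`; `[i,n]` for `i+t=n+1`;
`[i,n,j]` with `j = 2n+1-i-t` for `i+t ≥ n+2`.  The induced linear order is exactly the
convex order coming from standard Lyndon words. -/
def IsPosRootC (p : Fin (n + 1) ×ₗ Fin (2 * n + 1)) : Prop :=
  1 ≤ ((ofLex p).1 : ℕ) ∧ (((ofLex p).1 : ℕ) = n → ((ofLex p).2 : ℕ) = 0) ∧
    ((ofLex p).2 : ℕ) + 2 * ((ofLex p).1 : ℕ) ≤ 2 * n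

instance : DecidablePred (IsPosRootC n) := fun p => by unfold IsPosRootC; infer_instance

/-- the set `Δ⁺` of positive roots of type `C_n`, with its convex linear order. -/
abbrev PosRootC := {p : Fin (n + 1) ×ₗ Fin (2 * n + 1) // IsPosRootC n p}

variable {n}
/-- the first index `i` of a positive root. -/
def ri (β : PosRootC n) : ℕ := ((ofLex β.1).1 : ℕ)
/-- the offset `t` of a positive root within its block. -/
def rt (β : PosRootC n) : ℕ := ((ofLex β.1).2 : ℕ)

/-- multiplicity of `α_c` (1-based color `c`) in the positive root `β` (type `C_n`). -/
def nuC (β : PosRootC n) (c : ℕ) : ℕ :=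
  let i := ri β; let t := rt β
  if i + t < n ∨ i = n then (if i ≤ c ∧ c ≤ i + t then 1 else 0)
  else if i + t = n then (if i ≤ c ∧ c ≤ n - 1 then 2 else if c = n then 1 else 0)
  else if i + t = n + 1 then (if i ≤ c ∧ c ≤ n then 1 else 0)
  else (if i ≤ c ∧ c < 2 * n + 1 - i - t then 1
        else if 2 * n + 1 - i - t ≤ c ∧ c ≤ n - 1 then 2
        else if c = n then 1 else 0)

/-- standard Lyndon word (list of 1-based simple-root indices) of `β` (type `C_n`). -/
def wordC (β : PosRootC n) : List ℕ :=
  let i := ri β; let t := rt β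
  if i + t < n ∨ i = n then List.range' i (t + 1)
  else if i + t = n then List.range' i (n - i) ++ List.range' i (n - i) ++ [n]
  else if i + t = n + 1 then List.range' i (n - i + 1)
  else List.range' i (n - i + 1) ++ (List.range' (2 * n + 1 - i - t) (n - (2 * n + 1 - i - t))).reverse

/-- the height `|β|` of a positive root (type `C_n`). -/
def heightC (β : PosRootC n) : ℕ := (wordC β).length

/-- `β` is a root of the form `[i,n,i]`. -/
def isINI (β : PosRootC n) : Prop := ri β + rt β = n ∧ ri β < n
instance (β : PosRootC n) : Decidable (isINI β) := by unfold isINI; infer_instance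
end RootsC

/-! ### General quantum root vectors of type `C_n` -/

section RVC
variable (n : ℕ)

/-- the positive subalgebra `U_v^>(Lsp_{2n})`. -/
abbrev UC := UA n (aC n) (dC n)
/-- generators of `U_v^>(Lsp_{2n})` with 1-based indices. -/
def genC : ℕ → ℤ → UC n := g1 n (aC n) (dC n)

variable {n}
/-- `E` is a quantum root vector `E_{β,s}` for a root of "chain" type, i.e. obtained by an
iterated `q`-bracket along the standard Lyndon word of `β` for some choice of the parameters
`λ_k ∈ v^ℤ` and of a decomposition of `s`. -/
def IsRVCchain (β : PosRootC n) (s : ℤ) (E : UC n) : Prop :=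
  ∃ (ss : List ℤ) (ls : List KK),
    ss.length = (wordC β).length ∧ ls.length + 1 = (wordC β).length ∧ ss.sum = s ∧
    (∀ l ∈ ls, IsVpow l) ∧ E = chainE (genC n) (wordC β) ss ls

/-- `E` is a quantum root vector `E_{β,s}` of type `C_n` for some choice of the parameters:
for `β ≠ [i,n,i]` an iterated `q`-bracket along the standard Lyndon word of `β`, and for
`β = [i,n,i]` a `q`-bracket `[E_{[i,n-1],s₁}, E_{[i,n],s₂}]_λ`. -/
def IsRVC (β : PosRootC n) (s : ℤ) (E : UC n) : Prop :=
  if isINI β then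
    ∃ (β₁ β₂ : PosRootC n) (s₁ s₂ : ℤ) (lam : KK) (E₁ E₂ : UC n),
      (ri β₁ = ri β ∧ ri β₁ + rt β₁ + 1 = n) ∧ (ri β₂ = ri β ∧ ri β₂ + rt β₂ = n + 1) ∧
      IsVpow lam ∧ IsRVCchain β₁ s₁ E₁ ∧ IsRVCchain β₂ s₂ E₂ ∧
      s = s₁ + s₂ ∧ E = qcm lam E₁ E₂
  else IsRVCchain β s E
end RVC

namespace PBWD

/-! ### Explicit form of the Serre relations -/

section SerreForm
variable {B : Type*} [Ring B] [Algebra KK B]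

/-- the cubic expression in the Serre relation of degree two. -/
def serre2 (c : KK) (x y z : B) : B := x * y * z - c • (x * z * y) + z * x * y

/-- the quartic expression in the Serre relation of degree three. -/
def serre3 (c : KK) (x y w z : B) : B :=
  z * x * y * w - c • (x * z * y * w) + c • (x * y * z * w) - x * y * w * z

end SerreForm

theorem vv_ne_zero : vv ≠ 0 := RatFunc.X_ne_zero

theorem vpow_ne_zero (m : ℤ) : vpow m ≠ 0 := zpow_ne_zero _ vv_ne_zero

theorem vpow_add (a b : ℤ) : vpow (a + b) = vpow a * vpow b := zpow_add₀ vv_ne_zero a b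

theorem vpow_zero : vpow 0 = 1 := zpow_zero _

theorem vpow_inj {a b : ℤ} (h : vpow a = vpow b) : a = b := by
  have key : ∀ k : ℕ, vv ^ k = 1 → k = 0 := by
    intro k hk
    have h1 : (algebraMap (Polynomial ℚ) KK) (Polynomial.X ^ k) = algebraMap _ _ 1 := by
      rw [map_pow, RatFunc.algebraMap_X, map_one]
      exact hk
    have h2 := RatFunc.algebraMap_injective ℚ h1
    have := congrArg Polynomial.natDegree h2
    simpa using this
  have h3 : vpow (a - b) = 1 := by
    rw [vpow, zpow_sub₀ vv_ne_zero]
    exact (div_eq_one_iff_eq (vpow_ne_zero b)).2 h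
  have h4 : ∀ c : ℤ, vpow c = 1 → c = 0 := by
    intro c hc
    obtain ⟨k, rfl | rfl⟩ := c.eq_nat_or_neg
    · have := key k (by simpa [vpow] using hc)
      simp [this]
    · have := key k (by simpa [vpow] using hc)
      simp [this]
  have := h4 _ h3
  omega

theorem vpow_ne_one {a : ℤ} (h : a ≠ 0) : vpow a ≠ 1 := fun h' => h
    (vpow_inj (h'.trans vpow_zero.symm))

section QInt
variable {d : ℤ}

theorem vpow_sub_inv_ne (hd : d ≠ 0) : vpow d - (vpow d)⁻¹ ≠ 0 := by
  have : (vpow d)⁻¹ = vpow (-d) := by simp [vpow]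
  rw [this, sub_ne_zero]
  intro h
  have := vpow_inj h
  omega

theorem qInt_vpow_ne_zero (hd : d ≠ 0) {m : ℕ} (hm : m ≠ 0) : qInt (vpow d) m ≠ 0 := by
  have e : qInt (vpow d) m = (vpow (d * m) - (vpow (d * m))⁻¹) / (vpow d - (vpow d)⁻¹) := by
    simp only [qInt, vpow, ← zpow_mul, ← zpow_neg, mul_neg]
  rw [e]
  refine div_ne_zero (vpow_sub_inv_ne ?_) (vpow_sub_inv_ne hd)
  exact mul_ne_zero hd (by exact_mod_cast hm)

theorem qInt_one (hd : d ≠ 0) : qInt (vpow d) 1 = 1 := by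
  simp [qInt, div_self (vpow_sub_inv_ne hd)]

theorem qInt_two (hd : d ≠ 0) : qInt (vpow d) 2 = vpow d + (vpow d)⁻¹ := by
  rw [qInt, div_eq_iff (vpow_sub_inv_ne hd)]
  simp only [Nat.cast_ofNat, zpow_neg]
  rw [← inv_zpow]
  simp only [zpow_ofNat]
  ring

theorem qInt_three (hd : d ≠ 0) : qInt (vpow d) 3 = vpow d ^ 2 + 1 + (vpow d)⁻¹ ^ 2 := by
  have : vpow d * (vpow d)⁻¹ = 1 := mul_inv_cancel₀ (vpow_ne_zero d)
  rw [qInt, div_eq_iff (vpow_sub_inv_ne hd)]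
  simp only [Nat.cast_ofNat, zpow_neg]
  rw [← inv_zpow]
  simp only [zpow_ofNat]
  linear_combination (vpow d - (vpow d)⁻¹) * this

theorem qFact_vpow_ne_zero (hd : d ≠ 0) (m : ℕ) : qFact (vpow d) m ≠ 0 :=
  Finset.prod_ne_zero_iff.2 fun k _ => qInt_vpow_ne_zero hd k.succ_ne_zero

theorem qBinom_zero (hd : d ≠ 0) (m : ℕ) : qBinom (vpow d) m 0 = 1 := by
  have := qFact_vpow_ne_zero hd m
  rw [qBinom, Nat.sub_zero]
  simpa [qFact] using this

theorem qBinom_self (hd : d ≠ 0) (m : ℕ) : qBinom (vpow d) m m = 1 := by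
  have := qFact_vpow_ne_zero hd m
  rw [qBinom, Nat.sub_self]
  simpa [qFact] using this

theorem qFact_one (hd : d ≠ 0) : qFact (vpow d) 1 = 1 := by simpa [qFact] using qInt_one hd

theorem qFact_two (hd : d ≠ 0) : qFact (vpow d) 2 = qInt (vpow d) 2 := by
  simp [qFact, Finset.prod_range_succ, -Nat.reduceAdd, show 1 + 1 = 2 from rfl, qInt_one hd]

theorem qFact_three (hd : d ≠ 0) : qFact (vpow d) 3 = qInt (vpow d) 2 * qInt (vpow d) 3 := by
  rw [qFact, Finset.prod_range_succ]
  exact congrArg (· * _) (qFact_two hd)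

theorem qBinom_two_one (hd : d ≠ 0) : qBinom (vpow d) 2 1 = vpow d + (vpow d)⁻¹ := by
  simp [qBinom, qFact_one hd, qFact_two hd, qInt_two hd]

theorem qBinom_three_one (hd : d ≠ 0) : qBinom (vpow d) 3 1 = vpow d ^ 2 + 1 + (vpow d)⁻¹ ^ 2 := by
  have := qInt_vpow_ne_zero hd two_ne_zero
  rw [qBinom, qFact_one hd, qFact_three hd, show 3 - 1 = 2 from rfl, qFact_two hd, ← qInt_three hd]
  field_simp

theorem qBinom_three_two (hd : d ≠ 0) : qBinom (vpow d) 3 2 = vpow d ^ 2 + 1 + (vpow d)⁻¹ ^ 2 := by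
  have := qInt_vpow_ne_zero hd two_ne_zero
  rw [qBinom, qFact_two hd, qFact_three hd, show 3 - 2 = 1 from rfl, qFact_one hd, ← qInt_three hd]
  field_simp

end QInt

section SerreElt
variable (n : ℕ) (Dd : ℕ → ℕ) (i j : Fin n)

theorem serreElt_one (hd : (Dd (i.1 + 1) : ℤ) ≠ 0) (r : Fin 1 → ℤ) (t : ℤ) :
    serreElt n Dd i j 1 r t = fg n j t * fg n i (r 0) - fg n i (r 0) * fg n j t := by
  rw [serreElt]
  simp only [Finset.sum_range_succ, Finset.sum_range_zero, qBinom_zero hd, qBinom_self hd]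
  simp [List.ofFn_succ, sub_eq_add_neg]

theorem serreElt_two (hd : (Dd (i.1 + 1) : ℤ) ≠ 0) (r : Fin 2 → ℤ) (t : ℤ) :
    serreElt n Dd i j 2 r t =
      ∑ σ : Equiv.Perm (Fin 2), serre2 (vpow (Dd (i.1 + 1)) + (vpow (Dd (i.1 + 1)))⁻¹)
        (fg n i (r (σ 0))) (fg n i (r (σ 1))) (fg n j t) := by
  rw [serreElt]
  refine Finset.sum_congr rfl fun σ _ => ?_
  simp only [Finset.sum_range_succ, Finset.sum_range_zero, qBinom_zero hd, qBinom_self hd,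
    qBinom_two_one hd, zero_add, pow_zero, pow_one, mul_one]
  simp only [serre2, List.ofFn_succ, List.ofFn_zero, List.take, List.drop, List.prod_append,
    List.prod_cons, List.prod_nil, neg_mul, one_mul, mul_one, neg_smul, one_smul, neg_one_sq]
  simp only [mul_assoc, Fin.succ_zero_eq_one]
  abel

theorem serreElt_three (hd : (Dd (i.1 + 1) : ℤ) ≠ 0) (r : Fin 3 → ℤ) (t : ℤ) :
    serreElt n Dd i j 3 r t =
      ∑ σ : Equiv.Perm (Fin 3), serre3 (vpow (Dd (i.1 + 1)) ^ 2 + 1 + (vpow (Dd (i.1 + 1)))⁻¹ ^ 2)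
        (fg n i (r (σ 0))) (fg n i (r (σ 1))) (fg n i (r (σ 2))) (fg n j t) := by
  rw [serreElt]
  refine Finset.sum_congr rfl fun σ _ => ?_
  simp only [Finset.sum_range_succ, Finset.sum_range_zero, qBinom_zero hd, qBinom_self hd,
    qBinom_three_one hd, qBinom_three_two hd, zero_add, pow_zero, pow_one, mul_one]
  simp only [serre3, List.ofFn_succ, List.ofFn_zero, List.take, List.drop, List.prod_append,
    List.prod_cons, List.prod_nil, neg_mul, one_mul, mul_one, neg_smul, one_smul, neg_one_sq,
    show (-1 : KK) ^ 3 = -1 by norm_num]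
  simp only [mul_assoc, Fin.succ_zero_eq_one, show (Fin.succ 1 : Fin 3) = 2 from rfl]
  abel

end SerreElt

/-! ### Shuffle-type operators attached to a configuration of coloured points -/

/-- the symmetrized Cartan matrix of type `C_n`. -/
def cartB (n i j : ℕ) : ℤ :=
  if i = j then (if i = n then 4 else 2)
  else if (i + 1 = n ∧ j = n) ∨ (j + 1 = n ∧ i = n) then -2
  else if i + 1 = j ∨ j + 1 = i then -1 else 0

theorem cartB_comm (n i j : ℕ) : cartB n i j = cartB n j i := by
  unfold cartB
  split_ifs <;> omega

theorem dC_mul_aC {n i j : ℕ} (hi : i ≤ n) (hj : j ≤ n) :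
    (dC n i : ℤ) * aC n i j = cartB n i j := by
  unfold cartB dC aC
  split_ifs <;> omega

/-- the image of `v ^ m` in a `ℚ(v)`-algebra. -/
def vt (T : Type) [CommRing T] [Algebra KK T] (m : ℤ) : T := algebraMap KK T (vpow m)

/-- a configuration of points, each with a colour and an invertible position. -/
structure Pts (P T : Type) [CommRing T] where
  /-- the colour of a point -/
  col : P → ℕ
  /-- the position of a point -/
  x : P → Tˣ

section Ops
variable {P T : Type} [LinearOrder P] [CommRing T] [Algebra KK T] (n : ℕ) (D : Pts P T)

namespace Pts

/-- the structure factor of an ordered pair of points. -/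
def zeta (p q : P) : T :=
  if cartB n (D.col p) (D.col q) = 0 then 1
  else if p < q then
    1 - vt T (cartB n (D.col p) (D.col q)) * (D.x p : T) * ((D.x q)⁻¹ : Tˣ)
  else vt T (cartB n (D.col p) (D.col q)) - (D.x q : T) * ((D.x p)⁻¹ : Tˣ)

/-- the antisymmetric unit comparing `zeta` with a linear factor. -/
def sgn (p q : P) : T := if p < q then -(((D.x q)⁻¹ : Tˣ) : T) else (((D.x p)⁻¹ : Tˣ) : T)

theorem sgn_swap {p q : P} (h : p ≠ q) : D.sgn q p = -D.sgn p q := by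
  unfold sgn
  rcases lt_or_gt_of_ne h with h | h
  · rw [if_neg h.not_gt, if_pos h, neg_neg]
  · rw [if_pos h, if_neg h.not_gt]

theorem zeta_eq {p q : P} (h : cartB n (D.col p) (D.col q) ≠ 0) :
    D.zeta n p q = D.sgn p q * (vt T (cartB n (D.col p) (D.col q)) * D.x p - D.x q) := by
  unfold zeta sgn
  rw [if_neg h]
  have hp : (D.x p : T) * ((D.x p)⁻¹ : Tˣ) = 1 := Units.mul_inv _
  have hq : (D.x q : T) * ((D.x q)⁻¹ : Tˣ) = 1 := Units.mul_inv _
  split_ifs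
  · linear_combination -hq
  · linear_combination (-vt T (cartB n (D.col p) (D.col q))) * hp

theorem zeta_swap {p q : P} (h : p ≠ q) :
    ((D.x p : T) - vt T (cartB n (D.col p) (D.col q)) * D.x q) * D.zeta n p q =
      (vt T (cartB n (D.col p) (D.col q)) * D.x p - D.x q) * D.zeta n q p := by
  by_cases h0 : cartB n (D.col p) (D.col q) = 0
  · have h0' : cartB n (D.col q) (D.col p) = 0 := by rwa [cartB_comm]
    simp [zeta, h0, h0', vt, vpow_zero]
  · have h0' : cartB n (D.col q) (D.col p) ≠ 0 := by rwa [cartB_comm]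
    rw [zeta_eq n D h0, zeta_eq n D h0', cartB_comm n (D.col q), D.sgn_swap h]
    ring

/-- the product of the structure factors over all ordered pairs of a list. -/
def Z : List P → T
  | [] => 1
  | p :: l => (l.map (D.zeta n p)).prod * Z l

/-- the product of the structure factors between two finite sets of points. -/
def cross (F G : Finset P) : T := ∏ p ∈ F, ∏ q ∈ G, D.zeta n p q

/-- the operator removing a point. -/
def A (p : P) : Module.End T (Finset P → T) where
  toFun f S := if p ∈ S then (∏ q ∈ S.erase p, D.zeta n p q) * f (S.erase p) else 0
  map_add' f g := by
    funext S
    simp only [Pi.add_apply, mul_add]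
    split_ifs <;> simp
  map_smul' c f := by
    funext S
    simp only [Pi.smul_apply, smul_eq_mul, RingHom.id_apply]
    split_ifs
    · ring
    · simp

/-- the operator removing a finite set of points. -/
def Bop (F : Finset P) : Module.End T (Finset P → T) where
  toFun f S := if F ⊆ S then D.cross n F (S \ F) * f (S \ F) else 0
  map_add' f g := by
    funext S
    simp only [Pi.add_apply, mul_add]
    split_ifs <;> simp
  map_smul' c f := by
    funext S
    simp only [Pi.smul_apply, smul_eq_mul, RingHom.id_apply]
    split_ifs
    · ring
    · simp

theorem Bop_apply (F : Finset P) (f : Finset P → T) (S : Finset P) :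
    D.Bop n F f S = if F ⊆ S then D.cross n F (S \ F) * f (S \ F) else 0 := rfl

theorem A_apply (p : P) (f : Finset P → T) (S : Finset P) :
    D.A n p f S = if p ∈ S then (∏ q ∈ S.erase p, D.zeta n p q) * f (S.erase p) else 0 := rfl

theorem A_mul_Bop_of_mem {p : P} {F : Finset P} (h : p ∈ F) : D.A n p * D.Bop n F = 0 := by
  refine LinearMap.ext fun f => funext fun S => ?_
  simp only [Module.End.mul_apply, A_apply, Bop_apply, LinearMap.zero_apply, Pi.zero_apply]
  rw [if_neg (c := F ⊆ S.erase p) (fun hF => absurd (hF h) (Finset.notMem_erase p S))]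
  simp

theorem A_mul_Bop_of_notMem {p : P} {F : Finset P} (h : p ∉ F) :
    D.A n p * D.Bop n F = (∏ q ∈ F, D.zeta n p q) • D.Bop n (insert p F) := by
  refine LinearMap.ext fun f => funext fun S => ?_
  simp only [Module.End.mul_apply, A_apply, Bop_apply, LinearMap.smul_apply, Pi.smul_apply,
    smul_eq_mul]
  by_cases hp : p ∈ S
  · by_cases hF : F ⊆ S
    · have h1 : F ⊆ S.erase p := Finset.subset_erase.2 ⟨hF, h⟩
      have h2 : insert p F ⊆ S := Finset.insert_subset hp hF
      have h3 : S.erase p \ F = S \ insert p F := by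
        ext y; simp only [Finset.mem_sdiff, Finset.mem_erase, Finset.mem_insert]; tauto
      rw [if_pos hp, if_pos h1, if_pos h2, h3, cross, cross, Finset.prod_insert h,
        ← Finset.prod_sdiff h1, h3]
      ring
    · rw [if_neg (c := F ⊆ S.erase p) (fun hh => hF (hh.trans (Finset.erase_subset _ _))),
        if_neg (c := insert p F ⊆ S) (fun hh => hF ((Finset.subset_insert _ _).trans hh))]
      simp
  · rw [if_neg hp, if_neg (c := insert p F ⊆ S) (fun hh => hp (hh (Finset.mem_insert_self _ _)))]
    simp

theorem Bop_empty : D.Bop n ∅ = 1 := by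
  refine LinearMap.ext fun f => funext fun S => ?_
  simp [Bop_apply, cross]

theorem word_eq (l : List P) :
    (l.map (D.A n)).prod = if l.Nodup then D.Z n l • D.Bop n l.toFinset else 0 := by
  induction l with
  | nil => simp [Z, Bop_empty]
  | cons p l ih =>
    rw [List.map_cons, List.prod_cons, ih]
    by_cases hl : l.Nodup
    · rw [if_pos hl, mul_smul_comm]
      by_cases hp : p ∈ l
      · rw [A_mul_Bop_of_mem n D (List.mem_toFinset.2 hp), if_neg (by simp [hp]), smul_zero]
      · rw [A_mul_Bop_of_notMem n D (by simpa using hp), if_pos (List.nodup_cons.2 ⟨hp, hl⟩), Z,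
          List.toFinset_cons, smul_smul, List.prod_toFinset _ hl, mul_comm]
    · rw [if_neg hl, if_neg (by simp [hl]), mul_zero]

end Pts
end Ops

theorem serre2_poly {T : Type} [CommRing T] (u w p q t : T) (h : u * w = 1) :
    (u ^ 2 * p - q) * ((w * p - t) * (w * q - t) + (u + w) * ((w * p - t) * (w * t - q))
      + (w * t - p) * (w * t - q)) -
    (u ^ 2 * q - p) * ((w * q - t) * (w * p - t) + (u + w) * ((w * q - t) * (w * t - p))
      + (w * t - q) * (w * t - p)) = 0 := by
  grind

/-- the unsymmetrized polynomial of the Serre relation of degree three. -/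
def serrePoly {T : Type} [CommRing T] (u w p q r t : T) : T :=
   (u * p - q) * (u * p - r) * (u * q - r) *
   ((w * t - p) * (w * t - q) * (w * t - r) +
    (u + 1 + w) * ((w * p - t) * (w * t - q) * (w * t - r)) +
    (u + 1 + w) * ((w * p - t) * (w * q - t) * (w * t - r)) +
    (w * p - t) * (w * q - t) * (w * r - t))

set_option maxHeartbeats 4000000 in
set_option maxRecDepth 100000 in
theorem serre3_poly {T : Type} [CommRing T] (u w p q r t : T) (h : u * w = 1) :
    serrePoly u w p q r t - serrePoly u w q p r t - serrePoly u w p r q t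
      - serrePoly u w r q p t + serrePoly u w q r p t + serrePoly u w r p q t = 0 := by
  unfold serrePoly
  grind

theorem sum_perm_two {M : Type*} [AddCommMonoid M] (f : Equiv.Perm (Fin 2) → M) :
    ∑ σ, f σ = f 1 + f (Equiv.swap 0 1) := by
  rw [show (Finset.univ : Finset (Equiv.Perm (Fin 2))) = {1, Equiv.swap 0 1} by decide,
    Finset.sum_insert (by decide), Finset.sum_singleton]

theorem sum_perm_three {M : Type*} [AddCommMonoid M] (f : Fin 3 → Fin 3 → Fin 3 → M) :
    ∑ σ : Equiv.Perm (Fin 3), f (σ 0) (σ 1) (σ 2) =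
      f 0 1 2 + (f 1 0 2 + (f 2 1 0 + (f 0 2 1 + (f 1 2 0 + f 2 0 1)))) := by
  rw [show (Finset.univ : Finset (Equiv.Perm (Fin 3))) = {1, Equiv.swap 0 1, Equiv.swap 0 2,
      Equiv.swap 1 2, finRotate 3, (finRotate 3)⁻¹} by decide,
    Finset.sum_insert (by decide), Finset.sum_insert (by decide), Finset.sum_insert (by decide),
    Finset.sum_insert (by decide), Finset.sum_insert (by decide), Finset.sum_singleton]
  rfl

theorem mem_span_zero {T B : Type*} [CommRing T] [Ring B] [Algebra T B] (s : Set B) (f : B →ₗ[T] B)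
    (h : ∀ a ∈ s, f a = 0) {x : B} (hx : x ∈ Submodule.span T s) : f x = 0 := by
  have : Submodule.span T s ≤ LinearMap.ker f := Submodule.span_le.2 fun a ha => h a ha
  exact this hx

section SymSerre
variable {B : Type*} [Ring B] [Algebra KK B]

/-- the symmetrized Serre expression of degree two. -/
def symSerre2 (c : KK) (x y z : B) : B := serre2 c x y z + serre2 c y x z

/-- the symmetrized Serre expression of degree three. -/
def symSerre3 (c : KK) (x y w z : B) : B :=
  serre3 c x y w z + (serre3 c y x w z + (serre3 c w y x z + (serre3 c x w y z
    + (serre3 c y w x z + serre3 c w x y z))))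

theorem symSerre2_comm (c : KK) (x y z : B) : symSerre2 c x y z = symSerre2 c y x z := by
  unfold symSerre2; abel

theorem symSerre3_comm (c : KK) (x y w z : B) : symSerre3 c x y w z = symSerre3 c y x w z := by
  unfold symSerre3; abel

theorem symSerre3_comm' (c : KK) (x y w z : B) : symSerre3 c x y w z = symSerre3 c x w y z := by
  unfold symSerre3; abel

variable {T : Type*} [CommRing T] [Algebra T B] [SMulCommClass T KK B] [SMulCommClass KK T B]

/-- `symSerre2` as a linear map in its first argument. -/
def symSerre2L (T : Type*) [CommRing T] [Algebra T B] [SMulCommClass T KK B] (c : KK) (y z : B) :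
    B →ₗ[T] B where
  toFun x := symSerre2 c x y z
  map_add' a b := by simp only [symSerre2, serre2, add_mul, mul_add, smul_add]; abel
  map_smul' r a := by
    simp only [symSerre2, serre2, smul_mul_assoc, mul_smul_comm, smul_add, smul_sub,
      RingHom.id_apply, smul_comm r c]

/-- `symSerre2` as a linear map in its last argument. -/
def symSerre2L' (T : Type*) [CommRing T] [Algebra T B] [SMulCommClass T KK B] (c : KK) (x y : B) :
    B →ₗ[T] B where
  toFun z := symSerre2 c x y z
  map_add' a b := by simp only [symSerre2, serre2, add_mul, mul_add, smul_add]; abel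
  map_smul' r a := by
    simp only [symSerre2, serre2, smul_mul_assoc, mul_smul_comm, smul_add, smul_sub,
      RingHom.id_apply, smul_comm r c]

/-- `symSerre3` as a linear map in its first argument. -/
def symSerre3L (T : Type*) [CommRing T] [Algebra T B] [SMulCommClass T KK B] (c : KK)
    (y w z : B) : B →ₗ[T] B where
  toFun x := symSerre3 c x y w z
  map_add' a b := by simp only [symSerre3, serre3, add_mul, mul_add, smul_add]; abel
  map_smul' r a := by
    simp only [symSerre3, serre3, smul_mul_assoc, mul_smul_comm, smul_add, smul_sub,
      RingHom.id_apply, smul_comm r c]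

/-- `symSerre3` as a linear map in its last argument. -/
def symSerre3L' (T : Type*) [CommRing T] [Algebra T B] [SMulCommClass T KK B] (c : KK)
    (x y w : B) : B →ₗ[T] B where
  toFun z := symSerre3 c x y w z
  map_add' a b := by simp only [symSerre3, serre3, add_mul, mul_add, smul_add]; abel
  map_smul' r a := by
    simp only [symSerre3, serre3, smul_mul_assoc, mul_smul_comm, smul_add, smul_sub,
      RingHom.id_apply, smul_comm r c]

theorem symSerre2_span {s t : Set B} {c : KK}
    (h : ∀ x ∈ s, ∀ y ∈ s, ∀ z ∈ t, symSerre2 c x y z = 0) {x y z : B}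
    (hx : x ∈ Submodule.span T s) (hy : y ∈ Submodule.span T s) (hz : z ∈ Submodule.span T t) :
    symSerre2 c x y z = 0 := by
  refine mem_span_zero s (symSerre2L T c y z) (fun x hx => ?_) hx
  change symSerre2 c x y z = 0
  rw [symSerre2_comm]
  refine mem_span_zero s (symSerre2L T c x z) (fun y hy => ?_) hy
  exact mem_span_zero t (symSerre2L' T c y x) (fun z hz => h y hy x hx z hz) hz

theorem symSerre3_span {s t : Set B} {c : KK}
    (h : ∀ x ∈ s, ∀ y ∈ s, ∀ w ∈ s, ∀ z ∈ t, symSerre3 c x y w z = 0) {x y w z : B}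
    (hx : x ∈ Submodule.span T s) (hy : y ∈ Submodule.span T s) (hw : w ∈ Submodule.span T s)
    (hz : z ∈ Submodule.span T t) : symSerre3 c x y w z = 0 := by
  refine mem_span_zero s (symSerre3L T c y w z) (fun x hx => ?_) hx
  change symSerre3 c x y w z = 0
  rw [symSerre3_comm]
  refine mem_span_zero s (symSerre3L T c x w z) (fun y hy => ?_) hy
  change symSerre3 c y x w z = 0
  rw [symSerre3_comm', symSerre3_comm]
  refine mem_span_zero s (symSerre3L T c y x z) (fun w hw => ?_) hw
  exact mem_span_zero t (symSerre3L' T c w y x) (fun z hz => h w hw y hy x hx z hz) hz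

end SymSerre

section Ops
variable {P T : Type} [LinearOrder P] [CommRing T] [Algebra KK T] (n : ℕ) (D : Pts P T)

theorem vt_add (a b : ℤ) : vt T (a + b) = vt T a * vt T b := by
  rw [vt, vpow_add, map_mul]; rfl

theorem vt_zero : vt T 0 = 1 := by rw [vt, vpow_zero, map_one]

theorem KK_smul_eq (c : KK) (X : Module.End T (Finset P → T)) :
    c • X = (algebraMap KK T c) • X := by
  rw [algebraMap_smul]

namespace Pts

theorem A_mul_A (p q : P) :
    D.A n p * D.A n q = if p = q then 0 else D.zeta n p q • D.Bop n {p, q} := by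
  have := D.word_eq n [p, q]
  simp only [List.map_cons, List.map_nil, List.prod_cons, List.prod_nil, mul_one] at this
  rw [this]
  by_cases h : p = q
  · simp [h]
  · simp [h, Z, List.toFinset_cons]

theorem A_mul_A_swap (p q : P) :
    ((D.x p : T) - vt T (cartB n (D.col p) (D.col q)) * D.x q) • (D.A n p * D.A n q) =
      (vt T (cartB n (D.col p) (D.col q)) * D.x p - D.x q) • (D.A n q * D.A n p) := by
  rw [A_mul_A, A_mul_A]
  by_cases h : p = q
  · simp [h]
  · rw [if_neg h, if_neg (Ne.symm h), smul_smul, smul_smul, D.zeta_swap n h, Finset.pair_comm]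

theorem A_mul_A_mul_A (p q t : P) :
    D.A n p * D.A n q * D.A n t = if p = q ∨ p = t ∨ q = t then 0
      else (D.zeta n p q * D.zeta n p t * D.zeta n q t) • D.Bop n {p, q, t} := by
  have := D.word_eq n [p, q, t]
  simp only [List.map_cons, List.map_nil, List.prod_cons, List.prod_nil, mul_one] at this
  rw [mul_assoc, this]
  by_cases h : p = q ∨ p = t ∨ q = t
  · rw [if_neg, if_pos h]
    simp; tauto
  · rw [if_pos, if_neg h]
    · simp [Z, List.toFinset_cons]
    · simp; tauto

theorem A_mul_A_mul_A_mul_A (p q r t : P) :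
    D.A n p * D.A n q * D.A n r * D.A n t =
      if p = q ∨ p = r ∨ p = t ∨ q = r ∨ q = t ∨ r = t then 0
      else (D.zeta n p q * D.zeta n p r * D.zeta n p t * D.zeta n q r * D.zeta n q t *
        D.zeta n r t) • D.Bop n {p, q, r, t} := by
  have := D.word_eq n [p, q, r, t]
  simp only [List.map_cons, List.map_nil, List.prod_cons, List.prod_nil, mul_one] at this
  rw [mul_assoc, mul_assoc, this]
  by_cases h : p = q ∨ p = r ∨ p = t ∨ q = r ∨ q = t ∨ r = t
  · rw [if_neg, if_pos h]
    simp; tauto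
  · rw [if_pos, if_neg h]
    · simp [Z, List.toFinset_cons, mul_assoc]
    · simp; tauto

theorem symSerre2_A (d : ℤ) (hd : d ≠ 0) {p q t : P}
    (h1 : cartB n (D.col p) (D.col q) = 2 * d) (h2 : cartB n (D.col p) (D.col t) = -d)
    (h3 : cartB n (D.col q) (D.col t) = -d) (hpt : p ≠ t) (hqt : q ≠ t) :
    symSerre2 (vpow d + (vpow d)⁻¹) (D.A n p) (D.A n q) (D.A n t) = 0 := by
  have huw : vt T d * vt T (-d) = 1 := by rw [← vt_add, add_neg_cancel, vt_zero]
  have hc : algebraMap KK T (vpow d + (vpow d)⁻¹) = vt T d + vt T (-d) := by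
    rw [map_add, vt, vt]; simp [vpow]
  simp only [symSerre2, serre2, A_mul_A_mul_A, KK_smul_eq, hc]
  by_cases hpq : p = q
  · simp [hpq]
  · have e1 : ({p, t, q} : Finset P) = {p, q, t} := by ext; simp; tauto
    have e2 : ({t, p, q} : Finset P) = {p, q, t} := by ext; simp; tauto
    have e3 : ({q, p, t} : Finset P) = {p, q, t} := by ext; simp; tauto
    have e4 : ({q, t, p} : Finset P) = {p, q, t} := by ext; simp; tauto
    have e5 : ({t, q, p} : Finset P) = {p, q, t} := by ext; simp; tauto
    simp only [hpq, Ne.symm hpq, hpt, hqt, hpt.symm, hqt.symm, or_self, if_false, e1, e2, e3, e4,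
      e5, smul_smul]
    generalize D.Bop n {p, q, t} = X
    have hadd : ∀ a b : T, a • X + b • X = (a + b) • X := fun a b => (add_smul a b X).symm
    have hsub : ∀ a b : T, a • X - b • X = (a - b) • X := fun a b => (sub_smul a b X).symm
    simp only [hadd, hsub]
    have h1' := h1; have h2' := h2; have h3' := h3
    rw [cartB_comm] at h1' h2' h3'
    rw [D.zeta_eq n (p := p) (q := q) (by omega), D.zeta_eq n (p := q) (q := p) (by omega),
      D.zeta_eq n (p := p) (q := t) (by omega), D.zeta_eq n (p := t) (q := p) (by omega),
      D.zeta_eq n (p := q) (q := t) (by omega), D.zeta_eq n (p := t) (q := q) (by omega)]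
    simp only [h1, h2, h3, h1', h2', h3', D.sgn_swap hpq, D.sgn_swap hpt, D.sgn_swap hqt]
    have := serre2_poly (vt T d) (vt T (-d)) (D.x p : T) (D.x q) (D.x t) huw
    have h2d : vt T (2 * d) = vt T d ^ 2 := by rw [two_mul, vt_add, sq]
    rw [h2d]
    refine (congrArg (fun c : T => c • X) ?_).trans (zero_smul T X)
    linear_combination (D.sgn p q * D.sgn p t * D.sgn q t) * this

set_option maxHeartbeats 1000000 in
theorem symSerre3_A {p q r t : P}
    (h1 : cartB n (D.col p) (D.col q) = 2) (h2 : cartB n (D.col p) (D.col r) = 2)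
    (h3 : cartB n (D.col q) (D.col r) = 2) (h4 : cartB n (D.col p) (D.col t) = -2)
    (h5 : cartB n (D.col q) (D.col t) = -2) (h6 : cartB n (D.col r) (D.col t) = -2)
    (hpt : p ≠ t) (hqt : q ≠ t) (hrt : r ≠ t) :
    symSerre3 (vpow 1 ^ 2 + 1 + (vpow 1)⁻¹ ^ 2) (D.A n p) (D.A n q) (D.A n r) (D.A n t) = 0 := by
  have huw : vt T 2 * vt T (-2) = 1 := by rw [← vt_add, add_neg_cancel, vt_zero]
  have hc : algebraMap KK T (vpow 1 ^ 2 + 1 + (vpow 1)⁻¹ ^ 2) = vt T 2 + 1 + vt T (-2) := by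
    have e1 : vpow 1 ^ 2 = vpow 2 := by simp only [vpow, zpow_one]; rfl
    have e2 : (vpow 1)⁻¹ ^ 2 = vpow (-2) := by simp only [vpow, zpow_one, zpow_neg, inv_pow]; rfl
    rw [map_add, map_add, vt, vt, map_one, e1, e2]
  simp only [symSerre3, serre3, A_mul_A_mul_A_mul_A, KK_smul_eq, hc]
  by_cases hpq : p = q
  · simp [hpq]
  by_cases hpr : p = r
  · simp [hpr]
  by_cases hqr : q = r
  · simp [hqr]
  simp only [hpq, Ne.symm hpq, hpr, Ne.symm hpr, hqr, Ne.symm hqr, hpt, hqt, hrt, hpt.symm,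
    hqt.symm, hrt.symm, or_self, if_false]
  simp only [Finset.insert_eq, Finset.union_comm, Finset.union_left_comm, smul_smul]
  generalize D.Bop n _ = X
  have hadd : ∀ a b : T, a • X + b • X = (a + b) • X := fun a b => (add_smul a b X).symm
  have hsub : ∀ a b : T, a • X - b • X = (a - b) • X := fun a b => (sub_smul a b X).symm
  simp only [hadd, hsub]
  have h1' := h1; have h2' := h2; have h3' := h3
  have h4' := h4; have h5' := h5; have h6' := h6
  rw [cartB_comm] at h1' h2' h3' h4' h5' h6'
  refine (congrArg (fun c : T => c • X) ?_).trans (zero_smul T X)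
  rw [D.zeta_eq n (p := p) (q := q) (by omega), D.zeta_eq n (p := q) (q := p) (by omega),
    D.zeta_eq n (p := p) (q := t) (by omega), D.zeta_eq n (p := t) (q := p) (by omega),
    D.zeta_eq n (p := q) (q := t) (by omega), D.zeta_eq n (p := t) (q := q) (by omega),
    D.zeta_eq n (p := p) (q := r) (by omega), D.zeta_eq n (p := r) (q := p) (by omega),
    D.zeta_eq n (p := q) (q := r) (by omega), D.zeta_eq n (p := r) (q := q) (by omega),
    D.zeta_eq n (p := r) (q := t) (by omega), D.zeta_eq n (p := t) (q := r) (by omega)]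
  simp only [h1, h2, h3, h4, h5, h6, h1', h2', h3', h4', h5', h6', D.sgn_swap hpq, D.sgn_swap hpt,
    D.sgn_swap hqt, D.sgn_swap hpr, D.sgn_swap hqr, D.sgn_swap hrt]
  have := serre3_poly (vt T 2) (vt T (-2)) (D.x p : T) (D.x q) (D.x r) (D.x t) huw
  simp only [serrePoly] at this
  generalize vt T 2 + 1 + vt T (-2) = c at this ⊢
  generalize vt T 2 = u at this ⊢
  generalize vt T (-2) = w at this ⊢
  generalize (D.x p : T) = xp at this ⊢
  generalize (D.x q : T) = xq at this ⊢
  generalize (D.x r : T) = xr at this ⊢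
  generalize (D.x t : T) = xt at this ⊢
  generalize D.sgn p q = s1
  generalize D.sgn p r = s2
  generalize D.sgn q r = s3
  generalize D.sgn p t = s4
  generalize D.sgn q t = s5
  generalize D.sgn r t = s6
  linear_combination (-s1 * s2 * s3 * s4 * s5 * s6) * this

end Pts
end Ops

section Ops
variable {P T : Type} [LinearOrder P] [CommRing T] [Algebra KK T] (n : ℕ) (D : Pts P T)
  (U : Finset P)

namespace Pts

/-- the operator representing the generator `e_{c,r}`. -/
def L (c : ℕ) (r : ℤ) : Module.End T (Finset P → T) :=
  ∑ p ∈ U with D.col p = c, ((D.x p ^ r : Tˣ) : T) • D.A n p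

theorem L_mem_span (c : ℕ) (r : ℤ) :
    D.L n U c r ∈ Submodule.span T {X | ∃ p, D.col p = c ∧ X = D.A n p} :=
  Submodule.sum_mem _ fun p hp => Submodule.smul_mem _ _
    (Submodule.subset_span ⟨p, (Finset.mem_filter.1 hp).2, rfl⟩)

theorem L_loop (i j : ℕ) (hi : i ≤ n) (hj : j ≤ n) (r s : ℤ) :
    D.L n U i (r + 1) * D.L n U j s
        - vpow ((dC n i : ℤ) * aC n i j) • (D.L n U i r * D.L n U j (s + 1)) =
      vpow ((dC n i : ℤ) * aC n i j) • (D.L n U j s * D.L n U i (r + 1))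
        - D.L n U j (s + 1) * D.L n U i r := by
  rw [dC_mul_aC hi hj]
  simp only [L, KK_smul_eq, Finset.sum_mul, Finset.mul_sum, Finset.smul_sum]
  rw [Finset.sum_comm (s := U.filter (D.col · = j)), Finset.sum_comm (s := U.filter (D.col · = j)),
    ← Finset.sum_sub_distrib, ← Finset.sum_sub_distrib]
  refine Finset.sum_congr rfl fun p hp => ?_
  rw [← Finset.sum_sub_distrib, ← Finset.sum_sub_distrib]
  refine Finset.sum_congr rfl fun q hq => ?_
  have h := D.A_mul_A_swap n p q
  rw [(Finset.mem_filter.1 hp).2, (Finset.mem_filter.1 hq).2] at h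
  simp only [smul_mul_assoc, mul_smul_comm, zpow_add, zpow_one, Units.val_mul]
  have h2 := congrArg (fun X => (((D.x p ^ r : Tˣ) : T) * ((D.x q ^ s : Tˣ) : T)) • X) h
  have hsub : ∀ (a b : T) (X : Module.End T (Finset P → T)), (a - b) • X = a • X - b • X :=
    fun a b X => sub_smul a b X
  simp only [hsub, smul_sub, smul_smul] at h2 ⊢
  rw [vt] at h2
  convert h2 using 3 <;> ring

theorem L_comm (i j : ℕ) (h : cartB n i j = 0) (r s : ℤ) :
    D.L n U i r * D.L n U j s = D.L n U j s * D.L n U i r := by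
  have h' : cartB n j i = 0 := by rwa [cartB_comm]
  simp only [L, Finset.sum_mul, Finset.mul_sum]
  rw [Finset.sum_comm]
  refine Finset.sum_congr rfl fun p hp => Finset.sum_congr rfl fun q hq => ?_
  have hp := (Finset.mem_filter.1 hp).2
  have hq := (Finset.mem_filter.1 hq).2
  simp only [smul_mul_assoc, mul_smul_comm, A_mul_A, zeta, hp, hq, h, h', Finset.pair_comm p q,
    if_true, eq_comm (a := p) (b := q)]
  exact smul_comm _ _ _

theorem L_serre (i j : Fin n) (hij : i ≠ j)
    (φ : FA n →ₐ[KK] Module.End T (Finset P → T))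
    (hφ : ∀ i r, φ (fg n i r) = D.L n U (i.1 + 1) r) :
    ∀ m : ℕ, m = (1 - aC n (i.1 + 1) (j.1 + 1)).toNat → ∀ (r : Fin m → ℤ) (t : ℤ),
      φ (serreElt n (dC n) i j m r t) = 0 := by
  intro m hm r t
  have hd : (dC n (i.1 + 1) : ℤ) ≠ 0 := by unfold dC; split_ifs <;> simp
  have hi := i.2
  have hj := j.2
  have hij' : i.1 + 1 ≠ j.1 + 1 := fun h => hij (Fin.ext (by omega))
  have hB := dC_mul_aC (n := n) (i := i.1 + 1) (j := j.1 + 1) (by omega) (by omega)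
  have hB' := dC_mul_aC (n := n) (i := i.1 + 1) (j := i.1 + 1) (by omega) (by omega)
  have hii : aC n (i.1 + 1) (i.1 + 1) = 2 := by simp [aC]
  have hcol : ∀ {p t : P}, D.col p = i.1 + 1 → D.col t = j.1 + 1 → p ≠ t := by
    rintro p t hp ht rfl
    exact hij' (hp.symm.trans ht)
  have hcases : aC n (i.1 + 1) (j.1 + 1) = 0 ∨ aC n (i.1 + 1) (j.1 + 1) = -1 ∨
      (aC n (i.1 + 1) (j.1 + 1) = -2 ∧ dC n (i.1 + 1) = 1) := by
    unfold aC dC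
    split_ifs <;> omega
  rcases hcases with h | h | ⟨h, h'⟩
  · obtain rfl : m = 1 := by rw [hm, h]; rfl
    rw [serreElt_one n (dC n) i j hd, map_sub, map_mul, map_mul, hφ, hφ, sub_eq_zero]
    apply L_comm
    rw [cartB_comm, ← hB, h, mul_zero]
  · obtain rfl : m = 2 := by rw [hm, h]; rfl
    rw [serreElt_two n (dC n) i j hd, sum_perm_two]
    simp only [serre2, map_add, map_sub, map_mul, map_smul, hφ]
    refine symSerre2_span (T := T) (c := vpow (dC n (i.1 + 1)) + (vpow (dC n (i.1 + 1)))⁻¹)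
      ?_ (D.L_mem_span n U _ _) (D.L_mem_span n U _ _) (D.L_mem_span n U _ _)
    rintro _ ⟨p, hp, rfl⟩ _ ⟨q, hq, rfl⟩ _ ⟨t, ht, rfl⟩
    refine D.symSerre2_A n _ hd ?_ ?_ ?_ (hcol hp ht) (hcol hq ht)
    · rw [hp, hq, ← hB', hii]; ring
    · rw [hp, ht, ← hB, h]; ring
    · rw [hq, ht, ← hB, h]; ring
  · obtain rfl : m = 3 := by rw [hm, h]; rfl
    rw [serreElt_three n (dC n) i j hd, sum_perm_three (fun a b c => serre3 _ (fg n i (r a))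
      (fg n i (r b)) (fg n i (r c)) (fg n j t)), h']
    rw [h'] at hB hB'
    simp only [serre3, map_add, map_sub, map_mul, map_smul, hφ]
    refine symSerre3_span (T := T) (c := vpow 1 ^ 2 + 1 + (vpow 1)⁻¹ ^ 2) ?_
      (D.L_mem_span n U _ _) (D.L_mem_span n U _ _) (D.L_mem_span n U _ _) (D.L_mem_span n U _ _)
    rintro _ ⟨p, hp, rfl⟩ _ ⟨q, hq, rfl⟩ _ ⟨w, hw, rfl⟩ _ ⟨t, ht, rfl⟩
    refine D.symSerre3_A n ?_ ?_ ?_ ?_ ?_ ?_ (hcol hp ht) (hcol hq ht) (hcol hw ht) <;>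
      simp only [hp, hq, hw, ht, ← hB, ← hB', hii, h] <;> norm_num

/-- the evaluation homomorphism attached to a configuration of points. -/
def ev : UC n →ₐ[KK] Module.End T (Finset P → T) :=
  RingQuot.liftAlgHom KK (s := URel n (aC n) (dC n))
    ⟨FreeAlgebra.lift KK fun p : Fin n × ℤ => D.L n U (p.1.1 + 1) p.2, by
      have hφ : ∀ (i : Fin n) (r : ℤ), (FreeAlgebra.lift KK fun p : Fin n × ℤ =>
          D.L n U (p.1.1 + 1) p.2) (fg n i r) = D.L n U (i.1 + 1) r := fun i r => by
        rw [fg, FreeAlgebra.lift_ι_apply]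
      intro x y h
      induction h with
      | loop i j r s =>
        simp only [map_sub, map_mul, map_smul, hφ]
        exact D.L_loop n U _ _ (by omega) (by omega) r s
      | serre i j hij r t =>
        rw [map_zero]
        exact D.L_serre n U i j hij _ hφ _ rfl r t⟩

theorem ev_ug (i : Fin n) (r : ℤ) : D.ev n U (ug n (aC n) (dC n) i r) = D.L n U (i.1 + 1) r := by
  rw [ev, ug, RingQuot.liftAlgHom_mkAlgHom_apply]
  change FreeAlgebra.lift KK _ _ = _
  rw [fg, FreeAlgebra.lift_ι_apply]

theorem ev_genC {i : ℕ} (h1 : 1 ≤ i) (h2 : i ≤ n) (r : ℤ) :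
    D.ev n U (genC n i r) = D.L n U i r := by
  rw [genC, g1, dif_pos ⟨h1, h2⟩, ev_ug]
  congr 1
  simp; omega

end Pts
end Ops

theorem adjoin_ug (n : ℕ) (A : ℕ → ℕ → ℤ) (Dd : ℕ → ℕ) :
    Algebra.adjoin KK (Set.range fun p : Fin n × ℤ => ug n A Dd p.1 p.2) = ⊤ := by
  have h1 : (Set.range fun p : Fin n × ℤ => ug n A Dd p.1 p.2) =
      RingQuot.mkAlgHom KK (URel n A Dd) '' Set.range (FreeAlgebra.ι KK) := by
    rw [← Set.range_comp]; rfl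
  rw [h1, ← AlgHom.map_adjoin, FreeAlgebra.adjoin_range_ι, Algebra.map_top,
    AlgHom.range_eq_top]
  exact RingQuot.mkAlgHom_surjective _ _

section Ops
variable {P T : Type} [LinearOrder P] [CommRing T] [Algebra KK T] (n : ℕ) (D : Pts P T)
  (U : Finset P)

namespace Pts

theorem ev_mem_span (u : UC n) :
    D.ev n U u ∈ Submodule.span T
      {X : Module.End T (Finset P → T) | ∃ l : List P, l.Nodup ∧
        X = D.Z n l • D.Bop n l.toFinset} := by
  have h1 : D.ev n U u ∈ Algebra.adjoin T (Set.range (D.A n)) := by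
    have hu : u ∈ Algebra.adjoin KK
      (Set.range fun p : Fin n × ℤ => ug n (aC n) (dC n) p.1 p.2) := by
        rw [adjoin_ug]; trivial
    induction hu using Algebra.adjoin_induction with
    | mem x hx =>
      obtain ⟨p, rfl⟩ := hx
      change D.ev n U (ug n (aC n) (dC n) p.1 p.2) ∈ _
      rw [ev_ug]
      exact Subalgebra.sum_mem _ fun p _ =>
        Subalgebra.smul_mem _ (Algebra.subset_adjoin (Set.mem_range_self p)) _
    | algebraMap r =>
      rw [AlgHom.commutes, Algebra.algebraMap_eq_smul_one, KK_smul_eq]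
      exact Subalgebra.smul_mem _ (one_mem _) _
    | add x y _ _ hx hy => rw [map_add]; exact add_mem hx hy
    | mul x y _ _ hx hy => rw [map_mul]; exact mul_mem hx hy
  rw [← Subalgebra.mem_toSubmodule, Algebra.adjoin_eq_span] at h1
  refine Submodule.span_le.2 ?_ h1
  intro X hX
  obtain ⟨l, hl, rfl⟩ := Submonoid.exists_list_of_mem_closure hX
  obtain ⟨l', rfl⟩ : ∃ l' : List P, l'.map (D.A n) = l := by
    clear h1 hX
    induction l with
    | nil => exact ⟨[], rfl⟩
    | cons a l ih =>
      obtain ⟨p, rfl⟩ := hl a (by simp)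
      obtain ⟨l', rfl⟩ := ih fun y hy => hl y (by simp [hy])
      exact ⟨p :: l', rfl⟩
  rw [word_eq]
  split_ifs with hl'
  · exact Submodule.subset_span ⟨l', hl', rfl⟩
  · exact Submodule.zero_mem _

/-- the vacuum function, supported at the empty set of points. -/
def vac : Finset P → T := fun S => if S = ∅ then 1 else 0

/-- the value of an element of the algebra at a set of points. -/
def Phi (S : Finset P) (u : UC n) : T := D.ev n U u vac S

theorem Bop_vac (F S : Finset P) : D.Bop n F vac S = if F = S then 1 else 0 := by
  rw [Bop_apply]
  by_cases h : F ⊆ S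
  · by_cases h' : F = S
    · subst h'
      simp [cross, vac]
    · rw [if_pos h, if_neg h', vac, if_neg, mul_zero]
      rw [Finset.sdiff_eq_empty_iff_subset]
      exact fun h2 => h' (h.antisymm h2)
  · rw [if_neg h, if_neg]
    rintro rfl
    exact h subset_rfl

theorem ev_apply_eq_sum (u : UC n) (f : Finset P → T) (S : Finset P) :
    D.ev n U u f S =
      ∑ F ∈ S.powerset, D.Phi n U F u * (D.cross n F (S \ F) * f (S \ F)) := by
  have h := D.ev_mem_span n U u
  unfold Phi
  generalize D.ev n U u = X at h ⊢
  induction h using Submodule.span_induction with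
  | mem X hX =>
    obtain ⟨l, hl, rfl⟩ := hX
    simp only [LinearMap.smul_apply, Pi.smul_apply, smul_eq_mul, Bop_vac, mul_ite, mul_one,
      mul_zero, ite_mul, zero_mul, Finset.sum_ite_eq, Finset.mem_powerset]
    rw [Bop_apply, mul_ite, mul_zero]
  | zero => simp
  | add X Y _ _ hX hY =>
    simp only [LinearMap.add_apply, Pi.add_apply, hX, hY, add_mul, Finset.sum_add_distrib]
  | smul c X _ hX =>
    simp only [LinearMap.smul_apply, Pi.smul_apply, hX, smul_eq_mul, mul_assoc, Finset.mul_sum]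

theorem Phi_mul (u w : UC n) (S : Finset P) :
    D.Phi n U S (u * w) =
      ∑ F ∈ S.powerset, D.Phi n U F u * (D.cross n F (S \ F) * D.Phi n U (S \ F) w) := by
  rw [Phi, map_mul, Module.End.mul_apply, ev_apply_eq_sum]
  rfl

theorem Phi_mem_ideal (u : UC n) (S : Finset P) :
    D.Phi n U S u ∈ Ideal.span {z : T | ∃ l : List P, l.Nodup ∧ l.toFinset = S ∧ z = D.Z n l} := by
  have h := D.ev_mem_span n U u
  unfold Phi
  generalize D.ev n U u = X at h ⊢
  induction h using Submodule.span_induction with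
  | mem X hX =>
    obtain ⟨l, hl, rfl⟩ := hX
    simp only [LinearMap.smul_apply, Pi.smul_apply, smul_eq_mul, Bop_vac, mul_ite, mul_one,
      mul_zero]
    split_ifs with h
    · exact Ideal.subset_span ⟨l, hl, h, rfl⟩
    · exact zero_mem _
  | zero => simp
  | add X Y _ _ hX hY => exact add_mem hX hY
  | smul c X _ hX => exact Ideal.mul_mem_left _ c hX

theorem Phi_add (u w : UC n) (S : Finset P) :
    D.Phi n U S (u + w) = D.Phi n U S u + D.Phi n U S w := by
  rw [Phi, map_add]; rfl

theorem Phi_sub (u w : UC n) (S : Finset P) :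
    D.Phi n U S (u - w) = D.Phi n U S u - D.Phi n U S w := by
  rw [Phi, map_sub]; rfl

theorem Phi_smul (c : KK) (u : UC n) (S : Finset P) :
    D.Phi n U S (c • u) = c • D.Phi n U S u := by
  rw [Phi, map_smul]; rfl

theorem Phi_one (S : Finset P) : D.Phi n U S 1 = if S = ∅ then 1 else 0 := by
  rw [Phi, map_one]; rfl

/-- the value map as a linear map. -/
def PhiL (S : Finset P) : UC n →ₗ[KK] T where
  toFun := D.Phi n U S
  map_add' u w := D.Phi_add n U u w S
  map_smul' c u := D.Phi_smul n U c u S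

theorem A_vac (p : P) (S : Finset P) : D.A n p vac S = if S = {p} then 1 else 0 := by
  rw [A_apply]
  by_cases h : p ∈ S
  · by_cases h' : S = {p}
    · subst h'; simp [vac]
    · rw [if_pos h, if_neg h', vac, if_neg, mul_zero]
      intro h2
      apply h'
      rw [← Finset.insert_erase h, h2]; rfl
  · rw [if_neg h, if_neg]
    rintro rfl
    simp at h

theorem Phi_gen_singleton {i : ℕ} (h1 : 1 ≤ i) (h2 : i ≤ n) (r : ℤ) {p : P} (hp : p ∈ U)
    (hc : D.col p = i) : D.Phi n U {p} (genC n i r) = ((D.x p ^ r : Tˣ) : T) := by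
  rw [Phi, ev_genC n D U h1 h2, L]
  simp only [LinearMap.sum_apply, Finset.sum_apply, LinearMap.smul_apply, Pi.smul_apply, A_vac,
    smul_eq_mul, mul_ite, mul_one, mul_zero, Finset.singleton_inj]
  rw [Finset.sum_ite_eq, if_pos]
  simp [hp, hc]

theorem Phi_gen_ne_zero {i : ℕ} (h1 : 1 ≤ i) (h2 : i ≤ n) (r : ℤ) {S : Finset P}
    (h : D.Phi n U S (genC n i r) ≠ 0) : ∃ p ∈ U, S = {p} ∧ D.col p = i := by
  rw [Phi, ev_genC n D U h1 h2, L] at h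
  simp only [LinearMap.sum_apply, Finset.sum_apply, LinearMap.smul_apply, Pi.smul_apply, A_vac,
    smul_eq_mul, mul_ite, mul_one, mul_zero] at h
  obtain ⟨p, hp, h⟩ := Finset.exists_ne_zero_of_sum_ne_zero h
  rw [Finset.mem_filter] at hp
  exact ⟨p, hp.1, by by_contra h'; exact h (if_neg h'), hp.2⟩

/-- `u` is supported on sets of points with colour multiset `m`. -/
def HasWt (u : UC n) (m : Multiset ℕ) : Prop :=
  ∀ S, D.Phi n U S u ≠ 0 → S.val.map D.col = m

variable {n D U}

theorem HasWt.mul {u w : UC n} {m m' : Multiset ℕ} (hu : D.HasWt n U u m)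
    (hw : D.HasWt n U w m') : D.HasWt n U (u * w) (m + m') := by
  intro S hS
  rw [Phi_mul] at hS
  obtain ⟨F, hF, h⟩ := Finset.exists_ne_zero_of_sum_ne_zero hS
  rw [← hu F (left_ne_zero_of_mul h), ← hw (S \ F) (right_ne_zero_of_mul (right_ne_zero_of_mul h)),
    ← Multiset.map_add]
  congr 1
  have hF := Finset.mem_powerset.1 hF
  have := Finset.disjUnion_val F (S \ F) Finset.disjoint_sdiff
  rw [← this, Finset.disjUnion_eq_union, Finset.union_sdiff_of_subset hF]

theorem HasWt.sub {u w : UC n} {m : Multiset ℕ} (hu : D.HasWt n U u m)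
    (hw : D.HasWt n U w m) : D.HasWt n U (u - w) m := by
  intro S hS
  rw [Phi_sub] at hS
  by_cases h : D.Phi n U S u = 0
  · exact hw S fun h' => hS (by rw [h, h', sub_zero])
  · exact hu S h

theorem HasWt.smul {u : UC n} {m : Multiset ℕ} (c : KK) (hu : D.HasWt n U u m) :
    D.HasWt n U (c • u) m := by
  intro S hS
  rw [Phi_smul] at hS
  exact hu S fun h => hS (by rw [h, smul_zero])

theorem hasWt_gen {i : ℕ} (h1 : 1 ≤ i) (h2 : i ≤ n) (r : ℤ) :
    D.HasWt n U (genC n i r) {i} := by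
  intro S hS
  obtain ⟨p, -, rfl, rfl⟩ := D.Phi_gen_ne_zero n U h1 h2 r hS
  simp

end Pts
end Ops

/-! ### The points used for evaluation -/

/-- labels of the evaluation points: a site, a chain within the site, a place in the chain. -/
def Pnt : Type := ℕ ×ₗ (Bool ×ₗ ℕ)

instance : LinearOrder Pnt := inferInstanceAs (LinearOrder (ℕ ×ₗ (Bool ×ₗ ℕ)))

/-- the label with the given components. -/
def pt (k : ℕ) (b : Bool) (q : ℕ) : Pnt := toLex (k, toLex (b, q))

theorem pt_inj {k k' : ℕ} {b b' : Bool} {q q' : ℕ} :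
    pt k b q = pt k' b' q' ↔ k = k' ∧ b = b' ∧ q = q' := by
  unfold pt Pnt
  rw [EmbeddingLike.apply_eq_iff_eq, Prod.mk.injEq, EmbeddingLike.apply_eq_iff_eq, Prod.mk.injEq]

theorem exists_pt (p : Pnt) : ∃ k b q, p = pt k b q :=
  ⟨(ofLex p).1, (ofLex (ofLex p).2).1, (ofLex (ofLex p).2).2, rfl⟩

theorem pt_lt {k k' : ℕ} {b b' : Bool} {q q' : ℕ} :
    pt k b q < pt k' b' q' ↔ k < k' ∨ k = k' ∧ (b < b' ∨ b = b' ∧ q < q') := by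
  change (toLex (k, toLex (b, q)) : ℕ ×ₗ (Bool ×ₗ ℕ)) < toLex (k', toLex (b', q')) ↔ _
  rw [Prod.Lex.toLex_lt_toLex]
  simp only [Prod.Lex.toLex_lt_toLex]

/-- the colour of the `q`-th place of a chain. -/
def pcol (n q : ℕ) : ℕ := if q ≤ n then q else 2 * n - q

/-- the exponent of the `q`-th place of a chain. -/
def peps (n q : ℕ) : ℤ := if q < n then q else if q = n then n + 1 else q + 2

/-- the image of `v` in the group of units of a `ℚ(v)`-algebra. -/
def vu (T : Type) [CommRing T] [Algebra KK T] : Tˣ :=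
  Units.map (algebraMap KK T).toMonoidHom (Units.mk0 vv vv_ne_zero)

section Conf
variable {T : Type} [CommRing T] [Algebra KK T] (n : ℕ) (a η : ℕ → Tˣ)

theorem vu_zpow (m : ℤ) : ((vu T ^ m : Tˣ) : T) = vt T m := by
  have h : vu T ^ m = Units.map (algebraMap KK T).toMonoidHom (Units.mk0 vv vv_ne_zero ^ m) :=
    (map_zpow _ _ _).symm
  rw [h, Units.coe_map, Units.val_zpow_eq_zpow_val]
  rfl

/-- the base position of a chain. -/
def cbase (k : ℕ) (b : Bool) : Tˣ := if b then vu T ^ (-2 : ℤ) * η k * a k else a k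

/-- the configuration of evaluation points with parameters `a` and `η`. -/
def conf : Pts Pnt T where
  col p := pcol n (ofLex (ofLex p).2).2
  x p := cbase a η (ofLex p).1 (ofLex (ofLex p).2).1 * vu T ^ (-peps n (ofLex (ofLex p).2).2)

theorem conf_col (k : ℕ) (b : Bool) (q : ℕ) : (conf n a η).col (pt k b q) = pcol n q := rfl

theorem conf_x (k : ℕ) (b : Bool) (q : ℕ) :
    (conf n a η).x (pt k b q) = cbase a η k b * vu T ^ (-peps n q) := rfl

/-- structure factor between two places of the same chain, later place first. -/
theorem zeta_chain_gt {k : ℕ} {b : Bool} {q q' : ℕ} (h : q' < q)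
    (hB : cartB n (pcol n q) (pcol n q') ≠ 0) :
    (conf n a η).zeta n (pt k b q) (pt k b q') =
      algebraMap KK T (vpow (cartB n (pcol n q) (pcol n q')) - vpow (peps n q - peps n q')) := by
  rw [Pts.zeta, conf_col, conf_col, if_neg hB, if_neg, conf_x, conf_x, map_sub, ← Units.val_mul]
  · change _ - _ = vt T _ - vt T _
    rw [← vu_zpow (peps n q - peps n q')]
    congr 2
    rw [mul_inv, mul_mul_mul_comm, mul_inv_cancel, one_mul, ← zpow_neg, ← zpow_add]
    congr 1; ring
  · rw [pt_lt]; simp; omega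

theorem zeta_of_cartB_zero {p q : Pnt} (h : cartB n ((conf n a η).col p) ((conf n a η).col q) = 0) :
    (conf n a η).zeta n p q = 1 := if_pos h

/-- structure factor between two places of the same chain, earlier place first. -/
theorem zeta_chain_lt {k : ℕ} {b : Bool} {q q' : ℕ} (h : q < q')
    (hB : cartB n (pcol n q) (pcol n q') ≠ 0) :
    (conf n a η).zeta n (pt k b q) (pt k b q') =
      algebraMap KK T (1 - vpow (cartB n (pcol n q) (pcol n q') + peps n q' - peps n q)) := by
  rw [Pts.zeta, conf_col, conf_col, if_neg hB, if_pos, conf_x, conf_x, map_sub, map_one, mul_assoc,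
    ← Units.val_mul]
  · change _ - _ = _ - vt T _
    rw [add_sub_assoc, vt_add, ← vu_zpow (peps n q' - peps n q)]
    congr 3
    rw [mul_inv, mul_mul_mul_comm, mul_inv_cancel, one_mul, ← zpow_neg, ← zpow_add]
    congr 1; ring
  · rw [pt_lt]; simp; omega

theorem zeta_succ (hn : 2 ≤ n) {k : ℕ} {b : Bool} {q : ℕ} (h : q + 2 ≤ 2 * n) :
    (conf n a η).zeta n (pt k b q) (pt k b (q + 1)) = 0 := by
  have key : cartB n (pcol n q) (pcol n (q + 1)) + peps n (q + 1) - peps n q = 0 ∧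
      cartB n (pcol n q) (pcol n (q + 1)) ≠ 0 := by
    unfold cartB pcol peps
    split_ifs <;> omega
  rw [zeta_chain_lt n a η (Nat.lt_succ_self q) key.2, key.1, vpow_zero, sub_self, map_zero]

/-- structure factor between the two chains of a site. -/
theorem zeta_cross (k q q' : ℕ) (hB : cartB n (pcol n q) (pcol n q') ≠ 0) :
    (conf n a η).zeta n (pt k false q) (pt k true q') =
      1 - vt T (cartB n (pcol n q) (pcol n q') + peps n q' - peps n q + 2) *
        (((η k)⁻¹ : Tˣ) : T) := by
  rw [Pts.zeta, conf_col, conf_col, if_neg hB, if_pos, conf_x, conf_x, mul_assoc, ← Units.val_mul,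
    add_sub_assoc, add_assoc, vt_add, ← vu_zpow (peps n q' - peps n q + 2),
    mul_assoc (vt T _) (Units.val (_ ^ _)), ← Units.val_mul]
  · congr 3
    simp only [cbase, if_true, Bool.false_eq_true, if_false, mul_inv, ← zpow_neg, neg_neg]
    rw [show peps n q' - peps n q + 2 = -peps n q + 2 + peps n q' by ring, zpow_add, zpow_add]
    have := mul_inv_cancel (a k)
    calc a k * vu T ^ (-peps n q) * (vu T ^ (2 : ℤ) * (η k)⁻¹ * (a k)⁻¹ * vu T ^ peps n q')
        = (a k * (a k)⁻¹) * (vu T ^ (-peps n q) * vu T ^ (2 : ℤ) * vu T ^ peps n q' * (η k)⁻¹) := by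
          simp only [mul_assoc, mul_comm, mul_left_comm]
      _ = _ := by rw [this, one_mul]
  · rw [pt_lt]; simp

theorem zeta_cross_back (hn : 2 ≤ n) (k q : ℕ) (hq : q < n) :
    (((η k : Tˣ) : T) - 1) ∣ (conf n a η).zeta n (pt k true q) (pt k false q) := by
  have hB : cartB n (pcol n q) (pcol n q) = 2 := by
    unfold cartB pcol; split_ifs <;> omega
  rw [Pts.zeta, conf_col, conf_col, if_neg (by omega), if_neg (by rw [pt_lt]; simp), conf_x,
    conf_x, hB, ← Units.val_mul]
  have : cbase a η k false * vu T ^ (-peps n q) * (cbase a η k true * vu T ^ (-peps n q))⁻¹ =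
      vu T ^ (2 : ℤ) * (η k)⁻¹ := by
    simp only [cbase, if_true, Bool.false_eq_true, if_false, mul_inv, ← zpow_neg, neg_neg]
    have h1 := mul_inv_cancel (a k)
    have h2 : vu T ^ (-peps n q) * vu T ^ (peps n q) = 1 := by rw [zpow_neg, inv_mul_cancel]
    calc a k * vu T ^ (-peps n q) * (vu T ^ (2 : ℤ) * (η k)⁻¹ * (a k)⁻¹ * vu T ^ peps n q)
        = (a k * (a k)⁻¹) * (vu T ^ (-peps n q) * vu T ^ peps n q)
            * (vu T ^ (2 : ℤ) * (η k)⁻¹) := by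
          simp only [mul_assoc, mul_comm, mul_left_comm]
      _ = _ := by rw [h1, h2, one_mul, one_mul]
  rw [this, Units.val_mul, vu_zpow]
  have h3 : ((η k : Tˣ) : T) * (((η k)⁻¹ : Tˣ) : T) = 1 := Units.mul_inv _
  exact ⟨vt T 2 * (((η k)⁻¹ : Tˣ) : T), by linear_combination (-vt T 2) * h3⟩

theorem zeta_cross_succ (k q : ℕ) (hq : q + 1 < n) :
    (conf n a η).zeta n (pt k false (q + 1)) (pt k true q) =
      (((η k : Tˣ) : T) - 1) * (((η k)⁻¹ : Tˣ) : T) := by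
  have key : cartB n (pcol n (q + 1)) (pcol n q) + peps n q - peps n (q + 1) + 2 = 0 ∧
      cartB n (pcol n (q + 1)) (pcol n q) ≠ 0 := by
    unfold cartB pcol peps
    split_ifs <;> omega
  rw [zeta_cross n a η k _ _ key.2, key.1, vt_zero]
  have h3 : ((η k : Tˣ) : T) * (((η k)⁻¹ : Tˣ) : T) = 1 := Units.mul_inv _
  linear_combination -h3

end Conf

/-! ### Divisibility of products of structure factors -/

section Ops
variable {P T : Type} [LinearOrder P] [CommRing T] [Algebra KK T] (n : ℕ) (D : Pts P T)
  (U : Finset P)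

namespace Pts

theorem Z_append (l₁ l₂ : List P) (h₁ : l₁.Nodup) (h₂ : l₂.Nodup) :
    D.Z n (l₁ ++ l₂) = D.Z n l₁ * (D.cross n l₁.toFinset l₂.toFinset * D.Z n l₂) := by
  induction l₁ with
  | nil => simp [Z, cross]
  | cons p l ih =>
    rw [List.nodup_cons] at h₁
    rw [List.cons_append, Z, Z, ih h₁.2, List.map_append, List.prod_append, List.toFinset_cons,
      cross, cross, Finset.prod_insert (by simpa using h₁.1), List.prod_toFinset _ h₂]
    ring

theorem prod_dvd_Z (l : List P) (hl : l.Nodup) (E : Finset (P × P))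
    (hE : ∀ e ∈ E, e.2 ∈ l ∧ l.idxOf e.1 < l.idxOf e.2) :
    (∏ e ∈ E, D.zeta n e.1 e.2) ∣ D.Z n l := by
  induction l generalizing E with
  | nil =>
    have : E = ∅ := Finset.eq_empty_of_forall_notMem fun e he => by simpa using (hE e he).1
    simp [this, Z]
  | cons p l ih =>
    rw [List.nodup_cons] at hl
    rw [Z, ← Finset.prod_filter_mul_prod_filter_not E (fun e => e.1 = p)]
    refine mul_dvd_mul ?_ (ih hl.2 _ ?_)
    · rw [← List.prod_toFinset _ hl.2]
      have h1 : ∏ e ∈ E.filter (fun e => e.1 = p), D.zeta n e.1 e.2 =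
          ∏ q ∈ (E.filter (fun e => e.1 = p)).image Prod.snd, D.zeta n p q := by
        rw [Finset.prod_image]
        · exact Finset.prod_congr rfl fun e he => by rw [(Finset.mem_filter.1 he).2]
        · intro e he e' he' h
          exact Prod.ext ((Finset.mem_filter.1 he).2.trans (Finset.mem_filter.1 he').2.symm) h
      rw [h1]
      refine Finset.prod_dvd_prod_of_subset _ _ _ fun q hq => ?_
      obtain ⟨e, he, rfl⟩ := Finset.mem_image.1 hq
      obtain ⟨he, h⟩ := Finset.mem_filter.1 he
      obtain ⟨h2, h3⟩ := hE e he
      rcases List.mem_cons.1 h2 with h4 | h4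
      · rw [h4, h] at h3; exact absurd h3 (lt_irrefl _)
      · simpa using h4
    · intro e he
      obtain ⟨he, h⟩ := Finset.mem_filter.1 he
      obtain ⟨h2, h3⟩ := hE e he
      have h4 : e.2 ≠ p := by
        rintro h4
        rw [h4, List.idxOf_cons_self] at h3
        exact absurd h3 (Nat.not_lt_zero _)
      rw [List.idxOf_cons_ne _ (Ne.symm h), List.idxOf_cons_ne _ (Ne.symm h4)] at h3
      exact ⟨(List.mem_cons.1 h2).resolve_left h4, Nat.lt_of_succ_lt_succ h3⟩

theorem idxOf_lt_of_Z_ne_zero {l : List P} (hl : l.Nodup) (hZ : D.Z n l ≠ 0) {p q : P} (hp : p ∈ l)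
    (hq : q ∈ l) (hpq : p ≠ q) (h0 : D.zeta n p q = 0) : l.idxOf q < l.idxOf p := by
  by_contra h
  have h1 : l.idxOf p ≠ l.idxOf q := fun h => hpq ((List.idxOf_inj hp).1 h)
  have := D.prod_dvd_Z n l hl {(p, q)} (by
    intro e he
    rw [Finset.mem_singleton] at he
    subst he
    exact ⟨hq, by change l.idxOf p < l.idxOf q; omega⟩)
  rw [Finset.prod_singleton, h0, zero_dvd_iff] at this
  exact hZ this

theorem Phi_mul_Phi_eq_zero (u w : UC n) (F G : Finset P)
    (h : ∀ l₁ l₂ : List P, l₁.Nodup → l₂.Nodup → l₁.toFinset = F → l₂.toFinset = G →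
      D.Z n l₁ * (D.cross n F G * D.Z n l₂) = 0) :
    D.Phi n U F u * (D.cross n F G * D.Phi n U G w) = 0 := by
  have h1 := D.Phi_mem_ideal n U u F
  have h2 := D.Phi_mem_ideal n U w G
  generalize D.Phi n U F u = X at h1 ⊢
  generalize D.Phi n U G w = Y at h2 ⊢
  induction h1 using Submodule.span_induction with
  | mem X hX =>
    obtain ⟨l, hl, hlF, rfl⟩ := hX
    induction h2 using Submodule.span_induction with
    | mem Y hY =>
      obtain ⟨l', hl', hlG, rfl⟩ := hY
      exact h l l' hl hl' hlF hlG
    | zero => simp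
    | add a b _ _ ha hb => rw [mul_add, mul_add, ha, hb, add_zero]
    | smul c a _ ha => rw [smul_eq_mul, mul_left_comm _ c, mul_left_comm _ c, ha, mul_zero]
  | zero => simp
  | add a b _ _ ha hb => rw [add_mul, ha, hb, add_zero]
  | smul c a _ ha => rw [smul_eq_mul, mul_assoc, ha, mul_zero]

end Pts
end Ops

theorem mem_left_of_idxOf_lt {P : Type} [DecidableEq P] {l₁ l₂ : List P} {p q : P} (hp : p ∈ l₁)
    (h : (l₁ ++ l₂).idxOf q < (l₁ ++ l₂).idxOf p) : q ∈ l₁ := by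
  by_contra hq
  rw [List.idxOf_append_of_mem hp, List.idxOf_append_of_notMem hq] at h
  have := List.idxOf_lt_length_iff.2 hp
  omega

section ConfZ
variable {T : Type} [CommRing T] [Algebra KK T] (n : ℕ) (a η : ℕ → Tˣ)

theorem idxOf_succ_lt (hn : 2 ≤ n) {l : List Pnt} (hl : l.Nodup) (hZ : (conf n a η).Z n l ≠ 0)
    {k : ℕ} {b : Bool} {q : ℕ} (h : q + 2 ≤ 2 * n) (h1 : pt k b q ∈ l) (h2 : pt k b (q + 1) ∈ l) :
    l.idxOf (pt k b (q + 1)) < l.idxOf (pt k b q) :=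
  (conf n a η).idxOf_lt_of_Z_ne_zero n hl hZ h1 h2 (by rw [Ne, pt_inj]; omega)
    (zeta_succ n a η hn h)

theorem idxOf_chain_lt (hn : 2 ≤ n) {l : List Pnt} (hl : l.Nodup) (hZ : (conf n a η).Z n l ≠ 0)
    {k i : ℕ} (hi : i < n) (hη : ((η k : T) - 1) ^ (n - i) = 0)
    (hA : ∀ q, i ≤ q → q < n → pt k false q ∈ l) (hB : ∀ q, i ≤ q → q < n → pt k true q ∈ l)
    {q : ℕ} (hq : i ≤ q) (hq' : q < n) :
    l.idxOf (pt k false q) < l.idxOf (pt k true q) := by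
  classical
  by_contra hlt
  set bf : ℕ → Prop := fun q => l.idxOf (pt k true q) < l.idxOf (pt k false q) with hbf
  set bg : ℕ → Prop := fun q => l.idxOf (pt k false (q + 1)) < l.idxOf (pt k true q) with hbg
  set QX := (Finset.Ico i n).filter bf with hQX
  set QY := (Finset.Ico i (n - 1)).filter bg with hQY
  have hne : ∀ q, i ≤ q → q < n → l.idxOf (pt k false q) ≠ l.idxOf (pt k true q) :=
    fun q h h' h2 => by
      have := (List.idxOf_inj (hA q h h')).1 h2
      rw [pt_inj] at this; simp at this
  have hqX : q ∈ QX := by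
    rw [hQX, Finset.mem_filter, Finset.mem_Ico]
    exact ⟨⟨hq, hq'⟩, by have := hne q hq hq'; simp only [hbf]; omega⟩
  have hU : Finset.Ico i (n - 1) ⊆ QX ∪ QY := by
    intro q h
    rw [Finset.mem_Ico] at h
    rw [Finset.mem_union, hQX, hQY, Finset.mem_filter, Finset.mem_filter, Finset.mem_Ico,
      Finset.mem_Ico]
    by_cases hx : bf q
    · exact Or.inl ⟨⟨h.1, by omega⟩, hx⟩
    · refine Or.inr ⟨h, ?_⟩
      have h1 := hne q h.1 (by omega)
      have h2 := idxOf_succ_lt n a η hn hl hZ (by omega) (hA q h.1 (by omega))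
        (hA (q + 1) (by omega) (by omega))
      simp only [hbf] at hx
      simp only [hbg]
      omega
  have hcard : n - i ≤ QX.card + QY.card := by
    rw [← Finset.card_union_add_card_inter]
    have h1 := Finset.card_le_card hU
    rw [Nat.card_Ico] at h1
    by_cases hx : n - 1 ∈ QX
    · have h2 : Finset.Ico i n ⊆ QX ∪ QY := by
        intro q h
        rw [Finset.mem_Ico] at h
        rcases Nat.lt_or_ge q (n - 1) with h3 | h3
        · exact hU (Finset.mem_Ico.2 ⟨h.1, h3⟩)
        · exact Finset.mem_union_left _ ((show q = n - 1 by omega) ▸ hx)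
      have h3 := Finset.card_le_card h2
      rw [Nat.card_Ico] at h3
      omega
    · have h2 : 0 < (QX ∩ QY).card := by
        obtain ⟨m, hm, hmax⟩ := QX.exists_max_image id ⟨q, hqX⟩
        refine Finset.card_pos.2 ⟨m, Finset.mem_inter.2 ⟨hm, ?_⟩⟩
        have hm' := hm
        rw [hQX, Finset.mem_filter, Finset.mem_Ico] at hm
        have hm1 : m ≠ n - 1 := fun h => hx (h ▸ hm')
        have hm2 : m + 1 ∉ QX := fun h => by have := hmax _ h; simp at this
        rw [hQX, Finset.mem_filter, Finset.mem_Ico] at hm2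
        rw [hQY, Finset.mem_filter, Finset.mem_Ico]
        refine ⟨⟨hm.1.1, by omega⟩, ?_⟩
        have h1 := hne (m + 1) (by omega) (by omega)
        have h2 := idxOf_succ_lt n a η hn hl hZ (by omega) (hB m hm.1.1 (by omega))
          (hB (m + 1) (by omega) (by omega))
        have h3 : ¬ bf (m + 1) := fun h => hm2 ⟨by omega, h⟩
        simp only [hbf] at h3
        simp only [hbg]
        omega
      omega
  have hE := (conf n a η).prod_dvd_Z n l hl
    (QX.image (fun q => (pt k true q, pt k false q)) ∪
      QY.image (fun q => (pt k false (q + 1), pt k true q))) (by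
    intro e he
    rcases Finset.mem_union.1 he with he | he
    · obtain ⟨q, hq, rfl⟩ := Finset.mem_image.1 he
      rw [hQX, Finset.mem_filter, Finset.mem_Ico] at hq
      exact ⟨hA q hq.1.1 hq.1.2, by simpa [hbf] using hq.2⟩
    · obtain ⟨q, hq, rfl⟩ := Finset.mem_image.1 he
      rw [hQY, Finset.mem_filter, Finset.mem_Ico] at hq
      exact ⟨hB q hq.1.1 (by omega), by simpa [hbg] using hq.2⟩)
  rw [Finset.prod_union, Finset.prod_image, Finset.prod_image] at hE
  · have h1 : ((η k : T) - 1) ^ QX.card ∣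
        ∏ q ∈ QX, (conf n a η).zeta n (pt k true q) (pt k false q) := by
      rw [← Finset.prod_const]
      refine Finset.prod_dvd_prod_of_dvd _ _ fun q hq => zeta_cross_back n a η hn k q ?_
      rw [hQX, Finset.mem_filter, Finset.mem_Ico] at hq
      omega
    have h2 : ((η k : T) - 1) ^ QY.card ∣
        ∏ q ∈ QY, (conf n a η).zeta n (pt k false (q + 1)) (pt k true q) := by
      rw [← Finset.prod_const]
      refine Finset.prod_dvd_prod_of_dvd _ _ fun q hq => ?_
      rw [hQY, Finset.mem_filter, Finset.mem_Ico] at hq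
      rw [zeta_cross_succ n a η k q (by omega)]
      exact Dvd.intro _ rfl
    have h4 := mul_dvd_mul h1 h2
    rw [← pow_add] at h4
    have h3 := (pow_dvd_pow ((η k : T) - 1) hcard).trans (h4.trans hE)
    rw [hη, zero_dvd_iff] at h3
    exact hZ h3
  · intro q _ q' _ h
    simp only [Prod.mk.injEq, pt_inj] at h
    omega
  · intro q _ q' _ h
    simp only [Prod.mk.injEq, pt_inj] at h
    omega
  · rw [Finset.disjoint_left]
    intro e he he'
    obtain ⟨q, -, rfl⟩ := Finset.mem_image.1 he
    obtain ⟨q', -, h⟩ := Finset.mem_image.1 he'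
    simp [pt_inj] at h

end ConfZ

/-! ### The sites attached to positive roots -/

section Roots
variable {n : ℕ}

theorem ri_pos (γ : PosRootC n) : 1 ≤ ri γ := γ.2.1

theorem rt_add_le (γ : PosRootC n) : rt γ + 2 * ri γ ≤ 2 * n := γ.2.2.2

theorem rt_eq_zero (γ : PosRootC n) (h : ri γ = n) : rt γ = 0 := γ.2.2.1 h

theorem root_ext {γ δ : PosRootC n} (h : ri γ = ri δ) (h' : rt γ = rt δ) : γ = δ := by
  apply Subtype.ext
  apply ofLex.injective
  exact Prod.ext (Fin.ext h) (Fin.ext h')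

theorem root_le_iff {γ δ : PosRootC n} :
    γ ≤ δ ↔ ri γ < ri δ ∨ ri γ = ri δ ∧ rt γ ≤ rt δ := by
  rw [← Subtype.coe_le_coe, Prod.Lex.le_iff]
  unfold ri rt
  rw [Fin.lt_def, Fin.le_def, Fin.ext_iff]

/-- the last place of the first chain of a root. -/
def rend (γ : PosRootC n) : ℕ := if ri γ + rt γ ≤ n then ri γ + rt γ else ri γ + rt γ - 1

theorem ri_le_rend (γ : PosRootC n) : ri γ ≤ rend γ := by
  have := rt_add_le γ
  unfold rend; split_ifs <;> omega

theorem rend_lt (γ : PosRootC n) (h : n < rend γ) : rend γ + ri γ < 2 * n := by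
  have := rt_add_le γ
  unfold rend at h ⊢
  split_ifs at h ⊢ <;> omega

theorem rend_le (γ : PosRootC n) : rend γ + ri γ ≤ 2 * n := by
  have := rt_add_le γ
  unfold rend
  split_ifs <;> omega

theorem ri_le (γ : PosRootC n) : ri γ ≤ n := by have := rt_add_le γ; omega

/-- one place after the last place of the second chain of a root. -/
def bend (γ : PosRootC n) : ℕ := if isINI γ then n else ri γ

end Roots

/-- the places `i, …, j - 1` of a chain. -/
def seg (k : ℕ) (b : Bool) (i j : ℕ) : Finset Pnt := (Finset.Ico i j).image (pt k b)

theorem mem_seg {k k' : ℕ} {b b' : Bool} {i j q : ℕ} :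
    pt k' b' q ∈ seg k b i j ↔ k' = k ∧ b' = b ∧ i ≤ q ∧ q < j := by
  unfold seg
  simp only [Finset.mem_image, Finset.mem_Ico, pt_inj]
  constructor
  · rintro ⟨q', h, rfl, rfl, rfl⟩; exact ⟨rfl, rfl, h⟩
  · rintro ⟨rfl, rfl, h⟩; exact ⟨q, h, rfl, rfl, rfl⟩

theorem card_seg (k : ℕ) (b : Bool) (i j : ℕ) : (seg k b i j).card = j - i := by
  unfold seg
  rw [Finset.card_image_of_injective _ (fun q q' h => (pt_inj.1 h).2.2), Nat.card_Ico]

/-- the colour of a label. -/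
def pc (n : ℕ) (p : Pnt) : ℕ := pcol n (ofLex (ofLex p).2).2

theorem pc_pt (n k : ℕ) (b : Bool) (q : ℕ) : pc n (pt k b q) = pcol n q := rfl

section Sites
variable {n : ℕ}

/-- the labels of the first chain of a site. -/
def siteA (γ : PosRootC n) (k : ℕ) : Finset Pnt := seg k false (ri γ) (rend γ + 1)
/-- the labels of the second chain of a site. -/
def siteB (γ : PosRootC n) (k : ℕ) : Finset Pnt := seg k true (ri γ) (bend γ)
/-- the labels of a site. -/
def site (γ : PosRootC n) (k : ℕ) : Finset Pnt := siteA γ k ∪ siteB γ k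

theorem siteA_disj (γ : PosRootC n) (k : ℕ) : Disjoint (siteA γ k) (siteB γ k) := by
  rw [Finset.disjoint_left]
  intro p
  obtain ⟨k', b, q, rfl⟩ := exists_pt p
  rw [siteA, siteB, mem_seg, mem_seg]
  rintro ⟨-, rfl, -⟩ ⟨-, h, -⟩
  exact absurd h (by simp)

theorem mem_site {γ : PosRootC n} {k k' : ℕ} {b : Bool} {q : ℕ} :
    pt k' b q ∈ site γ k ↔ k' = k ∧ ri γ ≤ q ∧ (b = false ∧ q ≤ rend γ ∨ b = true ∧ q < bend γ) := by
  rw [site, Finset.mem_union, siteA, siteB, mem_seg, mem_seg, Nat.lt_succ_iff]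
  tauto

theorem card_site (γ : PosRootC n) (k : ℕ) :
    (site γ k).card = rend γ + 1 - ri γ + (bend γ - ri γ) := by
  rw [site, Finset.card_union_of_disjoint (siteA_disj γ k), siteA, siteB, card_seg, card_seg]

/-- the labels of several sites. -/
def sites (β : ℕ → PosRootC n) (A : Finset ℕ) : Finset Pnt := A.biUnion fun k => site (β k) k

theorem mem_sites {β : ℕ → PosRootC n} {A : Finset ℕ} {k : ℕ} {b : Bool} {q : ℕ} :
    pt k b q ∈ sites β A ↔ k ∈ A ∧ pt k b q ∈ site (β k) k := by
  unfold sites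
  rw [Finset.mem_biUnion]
  constructor
  · rintro ⟨k', h, h'⟩
    obtain rfl := (mem_site.1 h').1
    exact ⟨h, h'⟩
  · rintro ⟨h, h'⟩; exact ⟨k, h, h'⟩

theorem pcol_eq_ri {γ : PosRootC n} {q i : ℕ} (hi : i ≤ ri γ) (h1 : ri γ ≤ q) (h2 : q ≤ rend γ)
    (h : pcol n q = i) : q = i ∧ ri γ = i := by
  have h3 := rend_lt γ
  unfold pcol at h
  split_ifs at h <;> omega

theorem bend_le_rend (γ : PosRootC n) : bend γ ≤ rend γ := by
  have := ri_le_rend γ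
  unfold bend
  split_ifs with h
  · unfold isINI at h
    unfold rend
    rw [if_pos (by omega)]
    omega
  · exact this

/-- a set of labels which is compatible with the order of the factors. -/
structure IsClosedIn (S F : Finset Pnt) : Prop where
  subset : F ⊆ S
  succ_mem : ∀ k b q, pt k b q ∈ F → pt k b (q + 1) ∈ S → pt k b (q + 1) ∈ F
  fst_mem : ∀ k q, pt k true q ∈ F → pt k false q ∈ F

theorem IsClosedIn.seg_subset {S F : Finset Pnt} (h : IsClosedIn S F) {k : ℕ} {b : Bool}
    {i j : ℕ} (hi : pt k b i ∈ F) (hS : seg k b i j ⊆ S) : seg k b i j ⊆ F := by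
  intro p hp
  obtain ⟨k', b', q, rfl⟩ := exists_pt p
  obtain ⟨rfl, rfl, h1, h2⟩ := mem_seg.1 hp
  clear hp
  obtain ⟨m, rfl⟩ := Nat.exists_eq_add_of_le h1
  clear h1
  induction m with
  | zero => exact hi
  | succ m ih =>
    exact h.succ_mem _ _ _ (ih (Nat.lt_of_succ_lt h2)) (hS (mem_seg.2 ⟨rfl, rfl, Nat.le_add_right i (m + 1), h2⟩))

theorem card_filter_eq_of_map_eq {P : Type} {F G : Finset P} {f : P → ℕ}
    (h : F.val.map f = G.val.map f) (c : ℕ) :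
    (F.filter (fun p => f p = c)).card = (G.filter (fun p => f p = c)).card := by
  have := congrArg (Multiset.count c) h
  rw [Multiset.count_map, Multiset.count_map] at this
  simp only [eq_comm (a := c)] at this
  exact this

theorem eq_site_of_isClosedIn {β : ℕ → PosRootC n} {A : Finset ℕ} {F : Finset Pnt}
    (hF : IsClosedIn (sites β A) F) {γ : PosRootC n} (hγ : ∀ k ∈ A, γ ≤ β k)
    (hc : F.val.map (pc n) = (site γ 0).val.map (pc n)) :
    ∃ k ∈ A, β k = γ ∧ F = site (β k) k := by
  have hcard : F.card = (site γ 0).card := by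
    have := congrArg Multiset.card hc
    simpa using this
  have hrn : ri γ ≤ n := ri_le γ
  have hpt : ∀ p ∈ F, pc n p = ri γ → ∃ k b, p = pt k b (ri γ) ∧ k ∈ A ∧ ri (β k) = ri γ ∧
      siteA (β k) k ⊆ F := by
    intro p hp hpc
    obtain ⟨k, b, q, rfl⟩ := exists_pt p
    obtain ⟨hk, hs⟩ := mem_sites.1 (hF.subset hp)
    obtain ⟨-, h1, h2⟩ := mem_site.1 hs
    have h4 := bend_le_rend (β k)
    have h3 := root_le_iff.1 (hγ k hk)
    obtain ⟨rfl, h5⟩ := pcol_eq_ri (γ := β k) (by omega) h1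
      (by rcases h2 with h2 | h2 <;> omega) hpc
    refine ⟨k, b, rfl, hk, h5, ?_⟩
    have h6 : pt k false (ri γ) ∈ F := by
      cases b
      · exact hp
      · exact hF.fst_mem _ _ hp
    rw [siteA, h5]
    refine hF.seg_subset h6 ?_
    intro p hp
    obtain ⟨k', b', q, rfl⟩ := exists_pt p
    obtain ⟨rfl, rfl, h7⟩ := mem_seg.1 hp
    exact mem_sites.2 ⟨hk, mem_site.2 ⟨rfl, by omega, Or.inl ⟨rfl, by omega⟩⟩⟩
  have hfc := card_filter_eq_of_map_eq hc
  have hpcr : pcol n (ri γ) = ri γ := by unfold pcol; rw [if_pos hrn]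
  have hpcn : pcol n n = n := by unfold pcol; rw [if_pos le_rfl]
  have hle := ri_le_rend γ
  by_cases hI : isINI γ
  · have hI' := hI
    unfold isINI at hI'
    have hrend : rend γ = n := by unfold rend; rw [if_pos (by omega)]; omega
    have hbend : bend γ = n := by unfold bend; rw [if_pos hI]
    have h1 : 1 < (F.filter (fun p => pc n p = ri γ)).card := by
      rw [hfc, Finset.one_lt_card]
      refine ⟨pt 0 false (ri γ), ?_, pt 0 true (ri γ), ?_, ?_⟩
      · rw [Finset.mem_filter]
        exact ⟨mem_site.2 ⟨rfl, le_rfl, Or.inl ⟨rfl, by omega⟩⟩, hpcr⟩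
      · rw [Finset.mem_filter]
        exact ⟨mem_site.2 ⟨rfl, le_rfl, Or.inr ⟨rfl, by omega⟩⟩, hpcr⟩
      · rw [Ne, pt_inj]; simp
    have h2 : (F.filter (fun p => pc n p = n)).card ≤ 1 := by
      rw [hfc, Finset.card_le_one]
      have : ∀ p ∈ (site γ 0).filter (fun p => pc n p = n), p = pt 0 false n := by
        intro p hp
        obtain ⟨k, b, q, rfl⟩ := exists_pt p
        rw [Finset.mem_filter, mem_site, pc_pt, pcol] at hp
        rw [pt_inj]
        obtain ⟨⟨h3, h4, h5⟩, h6⟩ := hp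
        refine ⟨h3, ?_⟩
        split_ifs at h6 <;> rcases h5 with h5 | h5 <;> first | exact ⟨h5.1, by omega⟩ | omega
      intro p hp q hq
      rw [this p hp, this q hq]
    obtain ⟨p, hp, p', hp', hne⟩ := Finset.one_lt_card.1 h1
    rw [Finset.mem_filter] at hp hp'
    obtain ⟨k, b, rfl, hk, hr, hs⟩ := hpt p hp.1 hp.2
    obtain ⟨k', b', rfl, hk', hr', hs'⟩ := hpt p' hp'.1 hp'.2
    have hrend' : ∀ j ∈ A, ri (β j) = ri γ → n ≤ rend (β j) := by
      intro j hj hj'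
      have := root_le_iff.1 (hγ j hj)
      unfold rend
      split_ifs <;> omega
    have hkk : k = k' := by
      have h3 := Finset.card_le_one.1 h2 (pt k false n)
        (by rw [Finset.mem_filter]
            have := hrend' k hk hr
            exact ⟨hs (mem_seg.2 ⟨rfl, rfl, by omega, by omega⟩), hpcn⟩) (pt k' false n)
        (by rw [Finset.mem_filter]
            have := hrend' k' hk' hr'
            exact ⟨hs' (mem_seg.2 ⟨rfl, rfl, by omega, by omega⟩), hpcn⟩)
      exact (pt_inj.1 h3).1
    subst hkk
    have hbt : pt k true (ri γ) ∈ F := by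
      cases b
      · cases b'
        · exact absurd rfl hne
        · exact hp'.1
      · exact hp.1
    have h4 := (mem_site.1 (mem_sites.1 (hF.subset hbt)).2).2.2
    have h5 : ri γ < bend (β k) := by simpa using h4
    have h6 : isINI (β k) := by
      by_contra h
      rw [bend, if_neg h] at h5
      omega
    have h7 : β k = γ := by
      unfold isINI at h6
      exact root_ext hr (by omega)
    refine ⟨k, hk, h7, ?_⟩
    refine (Finset.eq_of_subset_of_card_le ?_ ?_).symm
    · refine Finset.union_subset hs ?_
      rw [siteB, hr]
      refine hF.seg_subset hbt ?_
      intro p hp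
      obtain ⟨k', b', q, rfl⟩ := exists_pt p
      obtain ⟨rfl, rfl, h7⟩ := mem_seg.1 hp
      exact mem_sites.2 ⟨hk, mem_site.2 ⟨rfl, by omega, Or.inr ⟨rfl, by omega⟩⟩⟩
    · rw [hcard, card_site, card_site, h7]
  · have hbend : bend γ = ri γ := by unfold bend; rw [if_neg hI]
    have h1 : 0 < (F.filter (fun p => pc n p = ri γ)).card := by
      rw [hfc, Finset.card_pos]
      refine ⟨pt 0 false (ri γ), ?_⟩
      rw [Finset.mem_filter]
      exact ⟨mem_site.2 ⟨rfl, le_rfl, Or.inl ⟨rfl, by omega⟩⟩, hpcr⟩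
    obtain ⟨p, hp⟩ := Finset.card_pos.1 h1
    rw [Finset.mem_filter] at hp
    obtain ⟨k, b, rfl, hk, hr, hs⟩ := hpt p hp.1 hp.2
    have h2 := Finset.card_le_card hs
    rw [hcard, card_site, hbend, siteA, card_seg] at h2
    have h3 := root_le_iff.1 (hγ k hk)
    have h6 := rt_eq_zero (β k)
    have h10 := ri_pos γ
    have h7 : rt (β k) = rt γ := by
      unfold isINI at hI
      unfold rend at h2 hle
      split_ifs at h2 hle <;> omega
    have h8 : β k = γ := root_ext hr h7
    refine ⟨k, hk, h8, ?_⟩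
    have h9 : siteA (β k) k = F := by
      refine Finset.eq_of_subset_of_card_le hs ?_
      rw [hcard, card_site, siteA, card_seg, h8]
      omega
    rw [site, siteB, h8, hbend, ← h9, h8]
    simp [seg]

end Sites

section Closed
variable {n : ℕ} {T : Type} [CommRing T] [Algebra KK T] (a η : ℕ → Tˣ)

theorem isClosedIn_of_ne_zero (hn : 2 ≤ n) (U : Finset Pnt) (β : ℕ → PosRootC n) (A : Finset ℕ)
    (hη : ∀ k ∈ A, isINI (β k) → ((η k : T) - 1) ^ (n - ri (β k)) = 0) (u w : UC n)
    {F : Finset Pnt} (hF : F ⊆ sites β A)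
    (h : (conf n a η).Phi n U F u * ((conf n a η).cross n F (sites β A \ F) *
      (conf n a η).Phi n U (sites β A \ F) w) ≠ 0) : IsClosedIn (sites β A) F := by
  have h1 := mt ((conf n a η).Phi_mul_Phi_eq_zero n U u w F (sites β A \ F)) h
  push Not at h1
  obtain ⟨l₁, l₂, hl₁, hl₂, rfl, hF₂, hZ⟩ := h1
  rw [← hF₂, ← Pts.Z_append _ _ _ _ hl₁ hl₂] at hZ
  have hl : (l₁ ++ l₂).Nodup := by
    refine List.Nodup.append hl₁ hl₂ ?_
    intro p h1 h2
    rw [← List.mem_toFinset, hF₂, Finset.mem_sdiff, List.mem_toFinset] at h2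
    exact h2.2 h1
  have hmem : ∀ p, p ∈ l₁ ++ l₂ ↔ p ∈ sites β A := by
    intro p
    rw [List.mem_append, ← List.mem_toFinset (l := l₂), hF₂, Finset.mem_sdiff, List.mem_toFinset]
    constructor
    · rintro (h | h)
      · exact hF (List.mem_toFinset.2 h)
      · exact h.1
    · intro h
      by_cases h' : p ∈ l₁
      · exact Or.inl h'
      · exact Or.inr ⟨h, h'⟩
  refine ⟨hF, ?_, ?_⟩
  · intro k b q hq hS
    rw [List.mem_toFinset] at hq ⊢
    refine mem_left_of_idxOf_lt hq (idxOf_succ_lt n a η hn hl hZ ?_ ?_ ?_)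
    · have h2 := (mem_site.1 (mem_sites.1 hS).2).2.2
      have h3 := rend_le (β k)
      have h4 := bend_le_rend (β k)
      have h5 := ri_pos (β k)
      rcases h2 with h2 | h2 <;> omega
    · exact List.mem_append_left _ hq
    · exact (hmem _).2 hS
  · intro k q hq
    have h1 := mem_sites.1 (hF hq)
    have h2 := (mem_site.1 h1.2).2
    have h3 : q < bend (β k) := by simpa using h2.2
    have h4 : isINI (β k) := by
      by_contra h
      rw [bend, if_neg h] at h3
      omega
    rw [bend, if_pos h4] at h3
    have hrend : rend (β k) = n := by
      unfold rend
      unfold isINI at h4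
      rw [if_pos (by omega)]
      exact h4.1
    rw [List.mem_toFinset] at hq ⊢
    refine mem_left_of_idxOf_lt hq (idxOf_chain_lt n a η hn hl hZ h4.2 (hη k h1.1 h4) ?_ ?_
      h2.1 h3)
    · intro q h5 h6
      exact (hmem _).2 (mem_sites.2 ⟨h1.1, mem_site.2 ⟨rfl, h5, Or.inl ⟨rfl, by omega⟩⟩⟩)
    · intro q h5 h6
      exact (hmem _).2 (mem_sites.2 ⟨h1.1, mem_site.2 ⟨rfl, h5, Or.inr ⟨rfl, by
        rw [bend, if_pos h4]; exact h6⟩⟩⟩)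

end Closed

/-! ### Evaluation of the quantum root vectors of chain type -/

section Chains
variable (n : ℕ)

/-- iterated `q`-brackets along a word. -/
inductive IsCh : List ℕ → ℤ → UC n → Prop
  | single (j : ℕ) (r : ℤ) : IsCh [j] r (genC n j r)
  | snoc (w : List ℕ) (s : ℤ) (E : UC n) (j : ℕ) (r : ℤ) (l : KK) (h : IsCh w s E)
      (hl : IsVpow l) : IsCh (w ++ [j]) (s + r) (E * genC n j r - l • (genC n j r * E))

theorem IsCh.foldl {w : List ℕ} {s : ℤ} {E : UC n} (h : IsCh n w s E)
    (L : List ((ℕ × ℤ) × KK)) (hL : ∀ p ∈ L, IsVpow p.2) :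
    IsCh n (w ++ L.map (fun p => p.1.1)) (s + (L.map (fun p => p.1.2)).sum)
      (L.foldl (fun acc p => acc * genC n p.1.1 p.1.2 - p.2 • (genC n p.1.1 p.1.2 * acc)) E) := by
  induction L generalizing w s E with
  | nil => simpa using h
  | cons p L ih =>
    have := ih (IsCh.snoc w s E p.1.1 p.1.2 p.2 h (hL p List.mem_cons_self))
      (fun q hq => hL q (List.mem_cons_of_mem _ hq))
    simpa [add_assoc] using this

theorem isCh_chainE (w : List ℕ) (ss : List ℤ) (ls : List KK) (h1 : ss.length = w.length)
    (h2 : ls.length + 1 = w.length) (hl : ∀ l ∈ ls, IsVpow l) :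
    IsCh n w ss.sum (chainE (genC n) w ss ls) := by
  match w, ss, h1, h2 with
  | i :: w, s :: ss, h1, h2 =>
    simp only [List.length_cons, add_left_inj] at h1 h2
    have h3 := (IsCh.single (n := n) i s).foldl n ((w.zip ss).zip ls)
      (fun p hp => hl _ (List.of_mem_zip hp).2)
    have h4 : ((w.zip ss).zip ls).map Prod.fst = w.zip ss :=
      List.map_fst_zip (by rw [List.length_zip]; omega)
    have h5 : ((w.zip ss).zip ls).map (fun p => p.1.1) = w := by
      rw [show (fun p : (ℕ × ℤ) × KK => p.1.1) = Prod.fst ∘ Prod.fst from rfl, ← List.map_map, h4]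
      exact List.map_fst_zip (by omega)
    have h6 : ((w.zip ss).zip ls).map (fun p => p.1.2) = ss := by
      rw [show (fun p : (ℕ × ℤ) × KK => p.1.2) = Prod.snd ∘ Prod.fst from rfl, ← List.map_map, h4]
      exact List.map_snd_zip (by omega)
    rw [h5, h6] at h3
    simpa [chainE] using h3

theorem IsCh.ne_nil {w : List ℕ} {s : ℤ} {E : UC n} (h : IsCh n w s E) : w ≠ [] := by
  cases h <;> simp

theorem IsCh.hasWt {P T : Type} [LinearOrder P] [CommRing T] [Algebra KK T] {D : Pts P T}
    {U : Finset P} {w : List ℕ} {s : ℤ} {E : UC n} (h : IsCh n w s E)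
    (hw : ∀ j ∈ w, 1 ≤ j ∧ j ≤ n) : D.HasWt n U E (w : Multiset ℕ) := by
  induction h with
  | single j r =>
    obtain ⟨h1, h2⟩ := hw j (by simp)
    exact Pts.hasWt_gen h1 h2 r
  | snoc w s E j r l h hl ih =>
    obtain ⟨h1, h2⟩ := hw j (by simp)
    have h3 := ih fun j hj => hw j (by simp [hj])
    have h4 : ((w ++ [j] : List ℕ) : Multiset ℕ) = (w : Multiset ℕ) + {j} := rfl
    rw [h4]
    refine (h3.mul (Pts.hasWt_gen h1 h2 r)).sub (Pts.HasWt.smul _ ?_)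
    rw [add_comm]
    exact (Pts.hasWt_gen h1 h2 r).mul h3

end Chains

section Colours
variable {n : ℕ}

theorem pcol_mem {q : ℕ} (h1 : 1 ≤ q) (h2 : q < 2 * n) : 1 ≤ pcol n q ∧ pcol n q ≤ n := by
  unfold pcol; split_ifs <;> omega

/-- the scalar attached to two places of a chain. -/
def cgt (n q q' : ℕ) : KK :=
  if cartB n (pcol n q) (pcol n q') = 0 then 1
  else vpow (cartB n (pcol n q) (pcol n q')) - vpow (peps n q - peps n q')

theorem cgt_ne_zero {q q' : ℕ} (h : q' < q) (h2 : q < 2 * n) : cgt n q q' ≠ 0 := by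
  unfold cgt
  split_ifs with h0
  · exact one_ne_zero
  · rw [sub_ne_zero]
    intro h3
    have h4 := vpow_inj h3
    clear h3
    unfold cartB pcol peps at *
    split_ifs at * <;> omega

theorem zeta_eq_cgt {T : Type} [CommRing T] [Algebra KK T] (a η : ℕ → Tˣ) {k : ℕ} {b : Bool}
    {q q' : ℕ} (h : q' < q) :
    (conf n a η).zeta n (pt k b q) (pt k b q') = algebraMap KK T (cgt n q q') := by
  unfold cgt
  split_ifs with h0
  · rw [map_one]; exact zeta_of_cartB_zero n a η h0
  · exact zeta_chain_gt n a η h h0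

theorem seg_succ (k : ℕ) (b : Bool) (i L : ℕ) :
    seg k b i (i + (L + 1)) = insert (pt k b (i + L)) (seg k b i (i + L)) := by
  ext p
  obtain ⟨k', b', q, rfl⟩ := exists_pt p
  rw [Finset.mem_insert, mem_seg, mem_seg, pt_inj]
  constructor
  · rintro ⟨rfl, rfl, h1, h2⟩
    rcases Nat.lt_or_ge q (i + L) with h | h
    · exact Or.inr ⟨rfl, rfl, h1, h⟩
    · exact Or.inl ⟨rfl, rfl, by omega⟩
  · rintro (⟨rfl, rfl, rfl⟩ | ⟨rfl, rfl, h1, h2⟩)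
    · exact ⟨rfl, rfl, by omega, by omega⟩
    · exact ⟨rfl, rfl, by omega, by omega⟩

theorem notMem_seg (k : ℕ) (b : Bool) (i L : ℕ) : pt k b (i + L) ∉ seg k b i (i + L) := by
  rw [mem_seg]; omega

theorem seg_one (k : ℕ) (b : Bool) (i : ℕ) : seg k b i (i + 1) = {pt k b i} := by
  have := seg_succ k b i 0
  rw [show i + 0 = i from rfl, show 0 + 1 = 1 from rfl] at this
  rw [this]
  simp [seg]

theorem conf_x_zpow {T : Type} [CommRing T] [Algebra KK T] (a η : ℕ → Tˣ) (k : ℕ) (b : Bool)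
    (q : ℕ) (r : ℤ) : (((conf n a η).x (pt k b q) ^ r : Tˣ) : T) =
      algebraMap KK T (vpow (-peps n q * r)) * ((cbase a η k b ^ r : Tˣ) : T) := by
  rw [conf_x, mul_zpow, ← zpow_mul, Units.val_mul, vu_zpow, mul_comm]
  rfl

theorem IsCh.eval (hn : 2 ≤ n) {w : List ℕ} {s : ℤ} {E : UC n} (h : IsCh n w s E) {i L : ℕ}
    (hw : w = (List.range' i L).map (pcol n)) (hi : 1 ≤ i) (hin : i ≤ n)
    (hL : i + L ≤ n + 1 ∨ 2 * i + L ≤ 2 * n) :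
    ∃ u : KK, u ≠ 0 ∧ ∀ (T : Type) [CommRing T] [Algebra KK T] (a η : ℕ → Tˣ) (U : Finset Pnt)
      (k : ℕ) (b : Bool), seg k b i (i + L) ⊆ U → (conf n a η).Phi n U (seg k b i (i + L)) E =
        algebraMap KK T u * ((cbase a η k b ^ s : Tˣ) : T) := by
  induction h generalizing L with
  | single j r =>
    have hL1 : L = 1 := by
      have := congrArg List.length hw
      simpa using this.symm
    subst hL1
    have hj : pcol n i = j := by simpa using hw.symm
    refine ⟨vpow (-peps n i * r), vpow_ne_zero _, ?_⟩
    intro T _ _ a η U k b hU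
    rw [seg_one] at hU ⊢
    obtain ⟨h1, h2⟩ := pcol_mem (n := n) hi (by omega)
    rw [hj] at h1 h2
    rw [(conf n a η).Phi_gen_singleton n U h1 h2 r (hU (Finset.mem_singleton_self _)) hj,
      conf_x_zpow]
  | snoc w s E j r l h hl ih =>
    obtain ⟨m, rfl⟩ := hl
    have hlen := congrArg List.length hw
    obtain ⟨L, rfl⟩ : ∃ L', L = L' + 1 := ⟨L - 1, by simp at hlen; omega⟩
    rw [List.range'_concat, List.map_append, one_mul, List.map_singleton] at hw
    obtain ⟨hw1, hw2⟩ := List.append_inj' hw rfl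
    have hj : pcol n (i + L) = j := by simpa using hw2.symm
    have hL0 : 1 ≤ L := by
      rcases Nat.eq_zero_or_pos L with rfl | h0
      · exact absurd (by simpa using hw1) h.ne_nil
      · exact h0
    obtain ⟨u, hu, hE⟩ := ih hw1 (by omega)
    have htop : i + L < 2 * n := by omega
    refine ⟨-(vpow m * (vpow (-peps n (i + L) * r) *
      ((∏ q ∈ Finset.Ico i (i + L), cgt n (i + L) q) * u))), ?_, ?_⟩
    · refine neg_ne_zero.2 (mul_ne_zero (vpow_ne_zero _) (mul_ne_zero (vpow_ne_zero _)
        (mul_ne_zero (Finset.prod_ne_zero_iff.2 fun q hq => ?_) hu)))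
      rw [Finset.mem_Ico] at hq
      exact cgt_ne_zero hq.2 htop
    intro T _ _ a η U k b hU
    obtain ⟨h1, h2⟩ := pcol_mem (n := n) (q := i + L) (by omega) (by omega)
    rw [hj] at h1 h2
    have hpt : ∀ p ∈ seg k b i (i + (L + 1)), pc n p = j →
        ∃ q, p = pt k b q ∧ i < q ∧ q ≤ i + L := by
      intro p hp hpc
      obtain ⟨k', b', q, rfl⟩ := exists_pt p
      obtain ⟨rfl, rfl, h3, h4⟩ := mem_seg.1 hp
      refine ⟨q, rfl, ?_, by omega⟩
      rw [pc_pt] at hpc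
      rw [← hj] at hpc
      unfold pcol at hpc
      split_ifs at hpc <;> omega
    rw [Pts.Phi_sub, Pts.Phi_smul, Pts.Phi_mul, Pts.Phi_mul, Finset.sum_eq_zero,
      Finset.sum_eq_single {pt k b (i + L)}]
    · have hS : seg k b i (i + (L + 1)) \ {pt k b (i + L)} = seg k b i (i + L) := by
        rw [seg_succ, Finset.sdiff_singleton_eq_erase, Finset.erase_insert (notMem_seg k b i L)]
      have htopU : pt k b (i + L) ∈ U := hU (by rw [seg_succ]; exact Finset.mem_insert_self _ _)
      rw [hS, hE T a η U k b (fun p hp => hU (by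
          rw [seg_succ]; exact Finset.mem_insert_of_mem hp)),
        (conf n a η).Phi_gen_singleton n U h1 h2 r htopU hj, conf_x_zpow, Pts.cross,
        Finset.prod_singleton, seg, Finset.prod_image (fun q _ q' _ h => (pt_inj.1 h).2.2),
        Finset.prod_congr rfl (fun q hq => zeta_eq_cgt a η (Finset.mem_Ico.1 hq).2), zero_sub,
        zpow_add, Units.val_mul, Algebra.smul_def]
      simp only [map_neg, map_mul, map_prod]
      ring
    · intro F hF hne
      by_contra h0
      obtain ⟨p, hpU, rfl, hpc⟩ := (conf n a η).Phi_gen_ne_zero n U h1 h2 r (left_ne_zero_of_mul h0)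
      obtain ⟨q, rfl, h3, h4⟩ := hpt p (Finset.mem_powerset.1 hF (Finset.mem_singleton_self _)) hpc
      have h5 : q ≠ i + L := fun h => hne (by rw [h])
      apply h0
      rw [Pts.cross, Finset.prod_singleton, Finset.prod_eq_zero (i := pt k b (q + 1)) _
        (zeta_succ n a η hn (by omega))]
      · simp
      · rw [Finset.mem_sdiff, mem_seg, Finset.mem_singleton, pt_inj]
        exact ⟨⟨rfl, rfl, by omega, by omega⟩, by omega⟩
    · intro h0
      refine absurd (Finset.mem_powerset.2 (Finset.singleton_subset_iff.2 ?_)) h0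
      rw [seg_succ]; exact Finset.mem_insert_self _ _
    · intro F hF
      by_contra h0
      obtain ⟨p, hpU, hFp, hpc⟩ := (conf n a η).Phi_gen_ne_zero n U h1 h2 r
        (right_ne_zero_of_mul (right_ne_zero_of_mul h0))
      have hpS : p ∈ seg k b i (i + (L + 1)) \ F := by rw [hFp]; exact Finset.mem_singleton_self _
      obtain ⟨q, rfl, h3, h4⟩ := hpt p (Finset.mem_sdiff.1 hpS).1 hpc
      apply h0
      obtain ⟨q, rfl⟩ : ∃ q', q = q' + 1 := ⟨q - 1, by omega⟩
      have hq : pt k b q ∈ F := by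
        by_contra h5
        have : pt k b q ∈ seg k b i (i + (L + 1)) \ F :=
          Finset.mem_sdiff.2 ⟨mem_seg.2 ⟨rfl, rfl, by omega, by omega⟩, h5⟩
        rw [hFp, Finset.mem_singleton, pt_inj] at this
        omega
      rw [hFp, Pts.cross, Finset.prod_eq_zero hq]
      · simp
      · rw [Finset.prod_singleton, zeta_succ n a η hn (by omega)]

end Colours

/-! ### Evaluation of all quantum root vectors -/

section Words
variable {n : ℕ}

theorem wordC_of_not_isINI {γ : PosRootC n} (h : ¬isINI γ) :
    wordC γ = (List.range' (ri γ) (rend γ + 1 - ri γ)).map (pcol n) := by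
  have h1 := rt_add_le γ
  have h2 := rt_eq_zero γ
  have h3 := ri_le_rend γ
  unfold isINI at h
  unfold wordC rend
  dsimp only
  split_ifs with h4 h5 h6 h6 h7 h7 <;> try omega
  · refine List.ext_getElem (by simp; omega) ?_
    intro m hm hm'
    simp only [List.length_range'] at hm
    simp only [List.getElem_range', List.getElem_map, pcol]
    split_ifs <;> omega
  · refine List.ext_getElem (by simp; omega) ?_
    intro m hm hm'
    simp only [List.length_range'] at hm
    simp only [List.getElem_range', List.getElem_map, pcol]
    split_ifs <;> omega
  · refine List.ext_getElem (by simp; omega) ?_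
    intro m hm hm'
    simp only [List.length_append, List.length_reverse, List.length_range'] at hm
    simp only [List.getElem_append, List.getElem_reverse, List.length_range', List.getElem_range',
      List.getElem_map, pcol]
    split_ifs <;> omega

theorem range'_map_pcol {i L : ℕ} (h : i + L ≤ n + 1) :
    (List.range' i L).map (pcol n) = List.range' i L := by
  conv_rhs => rw [← List.map_id (List.range' i L)]
  refine List.map_congr_left fun q hq => ?_
  rw [List.mem_range'_1] at hq
  unfold pcol
  rw [if_pos (by omega), id]

theorem wordC_of_isINI {γ : PosRootC n} (h : isINI γ) :
    wordC γ = List.range' (ri γ) (n - ri γ) ++ List.range' (ri γ) (n - ri γ) ++ [n] := by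
  unfold isINI at h
  unfold wordC
  dsimp only
  rw [if_neg (by omega), if_pos h.1]

theorem seg_map_pc (k : ℕ) (b : Bool) (i j : ℕ) :
    (seg k b i j).val.map (pc n) = ((List.range' i (j - i)).map (pcol n) : Multiset ℕ) := by
  unfold seg
  rw [Finset.image_val_of_injOn (fun q _ q' _ h => (pt_inj.1 h).2.2), Multiset.map_map]
  rfl

theorem site_map_pc (γ : PosRootC n) (k : ℕ) :
    (site γ k).val.map (pc n) = (wordC γ : Multiset ℕ) := by
  have h1 : (site γ k).val = (siteA γ k).val + (siteB γ k).val := by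
    rw [site, ← Finset.disjUnion_eq_union _ _ (siteA_disj γ k)]
    rfl
  rw [h1, Multiset.map_add, siteA, siteB, seg_map_pc, seg_map_pc]
  by_cases h : isINI γ
  · rw [wordC_of_isINI h, bend, if_pos h, rend]
    unfold isINI at h
    rw [if_pos (by omega), h.1, range'_map_pcol (by omega), range'_map_pcol (by omega),
      show n + 1 - ri γ = (n - ri γ) + 1 by omega, List.range'_concat, Multiset.coe_add]
    rw [Multiset.coe_eq_coe, show ri γ + 1 * (n - ri γ) = n by omega, List.append_assoc,
      List.append_assoc]
    exact (List.perm_append_comm).append_left _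
  · rw [wordC_of_not_isINI h, bend, if_neg h]
    simp

theorem wordC_mem {γ : PosRootC n} {j : ℕ} (hj : j ∈ wordC γ) : 1 ≤ j ∧ j ≤ n := by
  have h1 : j ∈ (site γ 0).val.map (pc n) := by rw [site_map_pc]; exact hj
  obtain ⟨p, hp, rfl⟩ := Multiset.mem_map.1 h1
  obtain ⟨k, b, q, rfl⟩ := exists_pt p
  rw [Finset.mem_val, mem_site] at hp
  obtain ⟨-, h2, h3⟩ := hp
  rw [pc_pt]
  have h4 := ri_pos γ
  have h5 := rend_le γ
  have h6 := bend_le_rend γ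
  refine pcol_mem ?_ ?_
  · omega
  · rcases h3 with h3 | h3 <;> omega

/-- the power of `η - 1` in the value of a root vector at its own site. -/
def mexp (γ : PosRootC n) : ℕ := if isINI γ then n - 1 - ri γ else 0

theorem isCh_of_isRVCchain {γ : PosRootC n} {s : ℤ} {E : UC n} (h : IsRVCchain γ s E) :
    IsCh n (wordC γ) s E := by
  obtain ⟨ss, ls, h1, h2, rfl, h3, rfl⟩ := h
  exact isCh_chainE n _ _ _ h1 h2 h3

end Words

section Long
variable {n : ℕ}

/-- the scalar attached to a pair of places in the two chains of a site. -/
def ccr (n q q' : ℕ) : KK :=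
  if cartB n (pcol n q) (pcol n q') = 0 then 1
  else 1 - vpow (cartB n (pcol n q) (pcol n q') + peps n q' - peps n q + 2)

theorem ccr_ne_zero {q q' : ℕ} (h1 : q ≤ n) (h2 : q' < n) (h3 : ¬(q = q' + 1 ∧ q < n)) :
    ccr n q q' ≠ 0 := by
  unfold ccr
  split_ifs with h0
  · exact one_ne_zero
  · rw [sub_ne_zero]
    refine (vpow_ne_one ?_).symm
    unfold cartB pcol peps at *
    split_ifs at * <;> omega

section
variable {T : Type} [CommRing T] [Algebra KK T]

theorem pow_mul_congr {e x y : T} {m : ℕ} (he : e ^ (m + 1) = 0) (h : e ∣ x - y) :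
    e ^ m * x = e ^ m * y := by
  obtain ⟨z, hz⟩ := h
  rw [← sub_eq_zero, ← mul_sub, hz, ← mul_assoc, ← pow_succ, he, zero_mul]

/-- a unit of the form `η ^ m` is `1` modulo `η - 1`. -/
theorem zpow_congr_one (η : Tˣ) (m : ℤ) :
    Ideal.Quotient.mk (Ideal.span {((η : T) - 1)}) ((η ^ m : Tˣ) : T) = 1 := by
  set π := Ideal.Quotient.mk (Ideal.span {((η : T) - 1)})
  have h1 : Units.map π.toMonoidHom η = 1 := by
    refine Units.ext ?_
    change π (η : T) = 1
    rw [← sub_eq_zero, ← map_one π, ← map_sub]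
    exact Ideal.Quotient.eq_zero_iff_mem.2 (Ideal.mem_span_singleton_self _)
  have h2 : Units.map π.toMonoidHom (η ^ m) = 1 := by rw [map_zpow, h1, one_zpow]
  exact congrArg Units.val h2

theorem cross_sites (a η : ℕ → Tˣ) (k : ℕ) {i : ℕ} (hi : i < n)
    (hη : ((η k : T) - 1) ^ (n - 1 - i + 1) = 0) :
    ∃ c : T, (conf n a η).cross n (seg k false i (n + 1)) (seg k true i n) =
      ((η k : T) - 1) ^ (n - 1 - i) * c ∧
      Ideal.Quotient.mk (Ideal.span {((η k : T) - 1)}) c =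
      Ideal.Quotient.mk (Ideal.span {((η k : T) - 1)}) (algebraMap KK T
        (∏ e ∈ (Finset.Ico i (n + 1) ×ˢ Finset.Ico i n).filter
          (fun e => ¬(e.1 = e.2 + 1 ∧ e.1 < n)), ccr n e.1 e.2)) := by
  set π := Ideal.Quotient.mk (Ideal.span {((η k : T) - 1)}) with hπ
  have hc : ((Finset.Ico i (n + 1) ×ˢ Finset.Ico i n).filter
      (fun e => (e.1 = e.2 + 1 ∧ e.1 < n))).card = n - 1 - i := by
    rw [← Nat.card_Ico i (n - 1)]
    refine Finset.card_bij' (fun e _ => e.2) (fun q _ => (q + 1, q)) ?_ ?_ ?_ ?_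
    · rintro ⟨q, q'⟩ h
      simp only [Finset.mem_filter, Finset.mem_product, Finset.mem_Ico] at h ⊢
      omega
    · intro q h
      simp only [Finset.mem_filter, Finset.mem_product, Finset.mem_Ico, true_and] at h ⊢
      omega
    · rintro ⟨q, q'⟩ h
      simp only [Finset.mem_filter, Finset.mem_product, Finset.mem_Ico] at h
      rw [Prod.mk.injEq]
      exact ⟨h.2.1.symm, rfl⟩
    · intro q h
      rfl
  refine ⟨(((η k)⁻¹ : Tˣ) : T) ^ (n - 1 - i) * ∏ e ∈ (Finset.Ico i (n + 1) ×ˢ Finset.Ico i n).filter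
          (fun e => ¬(e.1 = e.2 + 1 ∧ e.1 < n)),
          (conf n a η).zeta n (pt k false e.1) (pt k true e.2), ?_, ?_⟩
  · rw [Pts.cross, seg, seg, Finset.prod_image (fun q _ q' _ h => (pt_inj.1 h).2.2)]
    simp_rw [Finset.prod_image (fun q _ q' _ h => (pt_inj.1 h).2.2)]
    rw [← Finset.prod_product', ← Finset.prod_filter_mul_prod_filter_not _
      (fun e => (e.1 = e.2 + 1 ∧ e.1 < n)), ← mul_assoc, ← mul_pow]
    congr 1
    rw [Finset.prod_congr rfl (g := fun _ => (((η k : Tˣ) : T) - 1) * (((η k)⁻¹ : Tˣ) : T)),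
      Finset.prod_const, hc]
    rintro ⟨q, q'⟩ h
    simp only [Finset.mem_filter, Finset.mem_product, Finset.mem_Ico] at h
    obtain ⟨-, rfl, h2⟩ := h
    exact zeta_cross_succ n a η k q' h2
  · have h1 := zpow_congr_one (η k) (-1)
    rw [zpow_neg_one] at h1
    rw [map_mul, map_pow, h1, one_pow, one_mul, map_prod, map_prod, map_prod]
    refine Finset.prod_congr rfl ?_
    rintro ⟨q, q'⟩ h
    unfold ccr
    split_ifs with h0
    · have h2 : (conf n a η).zeta n (pt k false q) (pt k true q') = 1 :=
        zeta_of_cartB_zero n a η h0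
      rw [h2, map_one, map_one, map_one]
    · rw [zeta_cross n a η k q q' h0, map_sub, map_mul, h1, mul_one, map_sub, map_one, map_one,
        map_sub, map_one]
      rfl

end

theorem IsRVC.eval (hn : 2 ≤ n) {γ : PosRootC n} {s : ℤ} {E : UC n} (h : IsRVC γ s E) :
    ∃ u : KK, u ≠ 0 ∧ ∀ (T : Type) [CommRing T] [Algebra KK T] (a η : ℕ → Tˣ) (U : Finset Pnt)
      (k : ℕ), site γ k ⊆ U → (isINI γ → ((η k : T) - 1) ^ (n - ri γ) = 0) →
      (conf n a η).Phi n U (site γ k) E =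
        algebraMap KK T u * (((a k ^ s : Tˣ) : T) * ((η k : T) - 1) ^ mexp γ) := by
  have hri := ri_pos γ
  have hrl := ri_le γ
  unfold IsRVC at h
  split_ifs at h with hI
  · obtain ⟨β₁, β₂, s₁, s₂, l, E₁, E₂, ⟨hβ₁, hβ₁'⟩, ⟨hβ₂, hβ₂'⟩, ⟨m, rfl⟩, hE₁, hE₂, rfl, rfl⟩ := h
    have hI' := hI
    unfold isINI at hI'
    have h₁ := isCh_of_isRVCchain hE₁
    have h₂ := isCh_of_isRVCchain hE₂
    have hw₁ : wordC β₁ = (List.range' (ri γ) (n - ri γ)).map (pcol n) := by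
      rw [wordC_of_not_isINI (by unfold isINI; omega), hβ₁, rend, if_pos (by omega)]
      congr 2
      omega
    have hw₂ : wordC β₂ = (List.range' (ri γ) (n + 1 - ri γ)).map (pcol n) := by
      rw [wordC_of_not_isINI (by unfold isINI; omega), hβ₂, rend, if_neg (by omega)]
      congr 2
      omega
    obtain ⟨u₁, hu₁, hE₁⟩ := h₁.eval hn hw₁ hri hrl (by omega)
    obtain ⟨u₂, hu₂, hE₂⟩ := h₂.eval hn hw₂ hri hrl (by omega)
    rw [show ri γ + (n - ri γ) = n by omega] at hE₁
    rw [show ri γ + (n + 1 - ri γ) = n + 1 by omega] at hE₂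
    have hrend : rend γ = n := by
      unfold rend
      rw [if_pos (by omega)]
      exact hI'.1
    have hA : ∀ k, siteA γ k = seg k false (ri γ) (n + 1) := fun k => by rw [siteA, hrend]
    have hB : ∀ k, siteB γ k = seg k true (ri γ) n := fun k => by rw [siteB, bend, if_pos hI]
    set C : KK := ∏ e ∈ (Finset.Ico (ri γ) (n + 1) ×ˢ Finset.Ico (ri γ) n).filter
          (fun e => ¬(e.1 = e.2 + 1 ∧ e.1 < n)), ccr n e.1 e.2 with hC
    have hC0 : C ≠ 0 := by
      refine Finset.prod_ne_zero_iff.2 ?_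
      rintro ⟨q, q'⟩ h
      simp only [Finset.mem_filter, Finset.mem_product, Finset.mem_Ico] at h
      exact ccr_ne_zero (by omega) (by omega) h.2
    refine ⟨-(vpow m * (u₂ * (C * (u₁ * vpow (-2 * s₁))))), ?_, ?_⟩
    · exact neg_ne_zero.2 (mul_ne_zero (vpow_ne_zero _) (mul_ne_zero hu₂ (mul_ne_zero hC0
        (mul_ne_zero hu₁ (vpow_ne_zero _)))))
    intro T _ _ a η U k hU hη
    have hη' := hη hI
    have hS : sites (fun _ => γ) {k} = site γ k := by simp [sites]
    have hclosed : ∀ (F : Finset Pnt) (u w : UC n), F ⊆ site γ k →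
        (conf n a η).Phi n U F u * ((conf n a η).cross n F (site γ k \ F) *
          (conf n a η).Phi n U (site γ k \ F) w) ≠ 0 → IsClosedIn (site γ k) F := by
      intro F u w hF h0
      have := isClosedIn_of_ne_zero a η hn U (fun _ => γ) {k} (fun j hj _ => by
        rw [Finset.mem_singleton.1 hj]; exact hη') u w (F := F)
      rw [hS] at this
      exact this hF h0
    have hsubA : ∀ F, IsClosedIn (site γ k) F → (∃ p ∈ F, pc n p = ri γ) → siteA γ k ⊆ F := by
      rintro F hF ⟨p, hp, hpc⟩
      obtain ⟨k', b, q, rfl⟩ := exists_pt p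
      have h3 := mem_site.1 (hF.subset hp)
      have h4 := bend_le_rend γ
      obtain ⟨rfl, -⟩ := pcol_eq_ri (γ := γ) le_rfl h3.2.1 (by rcases h3.2.2 with h | h <;> omega) hpc
      obtain ⟨rfl, -⟩ := h3
      have h6 : pt k' false (ri γ) ∈ F := by
        cases b
        · exact hp
        · exact hF.fst_mem _ _ hp
      exact hF.seg_subset h6 Finset.subset_union_left
    have hpcr : pcol n (ri γ) = ri γ := by unfold pcol; rw [if_pos hrl]
    have hcol : ∀ {F : Finset Pnt} {L : ℕ}, 0 < L →
        F.val.map (pc n) = (((List.range' (ri γ) L).map (pcol n) : List ℕ) : Multiset ℕ) →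
        ∃ p ∈ F, pc n p = ri γ := by
      intro F L hL h
      have h1 : ri γ ∈ F.val.map (pc n) := by
        rw [h, Multiset.mem_coe, List.mem_map]
        exact ⟨ri γ, by rw [List.mem_range'_1]; omega, hpcr⟩
      obtain ⟨p, hp, h2⟩ := Multiset.mem_map.1 h1
      exact ⟨p, hp, h2⟩
    have hcard : ∀ {F : Finset Pnt} {L : ℕ},
        F.val.map (pc n) = (((List.range' (ri γ) L).map (pcol n) : List ℕ) : Multiset ℕ) →
        F.card = L := by
      intro F L h
      have := congrArg Multiset.card h
      simpa using this
    rw [qcm, Pts.Phi_sub, Pts.Phi_smul, Pts.Phi_mul, Pts.Phi_mul, Finset.sum_eq_zero,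
      Finset.sum_eq_single (siteA γ k)]
    · have h3 : site γ k \ siteA γ k = siteB γ k := by
        rw [site, Finset.union_sdiff_left, Finset.sdiff_eq_self_of_disjoint (siteA_disj γ k).symm]
      rw [h3, hA, hB, hE₁ T a η U k true (fun p hp => hU (Finset.mem_union_right _ (by
          rwa [hB]))), hE₂ T a η U k false (fun p hp => hU (Finset.mem_union_left _ (by
          rwa [hA])))]
      obtain ⟨c, hc1, hc2⟩ := cross_sites a η k (i := ri γ) (n := n) hI'.2
        (by rw [show n - 1 - ri γ + 1 = n - ri γ by omega]; exact hη')
      have hm : mexp γ = n - 1 - ri γ := by unfold mexp; rw [if_pos hI]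
      rw [hc1, hm]
      have key := pow_mul_congr (e := (η k : T) - 1) (m := n - 1 - ri γ)
        (x := c * ((η k ^ s₁ : Tˣ) : T)) (y := algebraMap KK T C)
        (by rw [show n - 1 - ri γ + 1 = n - ri γ by omega]; exact hη')
        (by rw [← Ideal.mem_span_singleton, ← Ideal.Quotient.eq, map_mul, hc2, zpow_congr_one,
          mul_one])
      have hb : ((cbase a η k true ^ s₁ : Tˣ) : T) =
          algebraMap KK T (vpow (-2 * s₁)) * ((η k ^ s₁ : Tˣ) : T) * ((a k ^ s₁ : Tˣ) : T) := by
        rw [cbase, if_pos rfl, mul_zpow, mul_zpow, ← zpow_mul, Units.val_mul, Units.val_mul, vu_zpow]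
        rfl
      have ha : ((cbase a η k false ^ s₂ : Tˣ) : T) = ((a k ^ s₂ : Tˣ) : T) := by
        rw [cbase]; rfl
      rw [hb, ha, zero_sub, Algebra.smul_def, zpow_add, Units.val_mul]
      simp only [map_neg, map_mul]
      linear_combination (-(algebraMap KK T (vpow m)) * algebraMap KK T u₂ *
        ((a k ^ s₂ : Tˣ) : T) * algebraMap KK T u₁ * algebraMap KK T (vpow (-2 * s₁)) *
        ((a k ^ s₁ : Tˣ) : T)) * key
    · intro F hF hne
      by_contra h0
      have h3 := hclosed F _ _ (Finset.mem_powerset.1 hF) h0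
      have h4 := h₂.hasWt n (fun j hj => wordC_mem hj) F (left_ne_zero_of_mul h0)
      rw [hw₂] at h4
      have h5 := hsubA F h3 (hcol (by omega) h4)
      refine hne (Finset.eq_of_subset_of_card_le h5 ?_).symm
      rw [hcard h4, hA, card_seg]
    · intro h0
      exact absurd (Finset.mem_powerset.2 Finset.subset_union_left) h0
    · intro F hF
      by_contra h0
      have h3 := hclosed F _ _ (Finset.mem_powerset.1 hF) h0
      have h4 := h₁.hasWt n (fun j hj => wordC_mem hj) F (left_ne_zero_of_mul h0)
      rw [hw₁] at h4
      have h5 := Finset.card_le_card (hsubA F h3 (hcol (by omega) h4))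
      rw [hcard h4, hA, card_seg] at h5
      omega
  · have h2 := rend_lt γ
    have h3 := ri_le_rend γ
    obtain ⟨u, hu, h1⟩ := (isCh_of_isRVCchain h).eval hn (wordC_of_not_isINI hI) hri hrl (by omega)
    refine ⟨u, hu, ?_⟩
    intro T _ _ a η U k hU _
    have hS : site γ k = seg k false (ri γ) (ri γ + (rend γ + 1 - ri γ)) := by
      rw [site, siteB, bend, if_neg hI, siteA, show ri γ + (rend γ + 1 - ri γ) = rend γ + 1 by omega]
      simp [seg]
    rw [hS] at hU ⊢
    rw [h1 T a η U k false hU, mexp, if_neg hI, pow_zero, mul_one]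
    rfl

theorem IsRVC.hasWt {γ : PosRootC n} {s : ℤ} {E : UC n} (h : IsRVC γ s E)
    {P T : Type} [LinearOrder P] [CommRing T] [Algebra KK T] {D : Pts P T} {U : Finset P} :
    D.HasWt n U E (wordC γ : Multiset ℕ) := by
  unfold IsRVC at h
  split_ifs at h with hI
  · obtain ⟨β₁, β₂, s₁, s₂, l, E₁, E₂, ⟨hβ₁, hβ₁'⟩, ⟨hβ₂, hβ₂'⟩, -, hE₁, hE₂, rfl, rfl⟩ := h
    have hI' := hI
    unfold isINI at hI'
    have hw₁ : wordC β₁ = List.range' (ri γ) (n - ri γ) := by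
      rw [wordC_of_not_isINI (by unfold isINI; omega), hβ₁, rend, if_pos (by omega),
        range'_map_pcol (by omega)]
      congr 1
      omega
    have hw₂ : wordC β₂ = List.range' (ri γ) (n - ri γ) ++ [n] := by
      rw [wordC_of_not_isINI (by unfold isINI; omega), hβ₂, rend, if_neg (by omega),
        range'_map_pcol (by omega),
        show ri β₂ + rt β₂ - 1 + 1 - ri γ = (n - ri γ) + 1 by omega, List.range'_concat]
      congr 2
      omega
    have h₁ := (isCh_of_isRVCchain hE₁).hasWt n (D := D) (U := U) (fun j hj => wordC_mem hj)
    have h₂ := (isCh_of_isRVCchain hE₂).hasWt n (D := D) (U := U) (fun j hj => wordC_mem hj)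
    have h3 : ((wordC γ : List ℕ) : Multiset ℕ) = (wordC β₁ : Multiset ℕ) + (wordC β₂ : Multiset ℕ) := by
      rw [wordC_of_isINI hI, hw₁, hw₂, Multiset.coe_add, List.append_assoc]
    rw [h3]
    refine (h₁.mul h₂).sub (Pts.HasWt.smul _ ?_)
    rw [add_comm]
    exact h₂.mul h₁
  · exact (isCh_of_isRVCchain h).hasWt n (fun j hj => wordC_mem hj)

end Long

/-! ### Values of ordered products of root vectors -/

section Values
variable {n : ℕ}

/-- the index set of the root vectors with its lexicographic order. -/
abbrev Ix (n : ℕ) := Lex (PosRootC n × ℤ)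

variable (β : ℕ → PosRootC n) {T : Type} [CommRing T] [Algebra KK T] (a η : ℕ → Tˣ)

/-- the product of the structure factors between two sites. -/
def sx (k m : ℕ) : T := (conf n a η).cross n (site (β k) k) (site (β m) m)

/-- the value of an ordered product of normalized root vectors at a union of sites. -/
def V (A : Finset ℕ) : List (Ix n) → T
  | [] => if A = ∅ then 1 else 0
  | x :: l => ∑ k ∈ A.filter (fun k => β k = (ofLex x).1),
      (((a k ^ (ofLex x).2 : Tˣ) : T) * ((η k : T) - 1) ^ mexp (ofLex x).1) *
        ((∏ k' ∈ A.erase k, sx β a η k k') * V (A.erase k) l)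

/-- the list of roots of the factors is not larger than the list of roots of the sites. -/
def Low (A : Finset ℕ) : List (Ix n) → Prop
  | [] => True
  | x :: l => (∀ k ∈ A, (ofLex x).1 ≤ β k) ∧ ∀ k ∈ A, β k = (ofLex x).1 → Low (A.erase k) l

/-- the list of the roots of the factors. -/
def types (l : List (Ix n)) : List (PosRootC n) := l.map fun x => (ofLex x).1

theorem types_of_V_ne_zero {A : Finset ℕ} {l : List (Ix n)} (h : V β a η A l ≠ 0) :
    (types l : Multiset (PosRootC n)) = A.val.map β := by
  induction l generalizing A with
  | nil =>
    unfold V at h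
    by_cases hA : A = ∅
    · simp [hA, types]
    · exact absurd (if_neg hA) h
  | cons x l ih =>
    unfold V at h
    obtain ⟨k, hk, h1⟩ := Finset.exists_ne_zero_of_sum_ne_zero h
    rw [Finset.mem_filter] at hk
    have h2 := ih (right_ne_zero_of_mul (right_ne_zero_of_mul h1))
    have h3 : (types (x :: l) : Multiset (PosRootC n)) =
        (ofLex x).1 ::ₘ (types l : Multiset (PosRootC n)) := rfl
    rw [h3, h2, ← hk.2, ← Multiset.map_cons, Finset.erase_val, Multiset.cons_erase hk.1]

theorem low_of_types_le {A : Finset ℕ} {l : List (Ix n)}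
    (h : types l ≤ (A.val.map β).sort (· ≤ ·)) : Low β A l := by
  induction l generalizing A with
  | nil => trivial
  | cons x l ih =>
    have h3 : types (x :: l) = (ofLex x).1 :: types l := rfl
    rw [h3] at h
    have hge : ∀ k ∈ A, (ofLex x).1 ≤ β k := by
      intro k hk
      have hm : β k ∈ (A.val.map β).sort (· ≤ ·) := by
        rw [Multiset.mem_sort]; exact Multiset.mem_map_of_mem _ hk
      have hs : List.Pairwise (· ≤ ·) ((A.val.map β).sort (· ≤ ·)) := Multiset.pairwise_sort _ _
      revert h hm hs
      generalize (A.val.map β).sort (· ≤ ·) = L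
      intro h hm hs
      cases L with
      | nil => simp at hm
      | cons y L =>
        have h4 : (ofLex x).1 ≤ y := by
          by_contra hlt
          exact absurd (List.cons_lt_cons_iff.2 (Or.inl (not_le.1 hlt))) (not_lt.2 h)
        rcases List.mem_cons.1 hm with h5 | h5
        · rw [h5]; exact h4
        · exact h4.trans ((List.pairwise_cons.1 hs).1 _ h5)
    refine ⟨hge, ?_⟩
    · intro k hk hkx
      apply ih
      refine not_lt.1 fun hlt => not_lt.2 h ?_
      have h5 : A.val.map β = β k ::ₘ (A.erase k).val.map β := by
        rw [← Multiset.map_cons, Finset.erase_val, Multiset.cons_erase hk]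
      rw [h5, Multiset.sort_cons, hkx]
      · exact List.cons_lt_cons_iff.2 (Or.inr ⟨rfl, hlt⟩)
      · intro b hb
        obtain ⟨k', hk', rfl⟩ := Multiset.mem_map.1 hb
        rw [hkx]
        exact hge k' (Finset.mem_of_mem_erase hk')


theorem pt_mem_site (γ : PosRootC n) (k : ℕ) : pt k false (ri γ) ∈ site γ k :=
  mem_site.2 ⟨rfl, le_rfl, Or.inl ⟨rfl, ri_le_rend γ⟩⟩

theorem sites_eq_empty {A : Finset ℕ} : sites β A = ∅ ↔ A = ∅ := by
  unfold sites
  refine ⟨fun h => Finset.eq_empty_of_forall_notMem fun k hk => ?_, fun h => by simp [h]⟩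
  have := Finset.mem_biUnion (t := fun k => site (β k) k).2 ⟨k, hk, pt_mem_site (β k) k⟩
  rw [h] at this
  exact Finset.notMem_empty _ this

theorem site_disjoint {k k' : ℕ} (h : k ≠ k') (γ γ' : PosRootC n) :
    Disjoint (site γ k) (site γ' k') := by
  rw [Finset.disjoint_left]
  intro p hp hp'
  obtain ⟨k₁, b, q, rfl⟩ := exists_pt p
  exact h ((mem_site.1 hp).1.symm.trans (mem_site.1 hp').1)

theorem sites_sdiff_site {A : Finset ℕ} {k : ℕ} (hk : k ∈ A) :
    sites β A \ site (β k) k = sites β (A.erase k) := by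
  unfold sites
  conv_lhs => rw [← Finset.insert_erase hk, Finset.biUnion_insert]
  rw [Finset.union_sdiff_cancel_left]
  rw [Finset.disjoint_biUnion_right]
  exact fun k' hk' => site_disjoint (Finset.ne_of_mem_erase hk').symm _ _

theorem cross_sites_erase {A : Finset ℕ} {k : ℕ} :
    (conf n a η).cross n (site (β k) k) (sites β (A.erase k)) = ∏ k' ∈ A.erase k, sx β a η k k' := by
  unfold Pts.cross sites sx
  rw [Finset.prod_comm, Finset.prod_biUnion]
  · refine Finset.prod_congr rfl fun k' _ => ?_
    unfold Pts.cross
    rw [Finset.prod_comm]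
  · exact fun k _ k' _ h => site_disjoint h _ _

/-- `u` is the leading coefficient of the quantum root vector `E`. -/
def IsLead (γ : PosRootC n) (s : ℤ) (E : UC n) (u : KK) : Prop :=
  ∀ (T : Type) [CommRing T] [Algebra KK T] (a η : ℕ → Tˣ) (U : Finset Pnt) (k : ℕ),
    site γ k ⊆ U → (isINI γ → ((η k : T) - 1) ^ (n - ri γ) = 0) →
      (conf n a η).Phi n U (site γ k) E =
        algebraMap KK T u * (((a k ^ s : Tˣ) : T) * ((η k : T) - 1) ^ mexp γ)

theorem Phi_prod (hn : 2 ≤ n) {E : Ix n → UC n} {u : Ix n → KK}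
    (hE : ∀ x : Ix n, IsRVC (ofLex x).1 (ofLex x).2 (E x))
    (hu : ∀ x : Ix n, IsLead (ofLex x).1 (ofLex x).2 (E x) (u x)) {U : Finset Pnt} {A : Finset ℕ}
    (hU : sites β A ⊆ U) (hη : ∀ k ∈ A, isINI (β k) → ((η k : T) - 1) ^ (n - ri (β k)) = 0)
    {l : List (Ix n)} (hl : Low β A l) :
    (conf n a η).Phi n U (sites β A) (l.map E).prod =
      algebraMap KK T (l.map u).prod * V β a η A l := by
  induction l generalizing A with
  | nil =>
    simp only [List.map_nil, List.prod_nil, map_one, one_mul, V, Pts.Phi_one, sites_eq_empty]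
  | cons x l ih =>
    have hsub : ∀ k ∈ A, site (β k) k ⊆ sites β A := fun k hk =>
      Finset.subset_biUnion_of_mem (fun k => site (β k) k) hk
    rw [List.map_cons, List.prod_cons, Pts.Phi_mul]
    rw [← Finset.sum_subset (s₁ := (A.filter fun k => β k = (ofLex x).1).image
      fun k => site (β k) k)]
    · rw [Finset.sum_image]
      · rw [V, Finset.mul_sum]
        refine Finset.sum_congr rfl fun k hk => ?_
        obtain ⟨hkA, hkx⟩ := Finset.mem_filter.1 hk
        have hsub' : sites β (A.erase k) ⊆ sites β A := by
          rw [← sites_sdiff_site β hkA]; exact Finset.sdiff_subset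
        rw [sites_sdiff_site β hkA, cross_sites_erase, ih (hsub'.trans hU)
          (fun k' hk' => hη k' (Finset.mem_of_mem_erase hk')) (hl.2 k hkA hkx)]
        have h1 := hu x T a η U k (by rw [← hkx]; exact (hsub k hkA).trans hU)
          (by rw [← hkx]; exact hη k hkA)
        rw [← hkx] at h1
        rw [h1, ← hkx, List.map_cons, List.prod_cons, map_mul]
        ring
      · intro k _ k' _ h
        have h : site (β k) k = site (β k') k' := h
        by_contra hne
        have h1 := site_disjoint hne (β k) (β k')
        have h2 := pt_mem_site (β k) k
        exact Finset.disjoint_left.1 h1 h2 (h ▸ h2)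
    · intro F hF
      obtain ⟨k, hk, rfl⟩ := Finset.mem_image.1 hF
      exact Finset.mem_powerset.2 (hsub k (Finset.mem_filter.1 hk).1)
    · intro F hF hF'
      by_contra hne
      have hcl := isClosedIn_of_ne_zero a η hn U β A hη _ _ (Finset.mem_powerset.1 hF) hne
      have hwt := IsRVC.hasWt (hE x) F (left_ne_zero_of_mul hne)
      obtain ⟨k, hk, hkx, rfl⟩ := eq_site_of_isClosedIn hcl hl.1 (by
        rw [site_map_pc]; exact hwt)
      exact hF' (Finset.mem_image.2 ⟨k, Finset.mem_filter.2 ⟨hk, hkx⟩, rfl⟩)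

theorem map_zeta {T' : Type} [CommRing T'] [Algebra KK T'] (f : T →ₐ[KK] T') {a' η' : ℕ → T'ˣ}
    {k k' : ℕ} (ha : a' k = Units.map f (a k)) (hη : η' k = Units.map f (η k))
    (ha' : a' k' = Units.map f (a k')) (hη' : η' k' = Units.map f (η k')) (b b' : Bool) (q q' : ℕ) :
    (conf n a' η').zeta n (pt k b q) (pt k' b' q') =
      f ((conf n a η).zeta n (pt k b q) (pt k' b' q')) := by
  have hvu : ∀ m : ℤ, vu T' ^ m = Units.map f (vu T ^ m) := by
    intro m
    rw [map_zpow]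
    congr 1
    ext
    exact (f.commutes _).symm
  have hvt : ∀ m : ℤ, vt T' m = f (vt T m) := fun m => (f.commutes _).symm
  have hx : ∀ b q, (conf n a' η').x (pt k b q) = Units.map f ((conf n a η).x (pt k b q)) := by
    intro b q
    rw [conf_x, conf_x, map_mul, hvu]
    congr 1
    unfold cbase
    split_ifs
    · rw [map_mul, map_mul, hvu, ha, hη]
    · exact ha
  have hx' : ∀ b q, (conf n a' η').x (pt k' b q) = Units.map f ((conf n a η).x (pt k' b q)) := by
    intro b q
    rw [conf_x, conf_x, map_mul, hvu]
    congr 1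
    unfold cbase
    split_ifs
    · rw [map_mul, map_mul, hvu, ha', hη']
    · exact ha'
  unfold Pts.zeta
  rw [hx, hx', conf_col, conf_col, conf_col, conf_col, hvt, ← map_inv, ← map_inv]
  split_ifs <;> simp

theorem map_sx {T' : Type} [CommRing T'] [Algebra KK T'] (f : T →ₐ[KK] T') {a' η' : ℕ → T'ˣ}
    {k k' : ℕ} (ha : a' k = Units.map f (a k)) (hη : η' k = Units.map f (η k))
    (ha' : a' k' = Units.map f (a k')) (hη' : η' k' = Units.map f (η k')) :
    sx β a' η' k k' = f (sx β a η k k') := by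
  unfold sx Pts.cross
  rw [map_prod]
  refine Finset.prod_congr rfl fun p hp => ?_
  rw [map_prod]
  refine Finset.prod_congr rfl fun p' hp' => ?_
  obtain ⟨k₁, b, q, rfl⟩ := exists_pt p
  obtain ⟨k₂, b', q', rfl⟩ := exists_pt p'
  obtain ⟨rfl, -⟩ := mem_site.1 hp
  obtain ⟨rfl, -⟩ := mem_site.1 hp'
  exact map_zeta a η f ha hη ha' hη' _ _ _ _

theorem map_V {T' : Type} [CommRing T'] [Algebra KK T'] (f : T →ₐ[KK] T') {a' η' : ℕ → T'ˣ}
    {A : Finset ℕ} (h : ∀ k ∈ A, a' k = Units.map f (a k) ∧ η' k = Units.map f (η k))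
    (l : List (Ix n)) : V β a' η' A l = f (V β a η A l) := by
  induction l generalizing A with
  | nil => unfold V; split_ifs <;> simp
  | cons x l ih =>
    rw [V, V, map_sum]
    refine Finset.sum_congr rfl fun k hk => ?_
    have hk' := (Finset.mem_filter.1 hk).1
    rw [map_mul, map_mul, map_mul, map_prod, ih fun k' hk' => h k' (Finset.mem_of_mem_erase hk'),
      (h k hk').1, (h k hk').2]
    congr 1
    · rw [← map_zpow, map_pow, map_sub, map_one]
      rfl
    · congr 1
      refine Finset.prod_congr rfl fun k₂ hk₂ => ?_
      have h2 := h k₂ (Finset.mem_of_mem_erase hk₂)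
      exact map_sx β a η f (h k hk').1 (h k hk').2 h2.1 h2.2

end Values

/-! ### Leading coefficients of Laurent polynomials -/

section Top
open LaurentPolynomial
variable {R : Type} [CommRing R]

/-- the inclusion of polynomials in `T⁻¹`. -/
def negPoly (R : Type) [CommRing R] : Polynomial R →+* R[T;T⁻¹] :=
  (LaurentPolynomial.invert (R := R) : R[T;T⁻¹] →ₐ[R] R[T;T⁻¹]).toRingHom.comp
    Polynomial.toLaurent

theorem negPoly_injective : Function.Injective (negPoly R) := fun _ _ h =>
  Polynomial.toLaurent_injective ((LaurentPolynomial.invert (R := R)).injective h)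

theorem negPoly_C (c : R) : negPoly R (Polynomial.C c) = C c := by
  simp [negPoly]

theorem negPoly_X : negPoly R Polynomial.X = T (-1) := by
  simp [negPoly]

/-- `f` has degree at most `M` and coefficient `t` in degree `M`. -/
def Top (M : ℤ) (f : R[T;T⁻¹]) (t : R) : Prop :=
  ∃ g : Polynomial R, f = T M * negPoly R g ∧ g.coeff 0 = t

theorem Top.mul {M M' : ℤ} {f f' : R[T;T⁻¹]} {t t' : R} (h : Top M f t) (h' : Top M' f' t') :
    Top (M + M') (f * f') (t * t') := by
  obtain ⟨g, rfl, rfl⟩ := h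
  obtain ⟨g', rfl, rfl⟩ := h'
  exact ⟨g * g', by rw [map_mul, T_add]; ring, Polynomial.mul_coeff_zero _ _⟩

theorem Top.add {M : ℤ} {f f' : R[T;T⁻¹]} {t t' : R} (h : Top M f t) (h' : Top M f' t') :
    Top M (f + f') (t + t') := by
  obtain ⟨g, rfl, rfl⟩ := h
  obtain ⟨g', rfl, rfl⟩ := h'
  exact ⟨g + g', by rw [map_add]; ring, Polynomial.coeff_add _ _ _⟩

theorem top_zero (M : ℤ) : Top M (0 : R[T;T⁻¹]) 0 := ⟨0, by simp, by simp⟩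

theorem top_C (c : R) : Top 0 (C c : R[T;T⁻¹]) c :=
  ⟨Polynomial.C c, by rw [negPoly_C, T_zero, one_mul], Polynomial.coeff_C_zero⟩

theorem top_one : Top 0 (1 : R[T;T⁻¹]) 1 := by
  have := top_C (1 : R)
  rwa [map_one] at this

theorem top_T (M : ℤ) : Top M (T M : R[T;T⁻¹]) 1 := ⟨1, by simp, by simp⟩

theorem Top.shift_succ {M : ℤ} {f : R[T;T⁻¹]} {t : R} (h : Top M f t) : Top (M + 1) f 0 := by
  obtain ⟨g, rfl, -⟩ := h
  refine ⟨Polynomial.X * g, ?_, by simp⟩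
  rw [map_mul, negPoly_X, ← mul_assoc, ← T_add]
  congr 2
  ring

theorem Top.shift {M M' : ℤ} {f : R[T;T⁻¹]} {t : R} (h : Top M f t) (hM : M < M') :
    Top M' f 0 := by
  obtain ⟨d, rfl⟩ := Int.le.dest (Int.add_one_le_iff.2 hM)
  induction d with
  | zero => simpa using h.shift_succ
  | succ d ih =>
    have := (ih (by omega)).shift_succ
    rwa [add_assoc (M + 1), ← Nat.cast_succ] at this

theorem Top.sum {ι : Type} {s : Finset ι} {M : ℤ} {f : ι → R[T;T⁻¹]} {t : ι → R}
    (h : ∀ i ∈ s, Top M (f i) (t i)) : Top M (∑ i ∈ s, f i) (∑ i ∈ s, t i) := by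
  induction s using Finset.cons_induction with
  | empty => exact top_zero M
  | cons i s hi ih =>
    rw [Finset.sum_cons, Finset.sum_cons]
    exact (h i (Finset.mem_cons_self _ _)).add (ih fun j hj => h j (Finset.mem_cons_of_mem hj))

theorem Top.prod {ι : Type} {s : Finset ι} {f : ι → R[T;T⁻¹]} {t : ι → R}
    (h : ∀ i ∈ s, Top 0 (f i) (t i)) : Top 0 (∏ i ∈ s, f i) (∏ i ∈ s, t i) := by
  induction s using Finset.cons_induction with
  | empty => exact top_one
  | cons i s hi ih =>
    rw [Finset.prod_cons, Finset.prod_cons]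
    have := (h i (Finset.mem_cons_self _ _)).mul (ih fun j hj => h j (Finset.mem_cons_of_mem hj))
    rwa [add_zero] at this

theorem Top.eq_zero {M : ℤ} {t : R} (h : Top M 0 t) : t = 0 := by
  obtain ⟨g, hg, rfl⟩ := h
  have h1 : negPoly R g = 0 := by
    have : T (-M) * (T M * negPoly R g) = 0 := by rw [← hg, mul_zero]
    rwa [← mul_assoc, ← T_add, neg_add_cancel, T_zero, one_mul] at this
  rw [(map_eq_zero_iff _ negPoly_injective).1 h1, Polynomial.coeff_zero]

end Top

/-! ### Adjoining one more site -/

section Extend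
open LaurentPolynomial
variable {n : ℕ} (β : ℕ → PosRootC n) {R : Type} [CommRing R] [Algebra KK R] (a η : ℕ → Rˣ)
  (N : ℕ) (ε : Rˣ)

/-- the indeterminate as a unit. -/
def Tunit (R : Type) [CommRing R] : R[T;T⁻¹]ˣ where
  val := T 1
  inv := T (-1)
  val_inv := by rw [← T_add]; exact T_zero
  inv_val := by rw [← T_add]; exact T_zero

/-- the inclusion of the constants. -/
def Ck (R : Type) [CommRing R] [Algebra KK R] : R →ₐ[KK] R[T;T⁻¹] :=
  { (C : R →+* R[T;T⁻¹]) with commutes' := fun _ => rfl }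

/-- the parameters `a` with a generic value at `N`. -/
def aext (k : ℕ) : R[T;T⁻¹]ˣ := if k = N then Tunit R else Units.map (Ck R) (a k)

/-- the parameters `η` with the value `ε` at `N`. -/
def ηext (k : ℕ) : R[T;T⁻¹]ˣ := Units.map (Ck R) (if k = N then ε else η k)

theorem Tunit_zpow (m : ℤ) : ((Tunit R ^ m : R[T;T⁻¹]ˣ) : R[T;T⁻¹]) = T m := by
  have h : ∀ m : ℕ, ((Tunit R ^ m : R[T;T⁻¹]ˣ) : R[T;T⁻¹]) = T (m : ℤ) := by
    intro m
    rw [Units.val_pow_eq_pow_val]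
    change (T 1 : R[T;T⁻¹]) ^ m = _
    rw [T_pow, mul_one]
  have h2 : ∀ m : ℕ, (((Tunit R)⁻¹ ^ m : R[T;T⁻¹]ˣ) : R[T;T⁻¹]) = T (-(m : ℤ)) := by
    intro m
    rw [Units.val_pow_eq_pow_val]
    change (T (-1) : R[T;T⁻¹]) ^ m = _
    rw [T_pow, mul_neg_one]
  obtain ⟨m, rfl | rfl⟩ := m.eq_nat_or_neg
  · rw [zpow_natCast, h]
  · rw [zpow_neg, zpow_natCast, ← inv_pow, h2]

theorem conf_x_of_ne {k : ℕ} (hk : k ≠ N) (b : Bool) (q : ℕ) :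
    ∃ c : Rˣ, (conf n (aext a N) (ηext η N ε)).x (pt k b q) = Units.map (Ck R) c := by
  have hvu : vu R[T;T⁻¹] = Units.map (Ck R) (vu R) := by
    ext
    rfl
  rw [conf_x]
  unfold cbase aext ηext
  rw [if_neg hk, if_neg hk, hvu]
  simp only [← map_zpow, ← map_mul]
  split_ifs <;> exact ⟨_, (map_mul _ _ _).symm⟩

theorem conf_x_self (b : Bool) (q : ℕ) :
    ∃ c : Rˣ, (conf n (aext a N) (ηext η N ε)).x (pt N b q) = Units.map (Ck R) c * Tunit R := by
  have hvu : vu R[T;T⁻¹] = Units.map (Ck R) (vu R) := by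
    ext
    rfl
  rw [conf_x]
  unfold cbase aext ηext
  rw [if_pos rfl, if_pos rfl, hvu]
  simp only [← map_zpow, ← map_mul]
  split_ifs
  · exact ⟨(vu R ^ (-2 : ℤ) * ε) * vu R ^ (-peps n q), by
      rw [map_mul _ (_ * _), map_mul, mul_right_comm]⟩
  · exact ⟨vu R ^ (-peps n q), by rw [mul_comm]⟩

theorem top_mul_inv (c c' : Rˣ) :
    Top 0 (((Units.map (Ck R) c : R[T;T⁻¹]ˣ) : R[T;T⁻¹]) *
      (((Units.map (Ck R) c' * Tunit R)⁻¹ : R[T;T⁻¹]ˣ) : R[T;T⁻¹])) 0 := by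
  have h1 : ((Units.map (Ck R) c : R[T;T⁻¹]ˣ) : R[T;T⁻¹]) *
      (((Units.map (Ck R) c' * Tunit R)⁻¹ : R[T;T⁻¹]ˣ) : R[T;T⁻¹]) =
      T (-1) * C ((c : R) * (c'⁻¹ : Rˣ)) := by
    rw [mul_inv, Units.val_mul, ← map_inv, map_mul]
    have h2 : (((Tunit R)⁻¹ : R[T;T⁻¹]ˣ) : R[T;T⁻¹]) = T (-1) := rfl
    rw [h2]
    change C (c : R) * (C ((c'⁻¹ : Rˣ) : R) * T (-1)) = _
    ring
  rw [h1]
  have := (top_T (R := R) (-1)).mul (top_C ((c : R) * (c'⁻¹ : Rˣ)))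
  exact this.shift (by norm_num)

theorem top_zeta_left {k : ℕ} (hk : k < N) (b b' : Bool) (q q' : ℕ) :
    Top 0 ((conf n (aext a N) (ηext η N ε)).zeta n (pt k b q) (pt N b' q')) 1 := by
  unfold Pts.zeta
  split_ifs with h1 h2
  · exact top_one
  · obtain ⟨c, hc⟩ := conf_x_of_ne (n := n) a η N ε hk.ne b q
    obtain ⟨c', hc'⟩ := conf_x_self (n := n) a η N ε b' q'
    rw [hc, hc']
    have h3 := ((top_C (-vt R (cartB n ((conf n (aext a N) (ηext η N ε)).col (pt k b q))
      ((conf n (aext a N) (ηext η N ε)).col (pt N b' q'))))).mul (top_mul_inv c c'))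
    have h4 := top_one.add h3
    rw [mul_zero, add_zero] at h4
    convert h4 using 1
    rw [map_neg]
    have h5 : ∀ m, vt R[T;T⁻¹] m = C (vt R m) := fun m => rfl
    rw [h5]
    ring
  · exact absurd (pt_lt.2 (Or.inl hk)) h2

theorem top_zeta_right {k : ℕ} (hk : k < N) (b b' : Bool) (q q' : ℕ) :
    Top 0 ((conf n (aext a N) (ηext η N ε)).zeta n (pt N b' q') (pt k b q))
      (vt R (cartB n (pcol n q') (pcol n q))) := by
  unfold Pts.zeta
  rw [conf_col, conf_col]
  split_ifs with h1 h2
  · rw [h1, vt_zero]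
    exact top_one
  · exact absurd (pt_lt.2 (Or.inl hk)) h2.not_gt
  · obtain ⟨c, hc⟩ := conf_x_of_ne (n := n) a η N ε hk.ne b q
    obtain ⟨c', hc'⟩ := conf_x_self (n := n) a η N ε b' q'
    rw [hc, hc']
    have h3 := ((top_C (-1 : R)).mul (top_mul_inv c c'))
    have h4 := (top_C (vt R (cartB n (pcol n q') (pcol n q)))).add h3
    rw [mul_zero, add_zero] at h4
    convert h4 using 1
    have h5 : ∀ m, vt R[T;T⁻¹] m = C (vt R m) := fun m => rfl
    rw [h5, map_neg, map_one]
    ring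

/-- the pairing of two roots. -/
def rpair (γ γ' : PosRootC n) : ℤ :=
  ∑ p ∈ site γ 0, ∑ p' ∈ site γ' 0, cartB n (pc n p) (pc n p')

theorem rpair_eq (γ γ' : PosRootC n) (k k' : ℕ) :
    rpair γ γ' = ∑ p ∈ site γ k, ∑ p' ∈ site γ' k', cartB n (pc n p) (pc n p') := by
  have h : ∀ (γ : PosRootC n) (k : ℕ) (F : ℕ → ℤ),
      ∑ p ∈ site γ k, F (pc n p) = ((wordC γ : Multiset ℕ).map F).sum := by
    intro γ k F
    rw [← site_map_pc γ k, Multiset.map_map]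
    rfl
  unfold rpair
  rw [h γ 0 fun c => ∑ p' ∈ site γ' 0, cartB n c (pc n p'),
    h γ k fun c => ∑ p' ∈ site γ' k', cartB n c (pc n p')]
  congr 1
  refine Multiset.map_congr rfl fun c _ => ?_
  rw [h γ' 0 fun c' => cartB n c c', h γ' k' fun c' => cartB n c c']

theorem vt_sum {ι : Type} (s : Finset ι) (f : ι → ℤ) :
    vt R (∑ i ∈ s, f i) = ∏ i ∈ s, vt R (f i) := by
  induction s using Finset.cons_induction with
  | empty => exact vt_zero
  | cons i s hi ih => rw [Finset.sum_cons, Finset.prod_cons, vt_add, ih]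

theorem top_sx_left {k : ℕ} (hk : k < N) :
    Top 0 (sx β (aext a N) (ηext η N ε) k N) 1 := by
  unfold sx Pts.cross
  have h : Top 0 (∏ p ∈ site (β k) k, ∏ q ∈ site (β N) N,
      (conf n (aext a N) (ηext η N ε)).zeta n p q)
      (∏ p ∈ site (β k) k, ∏ q ∈ site (β N) N, (1 : R)) := by
    refine Top.prod fun p hp => Top.prod fun p' hp' => ?_
    obtain ⟨k₁, b, q, rfl⟩ := exists_pt p
    obtain ⟨k₂, b', q', rfl⟩ := exists_pt p'
    obtain ⟨rfl, -⟩ := mem_site.1 hp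
    obtain ⟨rfl, -⟩ := mem_site.1 hp'
    exact top_zeta_left a η _ ε hk _ _ _ _
  simpa using h

theorem top_sx_right {k : ℕ} (hk : k < N) :
    Top 0 (sx β (aext a N) (ηext η N ε) N k) (vt R (rpair (β N) (β k))) := by
  unfold sx Pts.cross
  rw [rpair_eq (β N) (β k) N k, vt_sum]
  simp only [vt_sum]
  refine Top.prod fun p hp => Top.prod fun p' hp' => ?_
  obtain ⟨k₁, b, q, rfl⟩ := exists_pt p
  obtain ⟨k₂, b', q', rfl⟩ := exists_pt p'
  obtain ⟨rfl, -⟩ := mem_site.1 hp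
  obtain ⟨rfl, -⟩ := mem_site.1 hp'
  exact top_zeta_right a η _ ε hk _ _ _ _

end Extend

/-! ### Linear independence of the values -/

section Indep
open LaurentPolynomial
variable {n : ℕ} (β : ℕ → PosRootC n)

/-- the multiplicity factor of the largest index. -/
def kap (w : ℤ) (mx : Ix n) : List (Ix n) → KK
  | [] => 0
  | x :: l => if x = mx then kap w mx l + vpow (w * l.length) else kap w mx l

theorem kap_of_notMem (w : ℤ) {mx : Ix n} {l : List (Ix n)} (h : mx ∉ l) : kap w mx l = 0 := by
  induction l with
  | nil => rfl
  | cons x l ih =>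
    rw [List.mem_cons, not_or] at h
    rw [kap, if_neg (Ne.symm h.1), ih h.2]

theorem kap_replicate (w : ℤ) (mx : Ix n) (m : ℕ) :
    kap w mx (List.replicate m mx) = ∑ j ∈ Finset.range m, vpow w ^ j := by
  induction m with
  | zero => rfl
  | succ m ih =>
    rw [List.replicate_succ, kap, if_pos rfl, ih, Finset.sum_range_succ, List.length_replicate]
    congr 1
    unfold vpow
    rw [zpow_mul, zpow_natCast]

theorem eq_replicate_of_forall_ge {mx : Ix n} {l : List (Ix n)} (h : ∀ x ∈ l, x ≤ mx)
    (h' : ∀ x ∈ l, mx ≤ x) : l = List.replicate l.length mx :=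
  List.eq_replicate_iff.2 ⟨rfl, fun x hx => (h x hx).antisymm (h' x hx)⟩

theorem kap_ne_zero (w : ℤ) {mx : Ix n} {l : List (Ix n)} (hl : l.Pairwise (· ≤ ·))
    (h : ∀ x ∈ l, x ≤ mx) (hm : mx ∈ l) : kap w mx l ≠ 0 := by
  induction l with
  | nil => simp at hm
  | cons x l ih =>
    rw [List.pairwise_cons] at hl
    by_cases hx : x = mx
    · subst hx
      rw [eq_replicate_of_forall_ge h (by
        intro y hy
        rcases List.mem_cons.1 hy with rfl | hy
        · exact le_rfl
        · exact hl.1 y hy), kap_replicate, List.length_cons]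
      intro h0
      have h1 := geom_sum_mul (vpow w) (l.length + 1)
      rw [h0, zero_mul] at h1
      have h2 : vpow (w * ((l.length + 1 : ℕ) : ℤ)) = vpow 0 := by
        unfold vpow at h1 ⊢
        rw [zpow_mul, zpow_natCast, zpow_zero]
        exact (sub_eq_zero.1 h1.symm)
      have h3 := vpow_inj h2
      have h4 : w = 0 := by
        rcases mul_eq_zero.1 h3 with h | h
        · exact h
        · omega
      rw [h4, vpow_zero] at h0
      simp only [one_pow, Finset.sum_const, Finset.card_range, nsmul_eq_mul, mul_one] at h0
      exact Nat.succ_ne_zero l.length (Nat.cast_eq_zero.1 h0)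
    · rw [kap, if_neg hx]
      exact ih hl.2 (fun y hy => h y (List.mem_cons_of_mem _ hy))
        ((List.mem_cons.1 hm).resolve_left (Ne.symm hx))

variable {R : Type} [CommRing R] [Algebra KK R] (a η : ℕ → Rˣ) (N : ℕ) (ε : Rˣ)

theorem V_ext {A : Finset ℕ} (hA : ∀ k ∈ A, k < N) (l : List (Ix n)) :
    V β (aext a N) (ηext η N ε) A l = C (V β a η A l) := by
  refine map_V β a η (Ck R) (fun k hk => ?_) l
  unfold aext ηext
  rw [if_neg (hA k hk).ne, if_neg (hA k hk).ne]
  exact ⟨rfl, rfl⟩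

theorem V_cons_insert {A : Finset ℕ} (hA : N ∉ A) (x : Ix n) (l : List (Ix n)) :
    V β a η (insert N A) (x :: l) =
      (if β N = (ofLex x).1 then (((a N ^ (ofLex x).2 : Rˣ) : R) *
        ((η N : R) - 1) ^ mexp (ofLex x).1) *
        ((∏ k' ∈ A, sx β a η N k') * V β a η A l) else 0) +
      ∑ k ∈ A.filter (fun k => β k = (ofLex x).1),
        (((a k ^ (ofLex x).2 : Rˣ) : R) * ((η k : R) - 1) ^ mexp (ofLex x).1) *
        ((∏ k' ∈ A.erase k, sx β a η k k') * (sx β a η k N * V β a η (insert N (A.erase k)) l)) := by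
  have hne : ∀ k ∈ A.filter (fun k => β k = (ofLex x).1), N ≠ k := fun k hk h =>
    hA (h ▸ (Finset.mem_filter.1 hk).1)
  have h1 : ∀ k ∈ A.filter (fun k => β k = (ofLex x).1),
      (((a k ^ (ofLex x).2 : Rˣ) : R) * ((η k : R) - 1) ^ mexp (ofLex x).1) *
        ((∏ k' ∈ (insert N A).erase k, sx β a η k k') * V β a η ((insert N A).erase k) l) =
      (((a k ^ (ofLex x).2 : Rˣ) : R) * ((η k : R) - 1) ^ mexp (ofLex x).1) *
        ((∏ k' ∈ A.erase k, sx β a η k k') *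
          (sx β a η k N * V β a η (insert N (A.erase k)) l)) := by
    intro k hk
    rw [Finset.erase_insert_of_ne (hne k hk), Finset.prod_insert fun h =>
      hA (Finset.mem_of_mem_erase h)]
    ring
  rw [V, Finset.filter_insert]
  split_ifs with h
  · rw [Finset.sum_insert fun h => hA (Finset.mem_filter.1 h).1, Finset.erase_insert hA,
      Finset.sum_congr rfl h1]
  · rw [zero_add, Finset.sum_congr rfl h1]

theorem V_replicate_ne_zero {A : Finset ℕ} {mx : Ix n} {m : ℕ}
    (h : V β a η A (List.replicate m mx) ≠ 0) :
    A.card = m ∧ ∀ k ∈ A, β k = (ofLex mx).1 := by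
  have h1 := types_of_V_ne_zero β a η h
  refine ⟨?_, fun k hk => ?_⟩
  · have := congrArg Multiset.card h1
    simpa [types] using this.symm
  · have h2 : β k ∈ (types (List.replicate m mx) : Multiset (PosRootC n)) := by
      rw [h1]; exact Multiset.mem_map_of_mem _ hk
    simp only [types, List.map_replicate, Multiset.mem_coe, List.mem_replicate] at h2
    exact h2.2

theorem top_V {A : Finset ℕ} (hA : ∀ k ∈ A, k < N) {mx : Ix n} (hmx : (ofLex mx).1 = β N)
    {l : List (Ix n)} (hl : l.Pairwise (· ≤ ·)) (h : ∀ x ∈ l, x ≤ mx) :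
    Top (ofLex mx).2 (V β (aext a N) (ηext η N ε) (insert N A) l)
      (algebraMap KK R (kap (rpair (β N) (β N)) mx l) * V β a η A (l.erase mx) *
        ((ε : R) - 1) ^ mexp (β N)) := by
  have hNA : N ∉ A := fun h => lt_irrefl _ (hA N h)
  induction l generalizing A with
  | nil =>
    rw [V, if_neg (Finset.insert_ne_empty _ _), kap, map_zero, zero_mul, zero_mul]
    exact top_zero _
  | cons x l ih =>
    rw [List.pairwise_cons] at hl
    have hx := h x List.mem_cons_self
    have hsum : Top (ofLex mx).2
        (∑ k ∈ A.filter (fun k => β k = (ofLex x).1),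
          (((aext a N k ^ (ofLex x).2 : R[T;T⁻¹]ˣ) : R[T;T⁻¹]) *
            ((ηext η N ε k : R[T;T⁻¹]) - 1) ^ mexp (ofLex x).1) *
          ((∏ k' ∈ A.erase k, sx β (aext a N) (ηext η N ε) k k') *
            (sx β (aext a N) (ηext η N ε) k N *
              V β (aext a N) (ηext η N ε) (insert N (A.erase k)) l)))
        (algebraMap KK R (kap (rpair (β N) (β N)) mx l) * V β a η A (x :: l.erase mx) *
        ((ε : R) - 1) ^ mexp (β N)) := by
      have h2 : algebraMap KK R (kap (rpair (β N) (β N)) mx l) * V β a η A (x :: l.erase mx) *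
          ((ε : R) - 1) ^ mexp (β N) = ∑ k ∈ A.filter (fun k => β k = (ofLex x).1),
          ((((a k ^ (ofLex x).2 : Rˣ) : R) * ((η k : R) - 1) ^ mexp (ofLex x).1) *
            (∏ k' ∈ A.erase k, sx β a η k k')) * (1 *
            (algebraMap KK R (kap (rpair (β N) (β N)) mx l) * V β a η (A.erase k) (l.erase mx) *
        ((ε : R) - 1) ^ mexp (β N))) := by
        rw [V, Finset.mul_sum, Finset.sum_mul]
        exact Finset.sum_congr rfl fun k _ => by ring
      rw [h2]
      refine Top.sum fun k hk => ?_
      have hkA := (Finset.mem_filter.1 hk).1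
      have h3 := ih (A := A.erase k) (fun k' hk' => hA k' (Finset.mem_of_mem_erase hk')) hl.2
        (fun y hy => h y (List.mem_cons_of_mem _ hy)) fun h => hNA (Finset.mem_of_mem_erase h)
      have h4 := (top_sx_left β a η N ε (hA k hkA)).mul h3
      have h5 : (((aext a N k ^ (ofLex x).2 : R[T;T⁻¹]ˣ) : R[T;T⁻¹]) *
            ((ηext η N ε k : R[T;T⁻¹]) - 1) ^ mexp (ofLex x).1) *
          (∏ k' ∈ A.erase k, sx β (aext a N) (ηext η N ε) k k') =
          C ((((a k ^ (ofLex x).2 : Rˣ) : R) * ((η k : R) - 1) ^ mexp (ofLex x).1) *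
            (∏ k' ∈ A.erase k, sx β a η k k')) := by
        rw [map_mul, map_prod, map_mul, map_pow, map_sub, map_one]
        congr 1
        · unfold aext ηext
          rw [if_neg (hA k hkA).ne, if_neg (hA k hkA).ne, ← map_zpow]
          rfl
        · refine Finset.prod_congr rfl fun k' hk' => ?_
          have hk'A := Finset.mem_of_mem_erase hk'
          refine map_sx β a η (Ck R) ?_ ?_ ?_ ?_
          · unfold aext
            rw [if_neg (hA k hkA).ne]
          · unfold ηext
            rw [if_neg (hA k hkA).ne]
          · unfold aext
            rw [if_neg (hA k' hk'A).ne]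
          · unfold ηext
            rw [if_neg (hA k' hk'A).ne]
      rw [← mul_assoc, h5]
      have h6 := (top_C ((((a k ^ (ofLex x).2 : Rˣ) : R) * ((η k : R) - 1) ^ mexp (ofLex x).1) *
            (∏ k' ∈ A.erase k, sx β a η k k'))).mul h4
      rwa [zero_add, zero_add] at h6
    have hN : β N = (ofLex x).1 → Top (ofLex x).2
        ((((aext a N N ^ (ofLex x).2 : R[T;T⁻¹]ˣ) : R[T;T⁻¹]) *
        ((ηext η N ε N : R[T;T⁻¹]) - 1) ^ mexp (ofLex x).1) *
        ((∏ k' ∈ A, sx β (aext a N) (ηext η N ε) N k') * V β (aext a N) (ηext η N ε) A l))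
        ((1 * ((ε : R) - 1) ^ mexp (β N)) * ((∏ k ∈ A, vt R (rpair (β N) (β k))) * V β a η A l)) := by
      intro hβ
      rw [← hβ, V_ext β a η N ε hA]
      have h1 : ((aext a N N ^ (ofLex x).2 : R[T;T⁻¹]ˣ) : R[T;T⁻¹]) = T (ofLex x).2 := by
        unfold aext
        rw [if_pos rfl, Tunit_zpow]
      have h2 : ((ηext η N ε N : R[T;T⁻¹]) - 1) ^ mexp (β N) = C (((ε : R) - 1) ^ mexp (β N)) := by
        unfold ηext
        rw [if_pos rfl, map_pow, map_sub, map_one]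
        rfl
      rw [h1, h2]
      have h3 := ((top_T (R := R) (ofLex x).2).mul (top_C (((ε : R) - 1) ^ mexp (β N)))).mul
        ((Top.prod fun k hk => top_sx_right β a η N ε (hA k hk)).mul (top_C (V β a η A l)))
      rwa [add_zero, add_zero, add_zero] at h3
    rw [V_cons_insert β (aext a N) (ηext η N ε) N hNA]
    by_cases hxm : x = mx
    · subst hxm
      rw [if_pos hmx.symm, kap, if_pos rfl, List.erase_cons_head]
      have h7 := (hN hmx.symm).add hsum
      convert h7 using 1
      have hrep : l = List.replicate l.length x := eq_replicate_of_forall_ge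
        (fun y hy => h y (List.mem_cons_of_mem _ hy)) hl.1
      have h9 : algebraMap KK R (kap (rpair (β N) (β N)) x l) * V β a η A (x :: l.erase x) =
          algebraMap KK R (kap (rpair (β N) (β N)) x l) * V β a η A l := by
        cases l with
        | nil => rw [kap, map_zero, zero_mul, zero_mul]
        | cons y l =>
          have : y = x := (h y (by simp)).antisymm (hl.1 y (by simp))
          rw [this, List.erase_cons_head]
      have h8 : (∏ k ∈ A, vt R (rpair (β N) (β k))) * V β a η A l =
          algebraMap KK R (vpow (rpair (β N) (β N) * l.length)) * V β a η A l := by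
        by_cases h0 : V β a η A l = 0
        · rw [h0, mul_zero, mul_zero]
        · rw [hrep] at h0
          obtain ⟨hc, hb⟩ := V_replicate_ne_zero β a η h0
          congr 1
          rw [Finset.prod_congr rfl fun k hk => by rw [hb k hk, hmx], Finset.prod_const, hc]
          unfold vt vpow
          rw [zpow_mul, zpow_natCast, map_pow]
      rw [h9, h8, map_add]
      ring
    · rw [kap, if_neg hxm, List.erase_cons_tail (by simpa using hxm)]
      split_ifs with hβ
      · have h7 := ((hN hβ).shift (M' := (ofLex mx).2) ?_).add hsum
        · rwa [zero_add] at h7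
        · have h8 := lt_of_le_of_ne hx hxm
          rw [Prod.Lex.lt_iff] at h8
          rcases h8 with h8 | h8
          · rw [hmx, hβ] at h8
            exact absurd h8 (lt_irrefl _)
          · exact h8.2
      · rwa [zero_add]


theorem eq_append_of_mem {mx : Ix n} {l : List (Ix n)} (hl : l.Pairwise (· ≤ ·))
    (h : ∀ x ∈ l, x ≤ mx) (hm : mx ∈ l) : l = l.erase mx ++ [mx] := by
  refine List.Perm.eq_of_pairwise (le := (· ≤ ·)) (fun a b _ _ h h' => le_antisymm h h') hl ?_ ?_
  · rw [List.pairwise_append]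
    refine ⟨hl.erase mx, List.pairwise_singleton _ _, fun x hx y hy => ?_⟩
    rw [List.mem_singleton] at hy
    exact hy ▸ h x (List.mem_of_mem_erase hx)
  · exact (List.perm_cons_erase hm).trans (List.perm_append_singleton _ _).symm

theorem eq_zero_of_sum_V (N : ℕ) : ∀ (s : Finset (List (Ix n))) (c : List (Ix n) → KK),
    (∀ l ∈ s, l.Pairwise (· ≤ ·) ∧ types l = (List.range N).map β) →
    (∀ (R : Type) [CommRing R] [Algebra KK R] (a η : ℕ → Rˣ),
      (∀ k < N, ((η k : R) - 1) ^ (mexp (β k) + 1) = 0) →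
      ∑ l ∈ s, c l • V β a η (Finset.range N) l = 0) → ∀ l ∈ s, c l = 0 := by
  induction N with
  | zero =>
    intro s c hs h l hl
    have hnil : ∀ l ∈ s, l = [] := fun l hl => List.map_eq_nil_iff.1 (hs l hl).2
    have h1 := h KK (fun _ => 1) (fun _ => 1) (by simp)
    have hs' : s = {l} := by
      refine Finset.eq_singleton_iff_unique_mem.2 ⟨hl, fun l' hl' => ?_⟩
      rw [hnil l hl, hnil l' hl']
    rw [hs', Finset.sum_singleton, hnil l hl, V, if_pos Finset.range_zero, smul_eq_mul,
      mul_one] at h1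
    rw [hnil l hl, h1]
  | succ N ih =>
    classical
    intro s c hs h
    by_contra! hne
    have hlast : ∀ l ∈ s, ∃ z : ℤ, toLex (β N, z) ∈ l ∧ ∀ x ∈ l, x ≤ toLex (β N, z) := by
      intro l hl
      obtain ⟨h1, h2⟩ := hs l hl
      have hlne : l ≠ [] := by
        rintro rfl
        simp [types, List.range_succ] at h2
      have h3 : (ofLex (l.getLast hlne)).1 = β N := by
        have h4 : (types l).getLast? = some (β N) := by
          rw [h2, List.range_succ, List.map_append, List.map_cons, List.map_nil,
            List.getLast?_concat]
        unfold types at h4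
        rw [List.getLast?_map, List.getLast?_eq_some_getLast hlne] at h4
        exact Option.some.inj h4
      refine ⟨(ofLex (l.getLast hlne)).2, ?_, ?_⟩
      · rw [← h3]
        exact List.getLast_mem hlne
      · intro x hx
        rw [← h3]
        have h5 := List.dropLast_append_getLast hlne
        rw [← h5, List.pairwise_append] at h1
        rw [← h5] at hx
        rcases List.mem_append.1 hx with hx | hx
        · exact h1.2.2 x hx _ (by simp)
        · rw [List.mem_singleton] at hx
          rw [hx]
          exact le_rfl
    choose! z hz using hlast
    obtain ⟨l₁, hl₁, hc₁⟩ := hne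
    obtain ⟨l₀, hl₀, hmax⟩ := (s.filter fun l => c l ≠ 0).exists_max_image z
      ⟨l₁, Finset.mem_filter.2 ⟨hl₁, hc₁⟩⟩
    obtain ⟨hl₀s, hc₀⟩ := Finset.mem_filter.1 hl₀
    set mx : Ix n := toLex (β N, z l₀) with hmx
    have hle : ∀ l ∈ s.filter (fun l => c l ≠ 0), ∀ x ∈ l, x ≤ mx := by
      intro l hl x hx
      refine ((hz l (Finset.mem_filter.1 hl).1).2 x hx).trans ?_
      exact Prod.Lex.le_iff.2 (Or.inr ⟨rfl, hmax l hl⟩)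
    set s' := (s.filter fun l => c l ≠ 0).filter fun l => mx ∈ l with hs'
    have hs'm : ∀ {l}, l ∈ s' ↔ (l ∈ s ∧ c l ≠ 0) ∧ mx ∈ l := by
      intro l
      rw [hs', Finset.mem_filter, Finset.mem_filter]
    have happ : ∀ l ∈ s', l = l.erase mx ++ [mx] := fun l hl =>
      eq_append_of_mem (hs l (hs'm.1 hl).1.1).1 (hle l (Finset.mem_filter.1 hl).1) (hs'm.1 hl).2
    set w := rpair (β N) (β N)
    have key := ih (s'.image fun l => l.erase mx)
      (fun l' => c (l' ++ [mx]) * kap w mx (l' ++ [mx])) ?_ ?_ (l₀.erase mx)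
      (Finset.mem_image_of_mem _ (hs'm.2 ⟨⟨hl₀s, hc₀⟩, (hz l₀ hl₀s).1⟩))
    · have h1 := happ l₀ (hs'm.2 ⟨⟨hl₀s, hc₀⟩, (hz l₀ hl₀s).1⟩)
      rw [← h1] at key
      rcases mul_eq_zero.1 key with h2 | h2
      · exact hc₀ h2
      · exact kap_ne_zero w (hs l₀ hl₀s).1 (hle l₀ hl₀) (hz l₀ hl₀s).1 h2
    · intro l' hl'
      obtain ⟨l, hl, rfl⟩ := Finset.mem_image.1 hl'
      refine ⟨(hs l (hs'm.1 hl).1.1).1.erase mx, ?_⟩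
      have h1 := (hs l (hs'm.1 hl).1.1).2
      rw [happ l hl, List.range_succ, List.map_append] at h1
      unfold types at h1 ⊢
      rw [List.map_append] at h1
      exact (List.append_inj' h1 rfl).1
    · intro R _ _ a η hη
      have hinj : Set.InjOn (fun l : List (Ix n) => l.erase mx) s' := by
        intro l hl l' hl' hll
        have hll : l.erase mx = l'.erase mx := hll
        rw [happ l hl, happ l' hl', hll]
      rw [Finset.sum_image hinj]
      set m := mexp (β N) with hm
      set I : Ideal (Polynomial R) := Ideal.span {Polynomial.X ^ (m + 1)} with hI
      set Q := Polynomial R ⧸ I with hQ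
      set f : R →ₐ[KK] Q := (Ideal.Quotient.mkₐ KK I).comp (Polynomial.CAlgHom) with hf
      set e : Q := Ideal.Quotient.mk I Polynomial.X with he
      have hee : e ^ (m + 1) = 0 := by
        rw [he, ← map_pow]
        exact Ideal.Quotient.eq_zero_iff_mem.2 (Ideal.mem_span_singleton_self _)
      have hfe : ∀ t : R, f t * e ^ m = 0 → t = 0 := by
        intro t ht
        have h1 : Ideal.Quotient.mk I (Polynomial.C t * Polynomial.X ^ m) = 0 := by
          rw [map_mul, map_pow]
          exact ht
        rw [Ideal.Quotient.eq_zero_iff_mem, hI, Ideal.mem_span_singleton,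
          Polynomial.X_pow_dvd_iff] at h1
        have h2 := h1 m (Nat.lt_succ_self m)
        rwa [Polynomial.coeff_C_mul_X_pow, if_pos rfl] at h2
      obtain ⟨ε, hε⟩ : IsUnit (1 + e) := IsNilpotent.isUnit_one_add ⟨m + 1, hee⟩
      have hε' : (ε : Q) - 1 = e := by rw [hε]; ring
      set a' : ℕ → Qˣ := fun k => Units.map f (a k) with ha'
      set η' : ℕ → Qˣ := fun k => Units.map f (η k) with hη'
      have h0 := h (LaurentPolynomial Q) (aext a' N) (ηext η' N ε) ?_
      · have h1 : Top (z l₀) (∑ l ∈ s, c l • V β (aext a' N) (ηext η' N ε)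
            (Finset.range (N + 1)) l)
            (∑ l ∈ s, algebraMap KK Q (c l) *
              (algebraMap KK Q (kap w mx l) * V β a' η' (Finset.range N) (l.erase mx) *
                ((ε : Q) - 1) ^ m)) := by
          refine Top.sum fun l hl => ?_
          by_cases hc : c l = 0
          · rw [hc, zero_smul, map_zero, zero_mul]
            exact top_zero _
          · have h2 := top_V β a' η' N ε (A := Finset.range N) (fun k hk => Finset.mem_range.1 hk)
              (mx := mx) rfl (hs l hl).1 (hle l (Finset.mem_filter.2 ⟨hl, hc⟩))
            rw [Finset.range_add_one]
            have h3 := (top_C (algebraMap KK Q (c l))).mul h2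
            rw [zero_add] at h3
            rw [Algebra.smul_def]
            exact h3
        rw [h0] at h1
        have h2 := h1.eq_zero
        refine hfe _ ?_
        rw [map_sum, Finset.sum_mul, ← h2]
        refine Finset.sum_subset_zero_on_sdiff (fun l hl => (hs'm.1 hl).1.1) ?_ ?_
        · intro l hl
          obtain ⟨hls, hls'⟩ := Finset.mem_sdiff.1 hl
          by_cases hc : c l = 0
          · rw [hc, map_zero, zero_mul]
          · rw [kap_of_notMem w (fun hm => hls' (hs'm.2 ⟨⟨hls, hc⟩, hm⟩)), map_zero]
            ring
        · intro l hl
          rw [Algebra.smul_def, map_mul f, f.commutes, map_mul, ← happ l hl, hε',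
            map_V β a η f (a' := a') (η' := η') (fun k _ => ⟨rfl, rfl⟩)]
          ring
      · intro k hk
        have hCk : ∀ x : Q, ((Ck Q) x - 1) = (Ck Q) (x - 1) := fun x => by
          rw [map_sub, map_one]
        unfold ηext
        rw [Units.coe_map]
        change ((Ck Q) _ - 1) ^ _ = 0
        rw [hCk, ← map_pow]
        split_ifs with hkN
        · rw [hε', hkN, hee, map_zero]
        · have h1 := congrArg f (hη k (by omega))
          rw [map_zero, map_pow, map_sub, map_one] at h1
          change (Ck Q) ((f (η k) - 1) ^ _) = 0
          rw [h1, map_zero]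

end Indep

/-! ### Triangularity with respect to the degree filtration -/

section Kernel
variable {n : ℕ}

/-- the elements all of whose values at configurations of degree `d` vanish. -/
def Ker (d : List (PosRootC n)) : Submodule KK (UC n) where
  carrier := {x | ∀ β : ℕ → PosRootC n, (List.range d.length).map β = d →
    ∀ (T : Type) [CommRing T] [Algebra KK T] (a η : ℕ → Tˣ),
      (∀ k < d.length, ((η k : T) - 1) ^ (mexp (β k) + 1) = 0) →
      (conf n a η).Phi n (sites β (Finset.range d.length))
        (sites β (Finset.range d.length)) x = 0}
  add_mem' hx hy β hβ T _ _ a η h := by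
    rw [Pts.Phi_add, hx β hβ T a η h, hy β hβ T a η h, add_zero]
  zero_mem' β hβ T _ _ a η h := ((conf n a η).PhiL n _ _).map_zero
  smul_mem' c x hx β hβ T _ _ a η h := by
    rw [Pts.Phi_smul, hx β hβ T a η h, smul_zero]

theorem exists_map_range (hn : 2 ≤ n) (d : List (PosRootC n)) :
    ∃ β : ℕ → PosRootC n, (List.range d.length).map β = d := by
  rcases d with _ | ⟨γ, d⟩
  · refine ⟨fun _ => ⟨toLex (⟨1, by omega⟩, ⟨0, by omega⟩), ?_⟩, rfl⟩
    refine ⟨le_rfl, fun _ => rfl, ?_⟩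
    change 0 + 2 * 1 ≤ 2 * n
    omega
  · refine ⟨fun k => (γ :: d).getD k γ, ?_⟩
    refine List.ext_getElem (by simp) fun k h₁ h₂ => ?_
    simp only [List.getElem_map, List.getElem_range]
    rw [List.getD_eq_getElem _ _ h₂]

/-- a choice of all quantum root vectors. -/
def IsFam (E : Ix n → UC n) : Prop := ∀ x : Ix n, IsRVC (ofLex x).1 (ofLex x).2 (E x)

theorem IsFam.exists_lead (hn : 2 ≤ n) {E : Ix n → UC n} (hE : IsFam E) :
    ∃ u : Ix n → KK, (∀ x, u x ≠ 0) ∧ ∀ x : Ix n, IsLead (ofLex x).1 (ofLex x).2 (E x) (u x) := by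
  choose u hu hu' using fun x => IsRVC.eval hn (hE x)
  exact ⟨u, hu, fun x T _ _ a η U k => hu' x T a η U k⟩

theorem range_val_map (β : ℕ → PosRootC n) (N : ℕ) :
    (Finset.range N).val.map β = ((List.range N).map β : Multiset (PosRootC n)) := rfl

theorem Phi_prod_of_types_le (hn : 2 ≤ n) {E : Ix n → UC n} (hE : IsFam E) {u : Ix n → KK}
    (hu : ∀ x : Ix n, IsLead (ofLex x).1 (ofLex x).2 (E x) (u x)) {d : List (PosRootC n)}
    (hd : d.Pairwise (· ≤ ·)) {l : List (Ix n)} (hl : types l ≤ d)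
    {β : ℕ → PosRootC n} (hβ : (List.range d.length).map β = d)
    {T : Type} [CommRing T] [Algebra KK T] (a η : ℕ → Tˣ)
    (h : ∀ k < d.length, ((η k : T) - 1) ^ (mexp (β k) + 1) = 0) :
    (conf n a η).Phi n (sites β (Finset.range d.length)) (sites β (Finset.range d.length))
      (l.map E).prod = algebraMap KK T (l.map u).prod * V β a η (Finset.range d.length) l := by
  refine Phi_prod β a η hn hE hu (Finset.Subset.refl _) ?_ ?_
  · intro k hk hI
    have h1 := h k (Finset.mem_range.1 hk)
    have h2 : mexp (β k) + 1 = n - ri (β k) := by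
      unfold mexp
      rw [if_pos hI]
      unfold isINI at hI
      omega
    rwa [h2] at h1
  · refine low_of_types_le β ?_
    rw [range_val_map, hβ]
    have h1 : (d : Multiset (PosRootC n)).sort (· ≤ ·) = d :=
      List.Perm.eq_of_pairwise (le := (· ≤ ·)) (fun a b _ _ h h' => le_antisymm h h')
        (Multiset.pairwise_sort _ _) hd (Multiset.coe_eq_coe.1 (Multiset.sort_eq _ _))
    rw [h1]
    exact hl

theorem pairwise_types {l : List (Ix n)} (hl : l.Pairwise (· ≤ ·)) :
    (types l).Pairwise (· ≤ ·) := by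
  unfold types
  rw [List.pairwise_map]
  refine hl.imp fun {x y} h => ?_
  rcases Prod.Lex.le_iff.1 h with h | h
  · exact h.le
  · exact h.1.le

theorem mem_Ker_of_types_lt (hn : 2 ≤ n) {E : Ix n → UC n} (hE : IsFam E)
    {d : List (PosRootC n)} (hd : d.Pairwise (· ≤ ·)) {l : List (Ix n)}
    (hl : l.Pairwise (· ≤ ·)) (h : types l < d) : (l.map E).prod ∈ Ker d := by
  obtain ⟨u, -, hu⟩ := hE.exists_lead hn
  intro β hβ T _ _ a η hη
  rw [Phi_prod_of_types_le hn hE hu hd h.le hβ a η hη]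
  by_contra hne
  have h1 := types_of_V_ne_zero β a η (right_ne_zero_of_mul hne)
  rw [range_val_map, hβ] at h1
  exact h.ne (List.Perm.eq_of_pairwise (le := (· ≤ ·)) (fun a b _ _ h h' => le_antisymm h h')
    (pairwise_types hl) hd (Multiset.coe_eq_coe.1 h1))

theorem eq_zero_of_sum_mem_Ker (hn : 2 ≤ n) {E : Ix n → UC n} (hE : IsFam E)
    {d : List (PosRootC n)} (s : Finset (List (Ix n))) (c : List (Ix n) → KK)
    (hs : ∀ l ∈ s, l.Pairwise (· ≤ ·) ∧ types l = d)
    (h : ∑ l ∈ s, c l • (l.map E).prod ∈ Ker d) : ∀ l ∈ s, c l = 0 := by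
  obtain ⟨u, hu0, hu⟩ := hE.exists_lead hn
  obtain ⟨β, hβ⟩ := exists_map_range hn d
  intro l hl
  have key := eq_zero_of_sum_V β d.length s (fun l => c l * (l.map u).prod)
    (fun l hl => ⟨(hs l hl).1, by rw [(hs l hl).2, hβ]⟩) ?_ l hl
  · rcases mul_eq_zero.1 key with h1 | h1
    · exact h1
    · rw [List.prod_eq_zero_iff, List.mem_map] at h1
      obtain ⟨x, -, hx⟩ := h1
      exact absurd hx (hu0 x)
  · intro T _ _ a η hη
    have h1 := h β hβ T a η hη
    have h2 := map_sum ((conf n a η).PhiL n (sites β (Finset.range d.length))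
      (sites β (Finset.range d.length))) (fun l => c l • (l.map E).prod) s
    have h3 : ∑ l ∈ s, (conf n a η).Phi n (sites β (Finset.range d.length))
        (sites β (Finset.range d.length)) (c l • (l.map E).prod) = 0 := h2.symm.trans h1
    rw [← h3]
    refine Finset.sum_congr rfl fun l hl => ?_
    have hd : d.Pairwise (· ≤ ·) := (hs l hl).2 ▸ pairwise_types (hs l hl).1
    rw [Pts.Phi_smul, Phi_prod_of_types_le hn hE hu hd (hs l hl).2.le hβ a η hη, mul_smul,
      ← Algebra.smul_def]

theorem exists_smul_sub_mem_Ker (hn : 2 ≤ n) {E E' : Ix n → UC n} (hE : IsFam E)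
    (hE' : IsFam E') {l : List (Ix n)} (hl : l.Pairwise (· ≤ ·)) :
    ∃ t : KK, (l.map E').prod - t • (l.map E).prod ∈ Ker (types l) := by
  obtain ⟨u, hu0, hu⟩ := hE.exists_lead hn
  obtain ⟨u', -, hu'⟩ := hE'.exists_lead hn
  refine ⟨(l.map u').prod / (l.map u).prod, fun β hβ T _ _ a η hη => ?_⟩
  have hne : (l.map u).prod ≠ 0 := by
    rw [Ne, List.prod_eq_zero_iff, List.mem_map]
    rintro ⟨x, -, hx⟩
    exact hu0 x hx
  rw [Pts.Phi_sub, Pts.Phi_smul,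
    Phi_prod_of_types_le hn hE hu (pairwise_types hl) le_rfl hβ a η hη,
    Phi_prod_of_types_le hn hE' hu' (pairwise_types hl) le_rfl hβ a η hη, Algebra.smul_def,
    ← mul_assoc, ← map_mul, div_mul_cancel₀ _ hne, sub_self]

theorem coeff_eq_zero (hn : 2 ≤ n) {E : Ix n → UC n} (hE : IsFam E)
    (G : Set (List (PosRootC n))) (s : Finset (List (Ix n))) (c : List (Ix n) → KK)
    (hs : ∀ l ∈ s, l.Pairwise (· ≤ ·))
    (hG : ∀ l ∈ s, ∀ d ∈ G, d < types l → types l ∈ G)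
    (h : ∀ d ∈ G, ∑ l ∈ s, c l • (l.map E).prod ∈ Ker d) :
    ∀ l ∈ s, types l ∈ G → c l = 0 := by
  classical
  by_contra! hne
  obtain ⟨l₁, hl₁, hG₁, hc₁⟩ := hne
  obtain ⟨l₀, hl₀, hmax⟩ := (s.filter fun l => types l ∈ G ∧ c l ≠ 0).exists_max_image types
    ⟨l₁, Finset.mem_filter.2 ⟨hl₁, hG₁, hc₁⟩⟩
  obtain ⟨hl₀s, hG₀, hc₀⟩ := Finset.mem_filter.1 hl₀
  have h1 := h _ hG₀
  rw [← Finset.sum_filter_add_sum_filter_not s fun l => types l = types l₀] at h1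
  have h2 : ∑ l ∈ s.filter (fun l => ¬types l = types l₀), c l • (l.map E).prod ∈
      Ker (types l₀) := by
    refine Submodule.sum_mem _ fun l hl => ?_
    obtain ⟨hls, hlt⟩ := Finset.mem_filter.1 hl
    by_cases hc : c l = 0
    · rw [hc, zero_smul]
      exact Submodule.zero_mem _
    · refine Submodule.smul_mem _ _ (mem_Ker_of_types_lt hn hE (pairwise_types (hs l₀ hl₀s))
        (hs l hls) ?_)
      refine lt_of_le_of_ne (not_lt.1 fun hlt' => ?_) hlt
      exact (hmax l (Finset.mem_filter.2 ⟨hls, hG l hls _ hG₀ hlt', hc⟩)).not_gt hlt'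
  exact hc₀ (eq_zero_of_sum_mem_Ker hn hE (s.filter fun l => types l = types l₀) c
    (fun l hl => ⟨hs l (Finset.mem_filter.1 hl).1, (Finset.mem_filter.1 hl).2⟩)
    ((Submodule.add_mem_iff_left _ h2).1 h1) l₀ (Finset.mem_filter.2 ⟨hl₀s, rfl⟩))

/-- the total height of a list of roots. -/
def totHt (d : List (PosRootC n)) : ℕ := (d.map heightC).sum

theorem wordC_ne_nil (γ : PosRootC n) : wordC γ ≠ [] := by
  have h1 := rt_add_le γ
  have h2 := rt_eq_zero γ
  intro h
  have h3 := congrArg List.length h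
  unfold wordC at h3
  dsimp only at h3
  split_ifs at h3 <;> simp at h3

theorem length_le_totHt (d : List (PosRootC n)) : d.length ≤ totHt d := by
  induction d with
  | nil => exact Nat.zero_le _
  | cons γ d ih =>
    have h : 0 < heightC γ := List.length_pos_of_ne_nil (wordC_ne_nil γ)
    have h' : totHt (γ :: d) = heightC γ + totHt d := by simp [totHt]
    rw [h', List.length_cons]
    omega

theorem finite_totHt (m : ℕ) : {d : List (PosRootC n) | totHt d = m}.Finite :=
  (List.finite_length_le (PosRootC n) m).subset fun d hd => (length_le_totHt d).trans_eq hd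

/-- the span of the ordered monomials of total height `m`. -/
def monSpan (E : Ix n → UC n) (m : ℕ) : Submodule KK (UC n) :=
  Submodule.span KK ((fun l : List (Ix n) => (l.map E).prod) ''
    {l | l.Pairwise (· ≤ ·) ∧ totHt (types l) = m})

theorem exists_sum_of_mem_monSpan {E : Ix n → UC n} {m : ℕ} {x : UC n} (h : x ∈ monSpan E m) :
    ∃ (s : Finset (List (Ix n))) (c : List (Ix n) → KK),
      (∀ l ∈ s, l.Pairwise (· ≤ ·) ∧ totHt (types l) = m) ∧ x = ∑ l ∈ s, c l • (l.map E).prod := by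
  obtain ⟨f, hf, rfl⟩ := (Finsupp.mem_span_image_iff_linearCombination KK).1 h
  exact ⟨f.support, f, fun l hl => hf hl, by rw [Finsupp.linearCombination_apply]; rfl⟩

theorem le_monSpan (hn : 2 ≤ n) (m : ℕ) (W : Submodule KK (UC n))
    (hW : ∀ E : Ix n → UC n, IsFam E → ∀ l : List (Ix n), l.Pairwise (· ≤ ·) →
      totHt (types l) = m → (l.map E).prod ∈ W)
    (hspan : ∀ x ∈ W, ∃ E : Ix n → UC n, IsFam E ∧ x ∈ monSpan E m)
    {E : Ix n → UC n} (hE : IsFam E) : W ≤ monSpan E m := by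
  classical
  set D := (finite_totHt (n := n) m).toFinset.filter (fun d => d.Pairwise (· ≤ ·)) with hD
  have hDm : ∀ {d}, d ∈ D ↔ totHt d = m ∧ d.Pairwise (· ≤ ·) := fun {d} => by
    rw [hD, Finset.mem_filter, Set.Finite.mem_toFinset]
    rfl
  have key : ∀ (k : ℕ) (F : Finset (List (PosRootC n))), F ⊆ D → F.card = k →
      (∀ d ∈ F, ∀ d' ∈ D, d' < d → d' ∈ F) → ∀ x ∈ W, (∀ d ∈ D, d ∉ F → x ∈ Ker d) →
      x ∈ monSpan E m := by
    intro k
    induction k with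
    | zero =>
      intro F hFD hF hlow x hx hxK
      rw [Finset.card_eq_zero] at hF
      subst hF
      obtain ⟨E', hE', hx'⟩ := hspan x hx
      obtain ⟨s, c, hs, rfl⟩ := exists_sum_of_mem_monSpan hx'
      have h0 := coeff_eq_zero hn hE' D s c (fun l hl => (hs l hl).1)
        (fun l hl _ _ _ => hDm.2 ⟨(hs l hl).2, pairwise_types (hs l hl).1⟩) (fun d hd => hxK d hd (Finset.notMem_empty _))
      rw [Finset.sum_eq_zero fun l hl => by rw [h0 l hl (hDm.2 ⟨(hs l hl).2, pairwise_types (hs l hl).1⟩), zero_smul]]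
      exact Submodule.zero_mem _
    | succ k ih =>
      intro F hFD hF hlow x hx hxK
      have hFne : F.Nonempty := Finset.card_pos.1 (by omega)
      set d := F.max' hFne with hd
      have hdF : d ∈ F := F.max'_mem hFne
      obtain ⟨E', hE', hx'⟩ := hspan x hx
      obtain ⟨s, c, hs, hxs⟩ := exists_sum_of_mem_monSpan hx'
      have h0 : ∀ l ∈ s, types l ∉ F → c l = 0 := by
        intro l hl hlF
        refine coeff_eq_zero hn hE' {d | d ∈ D ∧ d ∉ F} s c (fun l hl => (hs l hl).1)
          ?_ ?_ l hl ⟨hDm.2 ⟨(hs l hl).2, pairwise_types (hs l hl).1⟩, hlF⟩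
        · rintro l hl d ⟨hdD, hdF⟩ hlt
          exact ⟨hDm.2 ⟨(hs l hl).2, pairwise_types (hs l hl).1⟩, fun h => hdF (hlow _ h d hdD hlt)⟩
        · rintro d ⟨hdD, hdF⟩
          rw [← hxs]
          exact hxK d hdD hdF
      choose! t ht using fun (l : List (Ix n)) (hl : l.Pairwise (· ≤ ·)) =>
        exists_smul_sub_mem_Ker hn hE hE' hl
      set y := ∑ l ∈ s.filter (fun l => types l = d), c l • (t l • (l.map E).prod) with hy
      have hyM : y ∈ monSpan E m := by
        refine Submodule.sum_mem _ fun l hl => Submodule.smul_mem _ _ (Submodule.smul_mem _ _ ?_)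
        exact Submodule.subset_span ⟨l, hs l (Finset.mem_filter.1 hl).1, rfl⟩
      have hyW : y ∈ W := by
        refine Submodule.sum_mem _ fun l hl => Submodule.smul_mem _ _ (Submodule.smul_mem _ _ ?_)
        have h1 := hs l (Finset.mem_filter.1 hl).1
        exact hW E hE l h1.1 h1.2
      have hlt : ∀ d' ∈ D, d' ∉ F → d < d' := fun d' hd' hd'F =>
        lt_of_le_of_ne (not_lt.1 fun h => hd'F (hlow d hdF d' hd' h)) fun h => hd'F (h ▸ hdF)
      have hxy := ih (F.erase d) ((Finset.erase_subset _ _).trans hFD)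
        (by rw [Finset.card_erase_of_mem hdF, hF]; rfl)
        (fun d₁ hd₁ d₂ hd₂ h12 => Finset.mem_erase.2
          ⟨(h12.trans_le (F.le_max' _ (Finset.mem_of_mem_erase hd₁))).ne,
            hlow d₁ (Finset.mem_of_mem_erase hd₁) d₂ hd₂ h12⟩) (x - y) (Submodule.sub_mem _ hx hyW) ?_
      · have := Submodule.add_mem _ hxy hyM
        rwa [sub_add_cancel] at this
      · intro d' hd' hd'F
        by_cases hdd : d' = d
        · subst hdd
          rw [hxs, ← Finset.sum_filter_add_sum_filter_not s fun l => types l = d, add_comm,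
            add_sub_assoc, hy, ← Finset.sum_sub_distrib]
          refine Submodule.add_mem _ (Submodule.sum_mem _ fun l hl => ?_)
            (Submodule.sum_mem _ fun l hl => ?_)
          · obtain ⟨hls, hlt'⟩ := Finset.mem_filter.1 hl
            by_cases hc : c l = 0
            · rw [hc, zero_smul]
              exact Submodule.zero_mem _
            · refine Submodule.smul_mem _ _ (mem_Ker_of_types_lt hn hE' ?_ (hs l hls).1 ?_)
              · exact (hDm.1 (hFD hdF)).2
              · refine lt_of_le_of_ne (F.le_max' _ ?_) hlt'
                by_contra hF'
                exact hc (h0 l hls hF')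
          · obtain ⟨hls, hlt'⟩ := Finset.mem_filter.1 hl
            have h1 : ∀ (c : KK) (x y : UC n), c • x - c • y = c • (x - y) :=
              fun c x y => (smul_sub c x y).symm
            rw [h1, ← hlt']
            exact Submodule.smul_mem _ _ (ht l (hs l hls).1)
        · have h1 := hlt d' hd' fun h => hd'F (Finset.mem_erase.2 ⟨hdd, h⟩)
          refine Submodule.sub_mem _ (hxK d' hd' fun h => hd'F (Finset.mem_erase.2 ⟨hdd, h⟩))
            (Submodule.sum_mem _ fun l hl => Submodule.smul_mem _ _ (Submodule.smul_mem _ _ ?_))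
          obtain ⟨hls, hld⟩ := Finset.mem_filter.1 hl
          exact mem_Ker_of_types_lt hn hE (hDm.1 hd').2 (hs l hls).1 (hld ▸ h1)
  exact fun x hx => key _ D (Finset.Subset.refl _) rfl (fun _ _ _ h _ => h) x hx
    fun d hd hd' => absurd hd hd'

end Kernel

/-! ### Reduction of the basis theorem to spanning by a suitable family -/

section Words
variable (n : ℕ)

/-- the span of the products of `m` generators. -/
def Wd (m : ℕ) : Submodule KK (UC n) :=
  Submodule.span KK (Set.range fun p : Fin n × ℤ => ug n (aC n) (dC n) p.1 p.2) ^ m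

variable {n}

theorem mul_mem_Wd {a b : ℕ} {x y : UC n} (hx : x ∈ Wd n a) (hy : y ∈ Wd n b) :
    x * y ∈ Wd n (a + b) := by
  unfold Wd
  rw [pow_add]
  exact Submodule.mul_mem_mul hx hy

theorem genC_mem_Wd (j : ℕ) (r : ℤ) : genC n j r ∈ Wd n 1 := by
  unfold genC g1 Wd
  rw [pow_one]
  split_ifs with h
  · exact Submodule.subset_span ⟨(⟨j - 1, by omega⟩, r), rfl⟩
  · exact Submodule.zero_mem _

theorem qcm_mem_Wd {a b : ℕ} {x y : UC n} (l : KK) (hx : x ∈ Wd n a) (hy : y ∈ Wd n b) :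
    x * y - l • (y * x) ∈ Wd n (a + b) :=
  Submodule.sub_mem _ (mul_mem_Wd hx hy)
    (Submodule.smul_mem _ _ (add_comm a b ▸ mul_mem_Wd hy hx))

theorem IsCh.mem_Wd {w : List ℕ} {s : ℤ} {E : UC n} (h : IsCh n w s E) : E ∈ Wd n w.length := by
  induction h with
  | single j r => exact genC_mem_Wd j r
  | snoc w s E j r l h hl ih =>
    rw [List.length_append]
    exact qcm_mem_Wd l ih (genC_mem_Wd j r)

theorem IsRVC.mem_Wd {γ : PosRootC n} {s : ℤ} {E : UC n} (h : IsRVC γ s E) :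
    E ∈ Wd n (heightC γ) := by
  unfold IsRVC at h
  split_ifs at h with hI
  · obtain ⟨β₁, β₂, s₁, s₂, l, E₁, E₂, ⟨hβ₁, hβ₁'⟩, ⟨hβ₂, hβ₂'⟩, -, hE₁, hE₂, rfl, rfl⟩ := h
    have hI' := hI
    unfold isINI at hI'
    have h3 : heightC γ = (wordC β₁).length + (wordC β₂).length := by
      unfold heightC
      rw [wordC_of_isINI hI, wordC_of_not_isINI (by unfold isINI; omega),
        wordC_of_not_isINI (by unfold isINI; omega), rend, rend, if_pos (by omega),
        if_neg (by omega)]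
      simp only [List.length_append, List.length_map, List.length_range', List.length_singleton]
      omega
    rw [h3]
    exact qcm_mem_Wd l (isCh_of_isRVCchain hE₁).mem_Wd (isCh_of_isRVCchain hE₂).mem_Wd
  · exact (isCh_of_isRVCchain h).mem_Wd

theorem prod_mem_Wd {E : Ix n → UC n} (hE : IsFam E) (l : List (Ix n)) :
    (l.map E).prod ∈ Wd n (totHt (types l)) := by
  induction l with
  | nil => exact Submodule.one_le.1 (pow_zero _).ge
  | cons x l ih =>
    have h : totHt (types (x :: l)) = heightC (ofLex x).1 + totHt (types l) := by
      simp [totHt, types]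
    rw [h, List.map_cons, List.prod_cons]
    exact mul_mem_Wd (IsRVC.mem_Wd (hE x)) ih

theorem iSup_Wd : ⨆ m, Wd n m = ⊤ := by
  rw [eq_top_iff, ← Algebra.top_toSubmodule, ← adjoin_ug n (aC n) (dC n),
    Algebra.adjoin_eq_span, Submodule.span_le]
  intro x hx
  obtain ⟨l, hl, rfl⟩ := Submonoid.exists_list_of_mem_closure hx
  refine Submodule.mem_iSup_of_mem l.length ?_
  clear hx
  induction l with
  | nil => exact Submodule.one_le.1 (pow_zero _).ge
  | cons y l ih =>
    rw [List.prod_cons, List.length_cons, add_comm]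
    refine mul_mem_Wd ?_ (ih fun z hz => hl z (List.mem_cons_of_mem _ hz))
    unfold Wd
    rw [pow_one]
    exact Submodule.subset_span (hl y List.mem_cons_self)

end Words

section OrdMon

/-- the sorted list with prescribed multiplicities. -/
def sortedList {ι : Type} [LinearOrder ι] (h : ι →₀ ℕ) : List ι :=
  (h.support.sort (· ≤ ·)).flatMap fun p => List.replicate (h p) p

variable {ι : Type} [LinearOrder ι]

theorem pairwise_sortedList (h : ι →₀ ℕ) : (sortedList h).Pairwise (· ≤ ·) := by
  unfold sortedList
  rw [List.pairwise_flatMap]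
  refine ⟨fun p _ => List.pairwise_replicate.2 (Or.inr le_rfl), ?_⟩
  refine (Finset.pairwise_sort h.support (· ≤ ·)).imp fun {a b} hab x hx y hy => ?_
  rw [List.eq_of_mem_replicate hx, List.eq_of_mem_replicate hy]
  exact hab

theorem coe_sortedList (h : ι →₀ ℕ) : (sortedList h : Multiset ι) = Finsupp.toMultiset h := by
  unfold sortedList
  rw [Finsupp.toMultiset_apply, Finsupp.sum, ← Multiset.coe_bind, Finset.sort_eq,
    Multiset.bind, Multiset.join, Finset.sum]
  refine congrArg Multiset.sum (Multiset.map_congr rfl fun p _ => ?_)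
  rw [Multiset.nsmul_singleton]
  rfl

theorem sortedList_injective : Function.Injective (sortedList (ι := ι)) := fun h h' hh =>
  Multiset.toFinsupp.symm.injective (show Finsupp.toMultiset h = Finsupp.toMultiset h' by
    rw [← coe_sortedList, ← coe_sortedList, hh])

theorem exists_sortedList {l : List ι} (hl : l.Pairwise (· ≤ ·)) :
    ∃ h : ι →₀ ℕ, sortedList h = l := by
  classical
  refine ⟨Multiset.toFinsupp (l : Multiset ι), ?_⟩
  refine List.Perm.eq_of_pairwise (le := (· ≤ ·)) (fun a b _ _ h h' => le_antisymm h h')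
    (pairwise_sortedList _) hl (Multiset.coe_eq_coe.1 ?_)
  rw [coe_sortedList, Multiset.toFinsupp_toMultiset]

theorem ordMon_eq {B : Type} [Ring B] (E : ι → B) (h : ι →₀ ℕ) :
    ordMon E h = ((sortedList h).map E).prod := by
  unfold ordMon sortedList
  induction h.support.sort (· ≤ ·) with
  | nil => rfl
  | cons p l ih =>
    rw [List.map_cons, List.prod_cons, List.flatMap_cons, List.map_append, List.prod_append,
      List.map_replicate, List.prod_replicate, ih]

end OrdMon

section Reduction
variable {n : ℕ}

theorem linearIndependent_ordMon (hn : 2 ≤ n) {E : Ix n → UC n} (hE : IsFam E) :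
    LinearIndependent KK (fun h : Ix n →₀ ℕ => ordMon E h) := by
  classical
  have h0 : (fun h : Ix n →₀ ℕ => ordMon E h) =
      (fun l : List (Ix n) => (l.map E).prod) ∘ fun h => sortedList h := by
    funext h
    exact ordMon_eq E h
  rw [linearIndependent_iff']
  intro s g hg h hh
  have h1 := coeff_eq_zero hn hE Set.univ (s.image sortedList)
    (fun l => g (Function.invFun sortedList l)) (fun l hl => ?_) (fun _ _ _ _ _ => trivial)
    (fun d _ => ?_) (sortedList h) (Finset.mem_image_of_mem _ hh) trivial
  · simpa only [Function.leftInverse_invFun sortedList_injective h] using h1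
  · obtain ⟨h, -, rfl⟩ := Finset.mem_image.1 hl
    exact pairwise_sortedList h
  · rw [Finset.sum_image fun _ _ _ _ h => sortedList_injective h]
    have h2 : ∑ x ∈ s, g (Function.invFun sortedList (sortedList x)) •
        (List.map E (sortedList x)).prod = 0 := by
      rw [← hg]
      refine Finset.sum_congr rfl fun x _ => ?_
      rw [Function.leftInverse_invFun sortedList_injective x]
      simp only [ordMon_eq]
    rw [h2]
    exact Submodule.zero_mem _

theorem span_ordMon (hn : 2 ≤ n)
    (hspan : ∀ m, ∀ x ∈ Wd n m, ∃ E : Ix n → UC n, IsFam E ∧ x ∈ monSpan E m)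
    {E : Ix n → UC n} (hE : IsFam E) :
    Submodule.span KK (Set.range fun h : Ix n →₀ ℕ => ordMon E h) = ⊤ := by
  rw [eq_top_iff, ← iSup_Wd, iSup_le_iff]
  intro m
  refine (le_monSpan hn m (Wd n m) ?_ (hspan m) hE).trans (Submodule.span_mono ?_)
  · intro E' hE' l _ hl
    exact hl ▸ prod_mem_Wd hE' l
  · rintro _ ⟨l, ⟨hl, -⟩, rfl⟩
    obtain ⟨h, rfl⟩ := exists_sortedList hl
    exact ⟨h, ordMon_eq E h⟩

end Reduction

/-! ### The classical limit: brackets of root vectors in the current algebra -/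

section Classical
variable {L : Type} [LieRing L]

/-- the iterated bracket of `a` with `f c(i+1), …, f c(i+m)`. -/
def ch (n : ℕ) (f : ℕ → L) (i : ℕ) (a : L) : ℕ → L
  | 0 => a
  | m + 1 => ⁅ch n f i a m, f (pcol n (i + m + 1))⁆

/-- the classical limit of the defining relations, for the generators with nonnegative modes. -/
structure ClassRel (n : ℕ) (e : ℕ → ℕ → L) : Prop where
  loop (i j r s : ℕ) : ⁅e i (r + 1), e j s⁆ = ⁅e i r, e j (s + 1)⁆
  comm (i j r s : ℕ) (h : i + 1 < j ∨ j + 1 < i) : ⁅e i r, e j s⁆ = 0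
  serre (i j t : ℕ) (h : i + 1 = j ∨ j + 1 = i) (h' : ¬(i + 1 = n ∧ j = n)) :
    ⁅e i 0, ⁅e i 0, e j t⁆⁆ = 0
  serre_last (i t : ℕ) (h : i + 1 = n) : ⁅e i 0, ⁅e i 0, ⁅e i 0, e n t⁆⁆⁆ = 0
  two (x : L) : x + x = 0 → x = 0
  three (x : L) : x + x + x = 0 → x = 0

theorem lie_lie_right (x y z : L) : ⁅⁅x, y⁆, z⁆ = ⁅⁅x, z⁆, y⁆ + ⁅x, ⁅y, z⁆⁆ := by
  rw [leibniz_lie x y z, ← lie_skew y ⁅x, z⁆]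
  abel

theorem lie_lie_comm {x y z : L} (h : ⁅y, z⁆ = 0) : ⁅⁅x, y⁆, z⁆ = ⁅⁅x, z⁆, y⁆ := by
  rw [lie_lie_right, h, lie_zero, add_zero]

theorem lie_lie_assoc {x y z : L} (h : ⁅x, z⁆ = 0) : ⁅⁅x, y⁆, z⁆ = ⁅x, ⁅y, z⁆⁆ := by
  rw [lie_lie_right, h, zero_lie, zero_add]

theorem lie_eq_zero_symm {x y : L} (h : ⁅x, y⁆ = 0) : ⁅y, x⁆ = 0 := by
  rw [← lie_skew, h, neg_zero]

namespace ClassRel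
variable {n : ℕ} {e : ℕ → ℕ → L}

theorem loop_zero (h : ClassRel n e) (i j r s : ℕ) : ⁅e i r, e j s⁆ = ⁅e i (r + s), e j 0⁆ := by
  induction s generalizing r with
  | zero => rfl
  | succ s ih => rw [← h.loop, ih, add_right_comm, add_assoc]

theorem loop_left (h : ClassRel n e) (i j r s : ℕ) : ⁅e i r, e j s⁆ = ⁅e i 0, e j (r + s)⁆ := by
  rw [h.loop_zero, h.loop_zero i j 0, zero_add]

theorem self (h : ClassRel n e) (i r s : ℕ) : ⁅e i r, e i s⁆ = 0 := by
  refine h.two _ ?_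
  nth_rewrite 2 [← lie_skew]
  rw [h.loop_zero i i r s, h.loop_zero i i s r, add_comm s r, add_neg_cancel]

theorem serre_right (h : ClassRel n e) (i j t r : ℕ) (hij : i + 1 = j ∨ j + 1 = i)
    (h' : ¬(i + 1 = n ∧ j = n)) :
    ⁅⁅e j t, e i 0⁆, e i r⁆ = 0 := by
  rw [lie_lie_comm (h.self i 0 r), h.loop_zero j i t r]
  have h1 := h.serre i j (t + r) hij h'
  rwa [← lie_skew (e i 0) (e j _), lie_neg, neg_eq_zero, ← neg_eq_zero, lie_skew] at h1

theorem lie_lie_two {y x g : L} (h1 : ⁅y, g⁆ = 0) (h2 : ⁅⁅y, x⁆, x⁆ = 0) :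
    ⁅y, ⁅x, ⁅x, g⁆⁆⁆ = ⁅x, ⁅⁅y, x⁆, g⁆⁆ + ⁅x, ⁅⁅y, x⁆, g⁆⁆ := by
  rw [leibniz_lie y x, leibniz_lie ⁅y, x⁆ x, leibniz_lie y x g, h1, h2]
  simp

theorem lie_lie_three {y x g : L} (h1 : ⁅y, g⁆ = 0) (h2 : ⁅⁅y, x⁆, x⁆ = 0) :
    ⁅y, ⁅x, ⁅x, ⁅x, g⁆⁆⁆⁆ = ⁅x, ⁅x, ⁅⁅y, x⁆, g⁆⁆⁆ + ⁅x, ⁅x, ⁅⁅y, x⁆, g⁆⁆⁆ + ⁅x, ⁅x, ⁅⁅y, x⁆, g⁆⁆⁆ := by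
  rw [leibniz_lie y x, leibniz_lie ⁅y, x⁆ x, leibniz_lie ⁅y, x⁆ x, lie_lie_two h1 h2, h2]
  simp only [zero_lie, zero_add, lie_add]
  abel

end ClassRel

/-- the root vector along the places `i, …, i + m` of mode `s`. -/
def rx (n : ℕ) (e : ℕ → ℕ → L) (i m s : ℕ) : L := ch n (fun j => e j 0) i (e i s) m

theorem rx_zero (n : ℕ) (e : ℕ → ℕ → L) (i s : ℕ) : rx n e i 0 s = e i s := rfl

theorem rx_succ (n : ℕ) (e : ℕ → ℕ → L) (i m s : ℕ) :
    rx n e i (m + 1) s = ⁅rx n e i m s, e (pcol n (i + m + 1)) 0⁆ := rfl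

namespace ClassRel
variable {n : ℕ} {e : ℕ → ℕ → L}

theorem rx_main (h : ClassRel n e) {i : ℕ} (hi : 1 ≤ i) (hin : i ≤ n) (m : ℕ) : i + m ≤ 2 * n - i →
    (∀ s j r, j ≤ n → j ≠ pcol n (i + m + 1) → j + 1 ≠ i → ⁅rx n e i m s, e j r⁆ = 0) ∧
    (i + m + 1 ≤ 2 * n - i → ∀ s r,
      ⁅rx n e i m s, e (pcol n (i + m + 1)) r⁆ = rx n e i (m + 1) (s + r)) := by
  induction m using Nat.strong_induction_on with
  | _ m ih =>
  intro hm
  rcases m with _ | m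
  · refine ⟨fun s j r hjn hj hj' => ?_, fun _ s r => ?_⟩
    · rw [rx_zero]
      rcases eq_or_ne j i with rfl | hji
      · exact h.self j s r
      · refine h.comm i j s r ?_
        unfold pcol at hj
        split_ifs at hj <;> omega
    · rw [rx_succ, rx_zero, rx_zero]
      exact h.loop_zero _ _ _ _
  obtain ⟨ihc, iha⟩ := ih m (by omega) (by omega)
  replace iha := iha (by omega)
  rw [← add_assoc]
  set c := pcol n (i + m + 1) with hc
  have hcn : c ≤ n := by
    rw [hc]; unfold pcol; split_ifs <;> omega
  refine ⟨fun s j r hjn hj hj' => ?_, fun hm' s r => ?_⟩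
  · have hcomm : ∀ u k, ⁅rx n e i m u, e j k⁆ = 0 ∨ j = c := fun u k => by
      rcases eq_or_ne j c with h1 | h1
      · exact Or.inr h1
      · exact Or.inl (ihc u j k hjn h1 hj')
    rw [rx_succ, ← hc]
    by_cases hA : c + 1 < j ∨ j + 1 < c
    · have h1 := (hcomm s r).resolve_right (by omega)
      rw [lie_lie_comm (h.comm c j 0 r hA), h1, zero_lie]
    rcases eq_or_ne j c with rfl | hjc
    · rw [lie_lie_comm (h.self _ 0 r), iha, rx_succ, ← hc]
      generalize s + r = t
      rcases m with _ | m
      · rw [rx_zero]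
        refine h.serre_right _ _ _ _ ?_ ?_ <;> rw [hc] <;> unfold pcol <;> split_ifs <;> omega
      · obtain ⟨ihc', iha'⟩ := ih m (by omega) (by omega)
        set c' := pcol n (i + m + 1) with hc'
        have hcc : c ≠ c' := by
          rw [hc, hc']; unfold pcol; split_ifs <;> omega
        have hY : ∀ u k, ⁅rx n e i m u, e c k⁆ = 0 := fun u k => ihc' u c k hjn hcc hj'
        rw [rx_succ, ← hc']
        by_cases hex : c + 1 = n ∧ c' = n
        · have hq : i + m + 1 = n := by
            have := hex.2
            rw [hc'] at this
            unfold pcol at this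
            split_ifs at this <;> omega
          rcases m with _ | m
          · rw [rx_zero, hex.2, h.loop_left, add_zero, show i = c by omega]
            rw [← lie_skew, ← lie_skew _ (e c 0), lie_neg, neg_neg]
            exact h.serre_last c t hex.1
          · obtain ⟨ihc₂, iha₂⟩ := ih m (by omega) (by omega)
            have hcm : pcol n (i + m + 1) = c := by
              rw [hc]; unfold pcol; split_ifs <;> omega
            have hY' := hY t 0
            rw [rx_succ, hcm] at hY' ⊢
            rw [hcm] at ihc₂
            have h1 := lie_lie_three (ihc₂ t n 0 le_rfl (by omega) (by omega)) hY'
            rw [h.serre_last c 0 hex.1, lie_zero] at h1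
            have h2 := h.three _ h1.symm
            rw [hex.2]
            rw [← lie_skew, ← lie_skew _ (e c 0), lie_neg, neg_neg]
            exact h2
        · rw [lie_lie_assoc (hY t 0), lie_lie_assoc (hY t 0), h.serre_right c c' 0 0 ?_ hex,
            lie_zero]
          rw [hc, hc']; unfold pcol; split_ifs <;> omega
    · have hXj := fun u k => (hcomm u k).resolve_right hjc
      have hjq : j = pcol n (i + m) ∧ c ≠ n := by
        rw [hc] at hjc hA ⊢
        unfold pcol at *
        split_ifs at * <;> omega
      rw [lie_lie_assoc (hXj s r), h.loop_zero, zero_add, ← lie_lie_assoc (hXj s 0), iha, rx_succ,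
        ← hc]
      generalize s + r = t
      have hjc' : j + 1 = c ∨ c + 1 = j := by omega
      rcases m with _ | m
      · have hji : j = i := by
          rw [hjq.1]; unfold pcol; split_ifs <;> omega
        rw [rx_zero, hji, h.loop_left, add_zero, lie_lie_assoc (h.self i 0 0),
          ← lie_skew (e c _), lie_neg, h.serre i c t (by omega) (fun h => hjq.2 h.2), neg_zero]
      · obtain ⟨ihc', iha'⟩ := ih m (by omega) (by omega)
        rw [← add_assoc] at hjq
        rw [← hjq.1] at ihc'
        have hXj' := hXj t 0
        rw [rx_succ, ← hjq.1] at hXj' ⊢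
        have h1 := lie_lie_two (ihc' t c 0 hcn hjc.symm (by
          rw [hc]; unfold pcol; split_ifs <;> omega)) hXj'
        rw [h.serre j c 0 hjc' (fun h => hjq.2 h.2), lie_zero] at h1
        exact lie_eq_zero_symm (h.two _ h1.symm)
  · have h1 : ∀ k, ⁅rx n e i m s, e (pcol n (i + m + 1 + 1)) k⁆ = 0 := fun k => by
      refine ihc s _ k ?_ ?_ ?_ <;> (try rw [hc]) <;> unfold pcol <;> split_ifs <;> omega
    rw [rx_succ, ← hc, lie_lie_assoc (h1 r), h.loop_zero, zero_add, ← lie_lie_assoc (h1 0), iha]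
    rfl

end ClassRel
end Classical

section ClosedBracket
variable {L : Type} [LieRing L]

namespace ClassRel
variable {n : ℕ} {e : ℕ → ℕ → L}

theorem rx_comm (h : ClassRel n e) {i m j : ℕ} (hi : 1 ≤ i) (hin : i ≤ n)
    (hm : i + m ≤ 2 * n - i) (s r : ℕ)
    (hjn : j ≤ n) (hj : j ≠ pcol n (i + m + 1)) (hj' : j + 1 ≠ i) :
    ⁅rx n e i m s, e j r⁆ = 0 :=
  (h.rx_main hi hin m hm).1 s j r hjn hj hj'

theorem rx_next (h : ClassRel n e) {i m : ℕ} (hi : 1 ≤ i) (hin : i ≤ n)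
    (hm : i + m + 1 ≤ 2 * n - i) (s r : ℕ) :
    ⁅rx n e i m s, e (pcol n (i + m + 1)) r⁆ = rx n e i (m + 1) (s + r) :=
  (h.rx_main hi hin m (by omega)).2 hm s r

theorem rx_lower (h : ClassRel n e) {i m : ℕ} (hi : 1 ≤ i) (hin : i + 1 ≤ n)
    (hm : m = 0 ∨ i + 1 + m < 2 * n - (i + 1)) (s r : ℕ) :
    ⁅rx n e (i + 1) m s, e i r⁆ = -rx n e i (m + 1) (s + r) := by
  induction m generalizing s with
  | zero =>
    have h1 : pcol n (i + 0 + 1) = i + 1 := by unfold pcol; split_ifs <;> omega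
    rw [rx_zero, ← lie_skew, h.loop_zero, rx_succ, rx_zero, h1, add_comm]
  | succ m ih =>
    have h1 : pcol n (i + (m + 1) + 1) = pcol n (i + 1 + m + 1) := by congr 1; omega
    rw [rx_succ, lie_lie_comm (h.comm _ _ _ _ ?_), ih (by omega), rx_succ n e i (m + 1), neg_lie, h1]
    right
    unfold pcol; split_ifs <;> omega

theorem rx_lower_last (h : ClassRel n e) (k : ℕ) {i : ℕ} (hi : 1 ≤ i) (hik : i + 1 + k = n)
    (s r : ℕ) :
    ⁅rx n e (i + 1) (2 * k) s, e i r⁆ = -rx n e i (2 * k + 1) (s + r) ∨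
    ⁅rx n e (i + 1) (2 * k) s, e i r⁆ =
      -(rx n e i (2 * k + 1) (s + r) + rx n e i (2 * k + 1) (s + r)) := by
  induction k generalizing i s r with
  | zero => exact Or.inl (h.rx_lower hi (by omega) (Or.inl rfl) s r)
  | succ k ih =>
    right
    have hZ := ih (i := i + 1) (by omega) (by omega) s 0
    have hY := h.rx_lower (m := 2 * k + 1) hi (by omega) (Or.inr (by omega)) s r
    have hc : pcol n (i + 1 + (2 * k + 1) + 1) = i + 1 := by unfold pcol; split_ifs <;> omega
    have hc' : pcol n (i + (2 * k + 1 + 1) + 1) = i + 1 := by unfold pcol; split_ifs <;> omega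
    have hX : ⁅rx n e i (2 * k + 1 + 1) (s + r), e (i + 1) 0⁆ = rx n e i (2 * k + 1 + 1 + 1) (s + r) := by
      rw [rx_succ n e i (2 * k + 1 + 1), hc']
    rw [add_zero] at hZ
    change ⁅rx n e (i + 1) (2 * k + 1 + 1) s, e i r⁆ = -(rx n e i (2 * k + 1 + 1 + 1) (s + r) + rx n e i (2 * k + 1 + 1 + 1) (s + r))
    rw [rx_succ, hc]
    have hZi : ⁅rx n e (i + 1 + 1) (2 * k) s, e i r⁆ = 0 := by
      refine h.rx_comm (by omega) (by omega) (by omega) s r (by omega) ?_ (by omega)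
      unfold pcol; split_ifs <;> omega
    have hP : ⁅e (i + 1) 0, ⁅e (i + 1) 0, e i r⁆⁆ = 0 := h.serre _ _ _ (Or.inr rfl) (by omega)
    have hZP : ⁅⁅rx n e (i + 1 + 1) (2 * k) s, e (i + 1) 0⁆, ⁅e (i + 1) 0, e i r⁆⁆ =
        ⁅⁅⁅rx n e (i + 1 + 1) (2 * k) s, e (i + 1) 0⁆, e i r⁆, e (i + 1) 0⁆ := by
      rw [lie_lie_comm hP, leibniz_lie _ (e (i + 1) 0) (e i r), hZi, lie_zero, add_zero]
    have hYP : ⁅rx n e (i + 1) (2 * k + 1) s, ⁅e (i + 1) 0, e i r⁆⁆ =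
        ⁅⁅rx n e (i + 1) (2 * k + 1) s, e i r⁆, e (i + 1) 0⁆ := by
      rcases hZ with hZ | hZ
      · rw [hZ] at hZP
        simpa only [neg_lie, neg_inj] using hZP
      · rw [hZ] at hZP
        simp only [neg_lie, neg_inj, add_lie] at hZP
        rw [← sub_eq_zero] at hZP ⊢
        refine h.two _ ?_
        rw [← hZP]
        abel
    rw [lie_lie_right, hYP, hY, neg_lie, hX]
    abel

theorem rx_lie_rx (h : ClassRel n e) {i a b : ℕ} (hi : 1 ≤ i) (hab : a ≤ b)
    (hb : i + a + (i + b) + 1 < 2 * n)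
    (s r : ℕ) : ⁅rx n e i a s, rx n e i b r⁆ = 0 := by
  have hz : ∀ j u, j ≤ n → j ≠ pcol n (i + b + 1) → j + 1 ≠ i → ⁅e j u, rx n e i b r⁆ = 0 :=
    fun j u hj hj' hj'' =>
      lie_eq_zero_symm (h.rx_comm hi (by omega) (by omega) r u hj hj' hj'')
  induction a with
  | zero =>
    refine hz i s (by omega) ?_ (by omega)
    unfold pcol; split_ifs <;> omega
  | succ a ih =>
    rw [rx_succ, lie_lie_right, ih (by omega) (by omega), zero_lie, zero_add, hz, lie_zero] <;>
    unfold pcol <;> split_ifs <;> omega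

theorem rx_lie_rx_last (h : ClassRel n e) {i a b : ℕ} (hi : 1 ≤ i) (hab : a ≤ b)
    (hb : i + a + (i + b) + 1 = 2 * n)
    (s r : ℕ) : ⁅rx n e i a s, rx n e i b r⁆ = (-1 : ℤ) ^ (a + 1) • rx n e i (a + b + 1) (s + r) := by
  induction a generalizing b r with
  | zero =>
    have hc : pcol n (i + b + 1) = i := by unfold pcol; split_ifs <;> omega
    have h1 := h.rx_next (m := b) hi (by omega) (by omega) r s
    rw [hc] at h1
    rw [rx_zero, ← lie_skew, h1]
    simp [add_comm]
  | succ a ih =>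
    have hc : pcol n (i + b + 1) = pcol n (i + a + 1) := by unfold pcol; split_ifs <;> omega
    have h1 := h.rx_next (m := b) hi (by omega) (by omega) r 0
    rw [hc] at h1
    rw [rx_succ, lie_lie_right, h.rx_lie_rx hi (by omega) (by omega), zero_lie, zero_add,
      ← lie_skew (e _ 0), h1, lie_neg, ih (by omega) (by omega), pow_succ _ (a + 1),
      show a + (b + 1) + 1 = a + 1 + b + 1 by omega]
    simp

/-- the additive span of the root vectors. -/
def _root_.PBWD.rxSpan (n : ℕ) (e : ℕ → ℕ → L) : AddSubgroup L :=
  AddSubgroup.closure {x | ∃ i m s, 1 ≤ i ∧ i ≤ n ∧ i + m ≤ 2 * n - i ∧ x = rx n e i m s}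

theorem rx_mem {i m : ℕ} (hi : 1 ≤ i) (hin : i ≤ n) (hm : i + m ≤ 2 * n - i) (s : ℕ) :
    rx n e i m s ∈ rxSpan n e :=
  AddSubgroup.subset_closure ⟨i, m, s, hi, hin, hm, rfl⟩

theorem lie_gen_mem (h : ClassRel n e) {x : L} (hx : x ∈ rxSpan n e) {j : ℕ} (hj : 1 ≤ j)
    (hjn : j ≤ n) (r : ℕ) :
    ⁅x, e j r⁆ ∈ rxSpan n e := by
  induction hx using AddSubgroup.closure_induction with
  | mem x hx =>
    obtain ⟨i, m, s, hi, hin, hm, rfl⟩ := hx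
    by_cases hji : j + 1 = i
    · subst hji
      by_cases hm' : j + 1 + m < 2 * n - (j + 1)
      · rw [h.rx_lower hj (by omega) (Or.inr hm')]
        exact neg_mem (rx_mem hj hjn (by omega) _)
      · obtain ⟨k, rfl⟩ : ∃ k, m = 2 * k := ⟨n - (j + 1), by omega⟩
        have hmem := rx_mem (e := e) (m := 2 * k + 1) hj hjn (by omega) (s + r)
        rcases h.rx_lower_last k hj (by omega) s r with h1 | h1 <;> rw [h1]
        · exact neg_mem hmem
        · exact neg_mem (add_mem hmem hmem)
    · by_cases hjc : j = pcol n (i + m + 1)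
      · have hm' : i + m + 1 ≤ 2 * n - i := by
          unfold pcol at hjc
          split_ifs at hjc <;> omega
        rw [hjc, h.rx_next hi hin hm']
        exact rx_mem hi hin (by omega) _
      · rw [h.rx_comm hi hin hm s r hjn hjc hji]
        exact zero_mem _
  | zero => rw [zero_lie]; exact zero_mem _
  | add x y _ _ hx hy => rw [add_lie]; exact add_mem hx hy
  | neg x _ hx => rw [neg_lie]; exact neg_mem hx

theorem lie_mem (h : ClassRel n e) {x y : L} (hx : x ∈ rxSpan n e)
    (hy : y ∈ rxSpan n e) : ⁅x, y⁆ ∈ rxSpan n e := by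
  induction hy using AddSubgroup.closure_induction with
  | mem y hy =>
    obtain ⟨i, m, s, hi, hin, hm, rfl⟩ := hy
    induction m generalizing x with
    | zero => exact h.lie_gen_mem hx hi hin s
    | succ m ih =>
      have hc : 1 ≤ pcol n (i + m + 1) ∧ pcol n (i + m + 1) ≤ n := by
        unfold pcol; split_ifs <;> omega
      rw [rx_succ, leibniz_lie, ← lie_skew (rx n e i m s)]
      exact add_mem (h.lie_gen_mem (ih hx (by omega)) hc.1 hc.2 0)
        (neg_mem (ih (h.lie_gen_mem hx hc.1 hc.2 0) (by omega)))
  | zero => rw [lie_zero]; exact zero_mem _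
  | add x y _ _ hx hy => rw [lie_add]; exact add_mem hx hy
  | neg x _ hx => rw [lie_neg]; exact neg_mem hx

end ClassRel

variable {n : ℕ}

/-- the bracket along the standard Lyndon word of a root, with first letter `a` and further
letters `f j`. -/
def rvec (f : ℕ → L) (a : L) (β : PosRootC n) : L :=
  if isINI β then ⁅ch n f (ri β) (f (ri β)) (n - 1 - ri β), ch n f (ri β) a (n - ri β)⁆
  else ch n f (ri β) a (rend β - ri β)

/-- the classical root vectors. -/
def crv (e : ℕ → ℕ → L) (x : PosRootC n × ℕ) : L :=
  rvec (fun j => e j 0) (e (ri x.1) x.2) x.1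

theorem crv_of_isINI {e : ℕ → ℕ → L} (h : ClassRel n e) {x : PosRootC n × ℕ} (hx : isINI x.1)
    (hx1 : 1 ≤ ri x.1) :
    crv e x = (-1 : ℤ) ^ (n - 1 - ri x.1 + 1) • rx n e (ri x.1) (2 * (n - ri x.1)) x.2 := by
  unfold crv rvec
  rw [if_pos hx]
  unfold isINI at hx
  refine (h.rx_lie_rx_last hx1 (by omega) (by omega) 0 x.2).trans ?_
  rw [zero_add]
  congr 2
  omega

theorem closure_crv {e : ℕ → ℕ → L} (h : ClassRel n e) :
    AddSubgroup.closure (Set.range (crv (n := n) e)) = rxSpan n e := by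
  refine le_antisymm ((AddSubgroup.closure_le _).2 ?_) ((AddSubgroup.closure_le _).2 ?_)
  · rintro _ ⟨x, rfl⟩
    have h0 := ri_pos x.1
    have h1 := rt_add_le x.1
    have h2 := rt_eq_zero x.1
    have h3 := ri_le x.1
    by_cases hx : isINI x.1
    · have hx' := hx
      unfold isINI at hx'
      rw [crv_of_isINI h hx (by omega)]
      exact zsmul_mem (ClassRel.rx_mem (by omega) (by omega) (by omega) _) _
    · have hx' := hx
      unfold isINI at hx'
      unfold crv rvec
      rw [if_neg hx]
      refine ClassRel.rx_mem (by omega) (by omega) ?_ x.2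
      unfold rend; split_ifs <;> omega
  · rintro _ ⟨i, m, s, hi, hin, hm, rfl⟩
    by_cases hI : i + m = 2 * n - i ∧ i < n
    · let β : PosRootC n := ⟨toLex (⟨i, by omega⟩, ⟨n - i, by omega⟩), by
        refine ⟨hi, fun h => ?_, ?_⟩
        · change i = n at h
          change n - i = 0
          omega
        · change n - i + 2 * i ≤ 2 * n
          omega⟩
      have hβ : ri β = i := rfl
      have hβ' : rt β = n - i := rfl
      have h1 := crv_of_isINI h (x := (β, s)) (by unfold isINI; dsimp only; omega) (by dsimp only; omega)
      dsimp only at h1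
      rw [hβ, show 2 * (n - i) = m by omega] at h1
      have h2 : rx n e i m s = (-1 : ℤ) ^ (n - 1 - i + 1) • crv e (β, s) := by
        rw [h1, smul_smul, ← mul_pow]
        simp
      rw [h2]
      exact zsmul_mem (AddSubgroup.subset_closure (Set.mem_range_self _)) _
    · let t := if i + m < n ∨ i = n then m else m + 1
      have ht : t = if i + m < n ∨ i = n then m else m + 1 := rfl
      let β : PosRootC n := ⟨toLex (⟨i, by omega⟩, ⟨t, by rw [ht]; split_ifs <;> omega⟩), by
        refine ⟨hi, fun h => ?_, ?_⟩
        · change i = n at h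
          change t = 0
          rw [ht]; split_ifs <;> omega
        · change t + 2 * i ≤ 2 * n
          rw [ht]; split_ifs <;> omega⟩
      have hβ : ri β = i := rfl
      have hβ' : rt β = t := rfl
      have hI' : ¬isINI β := by
        unfold isINI
        rw [hβ, hβ', ht]
        split_ifs <;> omega
      have hm' : rend β - ri β = m := by
        unfold rend
        rw [hβ, hβ', ht]
        split_ifs <;> omega
      refine AddSubgroup.subset_closure ⟨(β, s), ?_⟩
      unfold crv rvec
      dsimp only
      rw [if_neg hI', hm', hβ]
      rfl

theorem lie_mem_closure_crv {e : ℕ → ℕ → L} (h : ClassRel n e) (x y : PosRootC n × ℕ) :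
    ⁅crv e x, crv e y⁆ ∈ AddSubgroup.closure (Set.range (crv (n := n) e)) := by
  have h1 := fun x => (closure_crv h).le (AddSubgroup.subset_closure ⟨x, rfl⟩)
  exact (closure_crv h).ge (h.lie_mem (h1 x) (h1 y))

theorem gen_mem_closure_crv {e : ℕ → ℕ → L} (h : ClassRel n e) {i : ℕ} (hi : 1 ≤ i) (hin : i ≤ n)
    (s : ℕ) : e i s ∈ AddSubgroup.closure (Set.range (crv (n := n) e)) :=
  (closure_crv h).ge (ClassRel.rx_mem (m := 0) hi hin (by omega) s)

end ClosedBracket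

section SortedProducts
variable {B ι : Type} [Ring B] [LinearOrder ι] (x : ι → B)

/-- the additive span of the products of at most `m` factors. -/
def wordSpan (m : ℕ) : AddSubgroup B :=
  AddSubgroup.closure {y | ∃ l : List ι, l.length ≤ m ∧ y = (l.map x).prod}

variable {x}

theorem prod_mem_wordSpan {m : ℕ} {l : List ι} (hl : l.length ≤ m) :
    (l.map x).prod ∈ wordSpan x m := AddSubgroup.subset_closure ⟨l, hl, rfl⟩

theorem mul_mem_wordSpan {a b : ℕ} {y z : B} (hy : y ∈ wordSpan x a) (hz : z ∈ wordSpan x b) :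
    y * z ∈ wordSpan x (a + b) := by
  induction hy using AddSubgroup.closure_induction with
  | mem y hy =>
    obtain ⟨l, hl, rfl⟩ := hy
    induction hz using AddSubgroup.closure_induction with
    | mem z hz =>
      obtain ⟨l', hl', rfl⟩ := hz
      rw [← List.prod_append, ← List.map_append]
      exact prod_mem_wordSpan (by rw [List.length_append]; omega)
    | zero => rw [mul_zero]; exact zero_mem _
    | add y z _ _ hy hz => rw [mul_add]; exact add_mem hy hz
    | neg y _ hy => rw [mul_neg]; exact neg_mem hy
  | zero => rw [zero_mul]; exact zero_mem _
  | add y z _ _ hy hz => rw [add_mul]; exact add_mem hy hz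
  | neg y _ hy => rw [neg_mul]; exact neg_mem hy

theorem closure_range_le_wordSpan : AddSubgroup.closure (Set.range x) ≤ wordSpan x 1 := by
  rw [AddSubgroup.closure_le]
  rintro _ ⟨a, rfl⟩
  simpa using prod_mem_wordSpan (x := x) (l := [a]) le_rfl


theorem perm_sub_mem (hx : ∀ a b, ⁅x a, x b⁆ ∈ AddSubgroup.closure (Set.range x)) {l l' : List ι}
    (h : l.Perm l') :
    (l.map x).prod - (l'.map x).prod ∈ wordSpan x (l.length - 1) := by
  induction h with
  | nil => rw [sub_self]; exact zero_mem _
  | cons a h ih =>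
    rename_i l₁ l₂
    rw [List.map_cons, List.map_cons, List.prod_cons, List.prod_cons, ← mul_sub]
    rcases Nat.eq_zero_or_pos l₁.length with h0 | h0
    · have h1 := List.eq_nil_of_length_eq_zero h0
      subst h1
      rw [List.Perm.nil_eq h, sub_self, mul_zero]
      exact zero_mem _
    · have h1 := mul_mem_wordSpan (closure_range_le_wordSpan (x := x)
        (AddSubgroup.subset_closure ⟨a, rfl⟩)) ih
      rwa [List.length_cons, show l₁.length + 1 - 1 = 1 + (l₁.length - 1) by omega]
  | swap a b l =>
    have h1 : ((b :: a :: l).map x).prod - ((a :: b :: l).map x).prod =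
        ⁅x b, x a⁆ * (l.map x).prod := by
      simp only [List.map_cons, List.prod_cons, Ring.lie_def, sub_mul, mul_assoc]
    rw [h1, show (b :: a :: l).length - 1 = 1 + l.length by simp; omega]
    exact mul_mem_wordSpan (closure_range_le_wordSpan (hx b a)) (prod_mem_wordSpan le_rfl)
  | trans h₁ h₂ ih₁ ih₂ =>
    rw [← h₁.length_eq] at ih₂
    rw [← sub_add_sub_cancel]
    exact add_mem ih₁ ih₂

theorem wordSpan_le (hx : ∀ a b, ⁅x a, x b⁆ ∈ AddSubgroup.closure (Set.range x))
    (m : ℕ) : wordSpan x m ≤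
    AddSubgroup.closure {y | ∃ l : List ι, l.Pairwise (· ≤ ·) ∧ y = (l.map x).prod} := by
  induction m with
  | zero =>
    refine AddSubgroup.closure_mono ?_
    rintro _ ⟨l, hl, rfl⟩
    have h1 := List.eq_nil_of_length_eq_zero (Nat.le_zero.1 hl)
    subst h1
    exact ⟨[], List.Pairwise.nil, rfl⟩
  | succ m ih =>
    refine (AddSubgroup.closure_le _).2 ?_
    rintro _ ⟨l, hl, rfl⟩
    have h1 := perm_sub_mem hx (List.mergeSort_perm l (· ≤ ·)).symm
    have h2 : (l.map x).prod - ((l.mergeSort (· ≤ ·)).map x).prod ∈ wordSpan x m := by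
      refine AddSubgroup.closure_mono ?_ h1
      rintro y ⟨l', hl', hy⟩
      exact ⟨l', by omega, hy⟩
    rw [← sub_add_cancel (l.map x).prod ((l.mergeSort (· ≤ ·)).map x).prod]
    refine add_mem (ih h2) (AddSubgroup.subset_closure ?_)
    exact ⟨l.mergeSort (· ≤ ·), List.pairwise_mergeSort' (· ≤ ·) l, rfl⟩

end SortedProducts

/-! ### The localization of `ℚ[v]` at `v = 1` -/

section Local
open Polynomial

/-- the ring of the rational functions regular at `v = 1`. -/
def Rloc : Subring KK where
  carrier := {f | ∃ p q : ℚ[X], q.eval 1 ≠ 0 ∧ f * algebraMap ℚ[X] KK q = algebraMap ℚ[X] KK p}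
  mul_mem' := by
    rintro f g ⟨p, q, hq, h⟩ ⟨p', q', hq', h'⟩
    refine ⟨p * p', q * q', by rw [eval_mul]; exact mul_ne_zero hq hq', ?_⟩
    rw [map_mul, map_mul, ← h, ← h']
    ring
  one_mem' := ⟨1, 1, by simp, by simp⟩
  add_mem' := by
    rintro f g ⟨p, q, hq, h⟩ ⟨p', q', hq', h'⟩
    refine ⟨p * q' + p' * q, q * q', by rw [eval_mul]; exact mul_ne_zero hq hq', ?_⟩
    rw [map_mul, map_add, map_mul, map_mul, ← h, ← h']
    ring
  zero_mem' := ⟨0, 1, by simp, by simp⟩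
  neg_mem' := by
    rintro f ⟨p, q, hq, h⟩
    exact ⟨-p, q, hq, by rw [map_neg, ← h]; ring⟩

theorem vv_mem_Rloc : vv ∈ Rloc := ⟨X, 1, by simp, by simp [vv]⟩

theorem vv_inv_mem_Rloc : vv⁻¹ ∈ Rloc :=
  ⟨1, X, by simp, by rw [RatFunc.algebraMap_X, map_one]; exact inv_mul_cancel₀ vv_ne_zero⟩

theorem natCast_inv_mem_Rloc {m : ℕ} (hm : m ≠ 0) : (m : KK)⁻¹ ∈ Rloc :=
  ⟨1, (m : ℚ[X]), by simpa using hm, by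
    rw [map_natCast, map_one]; exact inv_mul_cancel₀ (Nat.cast_ne_zero.2 hm)⟩

/-- the uniformizer `v - 1`. -/
def unif : Rloc := ⟨vv - 1, sub_mem vv_mem_Rloc (one_mem _)⟩

theorem unif_mul_ne (x : Rloc) : 1 + unif * x ≠ 0 := by
  intro h
  have h1 : 1 + (vv - 1) * (x : KK) = 0 := congrArg Subtype.val h
  obtain ⟨p, q, hq, hx⟩ := x.2
  have h2 : algebraMap ℚ[X] KK (q + (X - 1) * p) = 0 := by
    rw [map_add, map_mul, ← hx, map_sub, map_one, RatFunc.algebraMap_X]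
    calc _ = (1 + (vv - 1) * (x : KK)) * algebraMap ℚ[X] KK q := by unfold vv; ring
      _ = 0 := by rw [h1, zero_mul]
  have h3 := (map_eq_zero_iff _ (RatFunc.algebraMap_injective ℚ)).1 h2
  have h4 := congrArg (eval 1) h3
  simp at h4
  exact hq h4

theorem exists_vpow_eq (m : ℤ) : ∃ x : Rloc, vpow m = ((1 + unif * x : Rloc) : KK) := by
  have hv : ∀ k : ℕ, ∃ x : Rloc, vv ^ k = ((1 + unif * x : Rloc) : KK) := by
    intro k
    induction k with
    | zero => exact ⟨0, by simp⟩
    | succ k ih =>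
      obtain ⟨x, hx⟩ := ih
      refine ⟨x + 1 + unif * x, ?_⟩
      rw [pow_succ, hx]
      simp only [unif, Subring.coe_add, Subring.coe_mul, Subring.coe_one]
      ring
  obtain ⟨k, rfl | rfl⟩ := m.eq_nat_or_neg
  · obtain ⟨x, hx⟩ := hv k
    exact ⟨x, by rw [← hx]; exact zpow_natCast _ _⟩
  · obtain ⟨x, hx⟩ := hv k
    refine ⟨-(⟨vv⁻¹, vv_inv_mem_Rloc⟩ ^ k * x), ?_⟩
    have h1 : vpow (-(k : ℤ)) = vv⁻¹ ^ k := by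
      unfold vpow; rw [zpow_neg, zpow_natCast, inv_pow]
    have h2 : vv⁻¹ ^ k * vv ^ k = 1 := by rw [← mul_pow, inv_mul_cancel₀ vv_ne_zero, one_pow]
    rw [h1]
    rw [hx] at h2
    simp only [unif, Subring.coe_add, Subring.coe_mul, Subring.coe_one, Subring.coe_neg,
      SubmonoidClass.coe_pow] at h2 ⊢
    linear_combination h2

end Local

/-! ### Reduction modulo `v - 1` -/

section Reduction
attribute [local instance] LieRing.ofAssociativeRing

variable (A : Type) [Ring A] [Algebra Rloc A]

/-- congruence modulo `v - 1`. -/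
def unifCon : RingCon A where
  r x y := ∃ z, x = y + unif • z
  iseqv :=
    ⟨fun x => ⟨0, by rw [smul_zero, add_zero]⟩,
      fun {x y} ⟨z, h⟩ => ⟨-z, by rw [h, smul_neg, add_neg_cancel_right]⟩,
      fun {x y w} ⟨z, h⟩ ⟨z', h'⟩ => ⟨z' + z, by rw [h, h', smul_add, add_assoc]⟩⟩
  mul' := by
    rintro x y x' y' ⟨z, rfl⟩ ⟨z', rfl⟩
    exact ⟨y * z' + z * y' + unif • (z * z'), by
      simp only [add_mul, mul_add, smul_mul_assoc, mul_smul_comm, smul_add]; abel⟩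
  add' := by
    rintro x y x' y' ⟨z, rfl⟩ ⟨z', rfl⟩
    exact ⟨z + z', by rw [smul_add]; abel⟩

variable {A}

/-- reduction modulo `v - 1`. -/
def red : A →+* (unifCon A).Quotient := (unifCon A).mk'

theorem red_eq_iff {x y : A} : red x = red y ↔ ∃ z, x = y + unif • z := (unifCon A).eq

theorem red_surjective : Function.Surjective (red (A := A)) := (unifCon A).mk'_surjective

theorem eq_zero_of_nsmul_red {m : ℕ} (hm : m ≠ 0) (x : (unifCon A).Quotient) (h : m • x = 0) :
    x = 0 := by
  obtain ⟨x, rfl⟩ := red_surjective x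
  rw [← map_nsmul, ← map_zero red, red_eq_iff] at h
  rw [← map_zero red, red_eq_iff]
  obtain ⟨z, hz⟩ := h
  let u : Rloc := ⟨(m : KK)⁻¹, natCast_inv_mem_Rloc hm⟩
  have hu : u * (m : Rloc) = 1 := by
    apply Subtype.ext
    simp only [u, Subring.coe_mul, Subring.coe_natCast, Subring.coe_one]
    exact inv_mul_cancel₀ (Nat.cast_ne_zero.2 hm)
  refine ⟨u • z, ?_⟩
  rw [zero_add] at hz ⊢
  rw [smul_comm, ← hz, ← Nat.cast_smul_eq_nsmul Rloc, smul_smul, hu, one_smul]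

variable {n : ℕ}

theorem map_ch {A B : Type} [Ring A] [Ring B] (φ : A →+* B) (f : ℕ → A) (i : ℕ) (a : A) (m : ℕ) :
    φ (ch n f i a m) = ch n (fun j => φ (f j)) i (φ a) m := by
  induction m with
  | zero => rfl
  | succ m ih =>
    change φ ⁅_, _⁆ = ⁅_, _⁆
    rw [Ring.lie_def, Ring.lie_def, map_sub, map_mul, map_mul, ih]

theorem map_rvec {A B : Type} [Ring A] [Ring B] (φ : A →+* B) (f : ℕ → A) (a : A)
    (β : PosRootC n) : φ (rvec f a β) = rvec (fun j => φ (f j)) (φ a) β := by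
  unfold rvec
  split_ifs
  · simp only [Ring.lie_def, map_sub, map_mul, map_ch]
  · exact map_ch φ f _ a _

/-- the additive span of the sorted products of the root vectors. -/
def sortedSpan (n : ℕ) (e : ℕ → ℕ → A) : AddSubgroup A :=
  AddSubgroup.closure {y | ∃ l : List (Lex (PosRootC n × ℕ)), l.Pairwise (· ≤ ·) ∧
    y = (l.map fun x => crv e (ofLex x)).prod}

theorem prod_mem_wordSpan_crv {B : Type} [Ring B] {e : ℕ → ℕ → B} (h : ClassRel n e)
    (l : List (Fin n × ℕ)) :
    (l.map fun p => e (p.1.1 + 1) p.2).prod ∈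
      wordSpan (fun x : Lex (PosRootC n × ℕ) => crv e (ofLex x)) l.length := by
  induction l with
  | nil => exact AddSubgroup.subset_closure ⟨[], le_rfl, rfl⟩
  | cons p l ih =>
    rw [List.map_cons, List.prod_cons, List.length_cons, add_comm]
    exact mul_mem_wordSpan (closure_range_le_wordSpan
      (gen_mem_closure_crv h (by omega) (by omega) p.2)) ih

theorem exists_eq_add_smul {e : ℕ → ℕ → A} (h : ClassRel n fun i k => red (e i k))
    (l : List (Fin n × ℕ)) : ∃ y ∈ sortedSpan n e, ∃ z,
      (l.map fun p => e (p.1.1 + 1) p.2).prod = y + unif • z := by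
  have h1 := wordSpan_le (x := fun x : Lex (PosRootC n × ℕ) => crv (fun i k => red (e i k)) (ofLex x))
    (fun a b => lie_mem_closure_crv h (ofLex a) (ofLex b)) _ (prod_mem_wordSpan_crv h l)
  have h2 : ∀ y ∈ AddSubgroup.closure {y | ∃ l : List (Lex (PosRootC n × ℕ)),
      l.Pairwise (· ≤ ·) ∧ y = (l.map fun x => crv (fun i k => red (e i k)) (ofLex x)).prod},
      ∃ y' ∈ sortedSpan n e, y = red y' := by
    intro y hy
    induction hy using AddSubgroup.closure_induction with
    | mem y hy =>
      obtain ⟨l', hl', rfl⟩ := hy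
      refine ⟨_, AddSubgroup.subset_closure ⟨l', hl', rfl⟩, ?_⟩
      rw [map_list_prod, List.map_map]
      refine congrArg List.prod (List.map_congr_left fun x _ => ?_)
      exact (map_rvec red _ _ _).symm
    | zero => exact ⟨0, zero_mem _, (map_zero red).symm⟩
    | add x y _ _ hx hy =>
      obtain ⟨x', hx', rfl⟩ := hx
      obtain ⟨y', hy', rfl⟩ := hy
      exact ⟨_, add_mem hx' hy', (map_add red _ _).symm⟩
    | neg x _ hx =>
      obtain ⟨x', hx', rfl⟩ := hx
      exact ⟨_, neg_mem hx', (map_neg red _).symm⟩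
  obtain ⟨y, hy, hy'⟩ := h2 _ h1
  refine ⟨y, hy, red_eq_iff.1 ?_⟩
  rw [← hy', map_list_prod, List.map_map]
  rfl

end Reduction

/-! ### The bigraded form of the algebra -/

/-- the defining relations for generators with nonnegative modes. -/
structure QRel {U : Type} [Ring U] [Algebra KK U] (n : ℕ) (g : ℕ → ℕ → U) : Prop where
  loop (i j : ℕ) : ∃ m : ℤ, ∀ r s, g i (r + 1) * g j s - vpow m • (g i r * g j (s + 1)) =
    vpow m • (g j s * g i (r + 1)) - g j (s + 1) * g i r
  comm (i j r s : ℕ) (h : i + 1 < j ∨ j + 1 < i) : g i r * g j s = g j s * g i r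
  serre (i j t : ℕ) (h : i + 1 = j ∨ j + 1 = i) (h' : ¬(i + 1 = n ∧ j = n)) :
    ∃ m : ℤ, serre2 (vpow m + vpow (-m)) (g i 0) (g i 0) (g j t) = 0
  serre_last (i t : ℕ) (h : i + 1 = n) :
    ∃ m : ℤ, serre3 (vpow m + 1 + vpow (-m)) (g i 0) (g i 0) (g i 0) (g n t) = 0

section Limit
variable {G : Type} [Ring G] [Algebra KK G] {n : ℕ}
attribute [local instance] LieRing.ofAssociativeRing

theorem Rloc_smul_def (r : Rloc) (x : G) : r • x = (r : KK) • x := rfl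

theorem QRel.classRel {S : Subalgebra Rloc G} {e : ℕ → ℕ → S}
    (h : QRel n fun i k => (e i k : G)) : ClassRel n fun i k => red (e i k) where
  loop i j r s := by
    obtain ⟨m, hm⟩ := h.loop i j
    obtain ⟨a, ha⟩ := exists_vpow_eq m
    simp only [Ring.lie_def, ← map_mul, ← map_sub]
    refine red_eq_iff.2 ⟨a • (e i r * e j (s + 1) + e j s * e i (r + 1)), Subtype.ext ?_⟩
    have h1 := hm r s
    rw [ha, ← Rloc_smul_def, ← Rloc_smul_def, add_smul, add_smul, one_smul, one_smul, mul_smul,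
      mul_smul] at h1
    simp only [Subalgebra.coe_add, Subalgebra.coe_sub, Subalgebra.coe_mul, Subalgebra.coe_smul,
      smul_add]
    rw [← sub_eq_zero] at h1 ⊢
    rw [← h1]
    abel
  comm i j r s hij := by
    have h1 : e i r * e j s = e j s * e i r := Subtype.ext (h.comm i j r s hij)
    rw [Ring.lie_def, ← map_mul, ← map_mul, h1, sub_self]
  serre i j t hij h' := by
    obtain ⟨m, hm⟩ := h.serre i j t hij h'
    obtain ⟨a, ha⟩ := exists_vpow_eq m
    obtain ⟨b, hb⟩ := exists_vpow_eq (-m)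
    simp only [Ring.lie_def, ← map_mul, ← map_sub]
    rw [← map_zero red]
    refine red_eq_iff.2 ⟨(a + b) • (e i 0 * e j t * e i 0), Subtype.ext ?_⟩
    have h1 : ∀ y : G, (vpow m + vpow (-m)) • y = y + y + unif • (a + b) • y := by
      intro y
      rw [ha, hb, add_smul, ← Rloc_smul_def, ← Rloc_smul_def, add_smul, add_smul, one_smul,
        add_smul a b, smul_add, mul_smul, mul_smul]
      abel
    unfold serre2 at hm
    rw [h1] at hm
    simp only [Subalgebra.coe_add, Subalgebra.coe_sub, Subalgebra.coe_mul, Subalgebra.coe_smul,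
      Subalgebra.coe_zero]
    rw [zero_add, ← sub_eq_zero, ← hm]
    noncomm_ring
  serre_last i t hi := by
    obtain ⟨m, hm⟩ := h.serre_last i t hi
    obtain ⟨a, ha⟩ := exists_vpow_eq m
    obtain ⟨b, hb⟩ := exists_vpow_eq (-m)
    simp only [Ring.lie_def, ← map_mul, ← map_sub]
    rw [← map_zero red]
    refine red_eq_iff.2 ⟨(a + b) • (e i 0 * e i 0 * e n t * e i 0)
      - (a + b) • (e i 0 * e n t * e i 0 * e i 0), Subtype.ext ?_⟩
    have h1 : ∀ y : G, (vpow m + 1 + vpow (-m)) • y = y + y + y + unif • (a + b) • y := by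
      intro y
      rw [ha, hb, add_smul, add_smul, ← Rloc_smul_def, ← Rloc_smul_def, add_smul, add_smul,
        one_smul, one_smul, add_smul a b, smul_add, mul_smul, mul_smul]
      abel
    unfold serre3 at hm
    rw [h1, h1] at hm
    simp only [Subalgebra.coe_add, Subalgebra.coe_sub, Subalgebra.coe_mul, Subalgebra.coe_smul,
      Subalgebra.coe_zero, smul_sub]
    rw [zero_add, ← sub_eq_zero, ← neg_zero, ← hm]
    noncomm_ring
  two x hx := eq_zero_of_nsmul_red two_ne_zero x (by rw [two_nsmul, hx])
  three x hx := eq_zero_of_nsmul_red three_ne_zero x (by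
    rw [show (3 : ℕ) = 2 + 1 from rfl, succ_nsmul, two_nsmul, hx])

end Limit

/-- the algebra graded by the length of the words and by the sum of the modes. -/
def Gr (U : Type) [Ring U] : Type := AddMonoidAlgebra U (ℕ × ℕ)

section Graded
attribute [local instance] LieRing.ofAssociativeRing
variable {U : Type} [Ring U] [Algebra KK U]

instance : Ring (Gr U) := inferInstanceAs (Ring (AddMonoidAlgebra U (ℕ × ℕ)))
instance : Algebra KK (Gr U) := inferInstanceAs (Algebra KK (AddMonoidAlgebra U (ℕ × ℕ)))

/-- the homogeneous element with the given degree and value. -/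
def hom (d : ℕ × ℕ) (x : U) : Gr U := AddMonoidAlgebra.single d x

/-- the homogeneous components. -/
def comp (d : ℕ × ℕ) : Gr U →ₗ[KK] U where
  toFun x := AddMonoidAlgebra.coeff x d
  map_add' _ _ := rfl
  map_smul' _ _ := rfl

theorem comp_hom (d d' : ℕ × ℕ) (x : U) : comp d' (hom d x) = if d = d' then x else 0 :=
  Finsupp.single_apply

theorem hom_mul_hom (d d' : ℕ × ℕ) (x y : U) : hom d x * hom d' y = hom (d + d') (x * y) :=
  AddMonoidAlgebra.single_mul_single ..

theorem hom_sub (d : ℕ × ℕ) (x y : U) : hom d (x - y) = hom d x - hom d y :=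
  AddMonoidAlgebra.single_sub ..

theorem hom_add (d : ℕ × ℕ) (x y : U) : hom d (x + y) = hom d x + hom d y :=
  AddMonoidAlgebra.single_add ..

theorem smul_hom (d : ℕ × ℕ) (c : KK) (x : U) : c • hom d x = hom d (c • x) :=
  AddMonoidAlgebra.smul_single ..

theorem hom_zero (d : ℕ × ℕ) : hom d (0 : U) = 0 := AddMonoidAlgebra.single_zero _

/-- the generators in the graded algebra. -/
def genGr (g : ℕ → ℕ → U) (i k : ℕ) : Gr U := hom (1, k) (g i k)

variable {n : ℕ} {g : ℕ → ℕ → U}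

theorem QRel.graded (h : QRel n g) : QRel n (genGr g) where
  loop i j := by
    obtain ⟨m, hm⟩ := h.loop i j
    refine ⟨m, fun r s => ?_⟩
    unfold genGr
    simp only [hom_mul_hom, smul_hom, Prod.mk_add_mk]
    rw [show r + 1 + s = r + (s + 1) by omega, show s + 1 + r = r + (s + 1) by omega,
      show s + (r + 1) = r + (s + 1) by omega, ← hom_sub, ← hom_sub, hm]
  comm i j r s hij := by
    unfold genGr
    rw [hom_mul_hom, hom_mul_hom, h.comm i j r s hij, add_comm (1, r)]
  serre i j t hij h' := by
    obtain ⟨m, hm⟩ := h.serre i j t hij h'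
    refine ⟨m, ?_⟩
    unfold genGr
    unfold serre2 at hm ⊢
    simp only [hom_mul_hom, smul_hom, Prod.mk_add_mk, zero_add, add_zero]
    rw [← hom_sub, ← hom_add, hm, hom_zero]
  serre_last i t hi := by
    obtain ⟨m, hm⟩ := h.serre_last i t hi
    refine ⟨m, ?_⟩
    unfold genGr
    unfold serre3 at hm ⊢
    simp only [hom_mul_hom, smul_hom, Prod.mk_add_mk, zero_add, add_zero]
    rw [← hom_sub, ← hom_add, ← hom_sub, hm, hom_zero]

theorem hom_list_prod {ι : Type} (x : ι → U) (d : ι → ℕ × ℕ) (l : List ι) :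
    (l.map fun a => hom (d a) (x a)).prod = hom (l.map d).sum (l.map x).prod := by
  induction l with
  | nil => rfl
  | cons a l ih =>
    rw [List.map_cons, List.prod_cons, ih, hom_mul_hom, List.map_cons, List.map_cons,
      List.prod_cons, List.sum_cons]

theorem ch_hom (i a k m : ℕ) (u : U) (f : ℕ → U) :
    ch n (fun j => hom (1, 0) (f j)) i (hom (a, k) u) m = hom (a + m, k) (ch n f i u m) := by
  induction m with
  | zero => rfl
  | succ m ih =>
    change ⁅_, _⁆ = hom _ ⁅_, _⁆
    rw [ih, Ring.lie_def, Ring.lie_def, hom_mul_hom, hom_mul_hom, add_comm (1, 0), ← hom_sub]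
    rfl

theorem crv_genGr (x : PosRootC n × ℕ) :
    crv (genGr g) x = hom (heightC x.1, x.2) (crv g x) := by
  unfold crv rvec
  have h1 := ri_le_rend x.1
  split_ifs with hx
  · have hx' := hx
    unfold isINI at hx'
    unfold genGr
    rw [ch_hom, ch_hom, Ring.lie_def, Ring.lie_def, hom_mul_hom, hom_mul_hom,
      add_comm (1 + (n - 1 - ri x.1), 0), ← hom_sub, Prod.mk_add_mk, add_zero]
    congr 2
    unfold heightC
    rw [wordC_of_isINI hx]
    simp only [List.length_append, List.length_range', List.length_singleton]
    omega
  · unfold genGr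
    rw [ch_hom]
    congr 2
    unfold heightC
    rw [wordC_of_not_isINI hx]
    simp only [List.length_map, List.length_range']
    omega

end Graded

/-! ### Spanning by sorted products of root vectors -/

section Lattice
variable {U : Type} [Ring U] [Algebra KK U] {n : ℕ} {g : ℕ → ℕ → U}
attribute [local instance] LieRing.ofAssociativeRing

/-- the words of a given length and sum of modes. -/
def wordsOf (n ℓ c : ℕ) : Set (List (Fin n × ℕ)) :=
  {l | l.length = ℓ ∧ (l.map Prod.snd).sum = c}

theorem finite_wordsOf (n ℓ c : ℕ) : (wordsOf n ℓ c).Finite := by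
  refine ((List.finite_length_eq (Fin n × Fin (c + 1)) ℓ).image
    (List.map fun p => (p.1, (p.2 : ℕ)))).subset ?_
  rintro l ⟨hl, hc⟩
  refine ⟨l.map fun p => (p.1, (⟨min p.2 c, by omega⟩ : Fin (c + 1))), by simpa using hl, ?_⟩
  rw [List.map_map]
  conv_rhs => rw [← List.map_id l]
  refine List.map_congr_left fun p hp => ?_
  have h1 : p.2 ≤ c := hc ▸ List.single_le_sum (fun _ _ => Nat.zero_le _) _ (List.mem_map_of_mem hp)
  exact Prod.ext rfl (min_eq_left h1)

/-- the `Rloc`-span of the words of a given length and sum of modes. -/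
def wordLattice (n : ℕ) (g : ℕ → ℕ → U) (ℓ c : ℕ) : Submodule Rloc U :=
  Submodule.span Rloc ((fun l : List (Fin n × ℕ) => (l.map fun p => g (p.1.1 + 1) p.2).prod) ''
    wordsOf n ℓ c)

/-- the sorted products of root vectors of a given total height. -/
def sortedProds (n : ℕ) (g : ℕ → ℕ → U) (ℓ : ℕ) : Set U :=
  {y | ∃ l : List (Lex (PosRootC n × ℕ)), l.Pairwise (· ≤ ·) ∧
    totHt (l.map fun x => (ofLex x).1) = ℓ ∧ y = (l.map fun x => crv g (ofLex x)).prod}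

/-- the `Rloc`-form of the graded algebra. -/
def formGr (n : ℕ) (g : ℕ → ℕ → U) : Subalgebra Rloc (Gr U) :=
  Algebra.adjoin Rloc (Set.range fun p : Fin n × ℕ => genGr g (p.1.1 + 1) p.2)

theorem genGr_mem_formGr (hz : ∀ i k, ¬(1 ≤ i ∧ i ≤ n) → g i k = 0) (i k : ℕ) :
    genGr g i k ∈ formGr n g := by
  by_cases h : 1 ≤ i ∧ i ≤ n
  · refine Algebra.subset_adjoin ⟨(⟨i - 1, by omega⟩, k), ?_⟩
    dsimp only
    rw [Nat.sub_add_cancel h.1]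
  · unfold genGr
    rw [hz i k h, hom_zero]
    exact zero_mem _

theorem word_genGr (l : List (Fin n × ℕ)) :
    (l.map fun p => genGr g (p.1.1 + 1) p.2).prod =
      hom (l.length, (l.map Prod.snd).sum) (l.map fun p => g (p.1.1 + 1) p.2).prod := by
  unfold genGr
  rw [hom_list_prod (fun p : Fin n × ℕ => g (p.1.1 + 1) p.2) (fun p => (1, p.2))]
  congr 1
  induction l with
  | nil => rfl
  | cons a l ih =>
    rw [List.map_cons, List.sum_cons, ih, Prod.mk_add_mk, List.length_cons, List.map_cons,
      List.sum_cons, add_comm 1]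

theorem comp_mem_wordLattice {z : Gr U} (hz : z ∈ formGr n g) (ℓ c : ℕ) :
    comp (ℓ, c) z ∈ wordLattice n g ℓ c := by
  have key : ∀ z ∈ Submodule.span Rloc
      (Submonoid.closure (Set.range fun p : Fin n × ℕ => genGr g (p.1.1 + 1) p.2) : Set (Gr U)),
      comp (ℓ, c) z ∈ wordLattice n g ℓ c := by
    intro z hz
    induction hz using Submodule.span_induction with
    | mem z hz =>
      obtain ⟨l, hl, rfl⟩ := Submonoid.exists_list_of_mem_closure hz
      obtain ⟨l, rfl⟩ : l ∈ Set.range (List.map fun p : Fin n × ℕ => genGr g (p.1.1 + 1) p.2) := by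
        rw [Set.range_list_map]
        exact hl
      rw [word_genGr, comp_hom]
      split_ifs with h
      · rw [Prod.mk.injEq] at h
        exact Submodule.subset_span ⟨l, h, rfl⟩
      · exact zero_mem _
    | zero => rw [map_zero]; exact zero_mem _
    | add x y _ _ hx hy => rw [map_add]; exact add_mem hx hy
    | smul r x _ hx =>
      rw [Rloc_smul_def, map_smul, ← Rloc_smul_def]
      exact Submodule.smul_mem _ _ hx
  refine key z ?_
  rw [← Algebra.adjoin_eq_span]
  exact hz

theorem comp_mem_sortedProds {e : ℕ → ℕ → formGr n g} (he : ∀ i k, (e i k : Gr U) = genGr g i k)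
    {y : formGr n g} (hy : y ∈ sortedSpan n e) (ℓ c : ℕ) :
    comp (ℓ, c) (y : Gr U) ∈ Submodule.span Rloc (sortedProds n g ℓ) := by
  induction hy using AddSubgroup.closure_induction with
  | mem y hy =>
    obtain ⟨l, hl, rfl⟩ := hy
    have h1 : (((l.map fun x => crv e (ofLex x)).prod : formGr n g) : Gr U) =
        hom (l.map fun x => (heightC (ofLex x).1, (ofLex x).2)).sum
          (l.map fun x => crv g (ofLex x)).prod := by
      rw [← hom_list_prod (fun x : Lex (PosRootC n × ℕ) => crv g (ofLex x))]
      change (formGr n g).val _ = _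
      rw [map_list_prod, List.map_map]
      refine congrArg List.prod (List.map_congr_left fun x _ => ?_)
      rw [← crv_genGr]
      refine (map_rvec (formGr n g).val.toRingHom _ _ _).trans ?_
      unfold crv
      congr 1
      · funext j
        exact he j 0
      · exact he _ _
    rw [h1, comp_hom]
    split_ifs with h
    · refine Submodule.subset_span ⟨l, hl, ?_, rfl⟩
      have h2 := congrArg (AddMonoidHom.fst ℕ ℕ) h
      rw [map_list_sum, List.map_map] at h2
      unfold totHt
      rw [List.map_map]
      exact h2
    · exact zero_mem _
  | zero => rw [ZeroMemClass.coe_zero, map_zero]; exact zero_mem _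
  | add x y _ _ hx hy => rw [Subalgebra.coe_add, map_add]; exact add_mem hx hy
  | neg x _ hx => rw [Subalgebra.coe_neg, map_neg]; exact neg_mem hx

theorem QRel.wordLattice_le (h : QRel n g) (hz : ∀ i k, ¬(1 ≤ i ∧ i ≤ n) → g i k = 0) (ℓ c : ℕ) :
    wordLattice n g ℓ c ≤
      Submodule.span Rloc (sortedProds n g ℓ) ⊔ Ideal.span {unif} • wordLattice n g ℓ c := by
  conv_lhs => rw [wordLattice]
  rw [Submodule.span_le]
  rintro _ ⟨l, hl, rfl⟩
  let e : ℕ → ℕ → formGr n g := fun i k => ⟨genGr g i k, genGr_mem_formGr hz i k⟩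
  have hcl : ClassRel n fun i k => red (e i k) := QRel.classRel (S := formGr n g) (e := e) h.graded
  obtain ⟨y, hy, z, hyz⟩ := exists_eq_add_smul hcl l
  have h1 : hom (ℓ, c) (l.map fun p => g (p.1.1 + 1) p.2).prod = (y : Gr U) + unif • (z : Gr U) := by
    have h2 : _ = (y : Gr U) + unif • (z : Gr U) := congrArg (formGr n g).val hyz
    rw [map_list_prod, List.map_map] at h2
    have h3 := word_genGr (g := g) l
    rw [hl.1, hl.2] at h3
    exact h3.symm.trans h2
  have h2 := congrArg (comp (ℓ, c)) h1
  rw [comp_hom, if_pos rfl, map_add, Rloc_smul_def, map_smul, ← Rloc_smul_def] at h2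
  dsimp only
  rw [SetLike.mem_coe, h2]
  exact Submodule.add_mem_sup (comp_mem_sortedProds (e := e) (fun _ _ => rfl) hy ℓ c)
    (Submodule.smul_mem_smul (Ideal.mem_span_singleton_self _) (comp_mem_wordLattice z.2 ℓ c))

theorem QRel.word_mem_span (h : QRel n g) (hz : ∀ i k, ¬(1 ≤ i ∧ i ≤ n) → g i k = 0)
    (l : List (Fin n × ℕ)) : (l.map fun p => g (p.1.1 + 1) p.2).prod ∈
      Submodule.span KK (sortedProds n g l.length) := by
  obtain ⟨r, hr, hr'⟩ := Submodule.exists_sub_one_mem_and_smul_le_of_fg_of_le_sup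
    (N := Submodule.span Rloc (sortedProds n g l.length))
    (Submodule.fg_span ((finite_wordsOf n l.length (l.map Prod.snd).sum).image _)) le_rfl
    (h.wordLattice_le hz l.length (l.map Prod.snd).sum)
  obtain ⟨x, hx⟩ := Ideal.mem_span_singleton'.1 hr
  have hr0 : (r : KK) ≠ 0 := by
    have h1 := unif_mul_ne x
    rw [mul_comm, hx, add_sub_cancel] at h1
    exact fun h => h1 (Subtype.ext h)
  have h1 := hr' (Submodule.smul_mem_pointwise_smul _ r _ (Submodule.subset_span ⟨l, ⟨rfl, rfl⟩, rfl⟩))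
  have h2 : r • (l.map fun p => g (p.1.1 + 1) p.2).prod ∈
      Submodule.span KK (sortedProds n g l.length) := by
    revert h1
    dsimp only
    generalize r • (l.map fun p => g (p.1.1 + 1) p.2).prod = y
    intro h1
    induction h1 using Submodule.span_induction with
    | mem y hy => exact Submodule.subset_span hy
    | zero => exact zero_mem _
    | add x y _ _ hx hy => exact add_mem hx hy
    | smul r x _ hx => exact Submodule.smul_mem _ (r : KK) hx
  rw [Rloc_smul_def] at h2
  exact (Submodule.smul_mem_iff _ hr0).1 h2

end Lattice

/-! ### The relations between the generators, and a family of root vectors that spans -/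

section Spanning
variable {n : ℕ}

theorem ug_loop (i j : Fin n) (r s : ℤ) :
    ug n (aC n) (dC n) i (r + 1) * ug n (aC n) (dC n) j s -
      vpow ((dC n (i.1 + 1) : ℤ) * aC n (i.1 + 1) (j.1 + 1)) •
        (ug n (aC n) (dC n) i r * ug n (aC n) (dC n) j (s + 1)) =
    vpow ((dC n (i.1 + 1) : ℤ) * aC n (i.1 + 1) (j.1 + 1)) •
        (ug n (aC n) (dC n) j s * ug n (aC n) (dC n) i (r + 1)) -
      ug n (aC n) (dC n) j (s + 1) * ug n (aC n) (dC n) i r := by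
  have h := RingQuot.mkAlgHom_rel KK (URel.loop (A := aC n) (Dd := dC n) i j r s)
  simp only [map_sub, map_mul, map_smul] at h
  exact h

theorem mk_serreElt (i j : Fin n) (hij : i ≠ j) (m : ℕ)
    (hm : (1 - aC n (i.1 + 1) (j.1 + 1)).toNat = m) (r : Fin m → ℤ) (t : ℤ) :
    RingQuot.mkAlgHom KK (URel n (aC n) (dC n)) (serreElt n (dC n) i j m r t) = 0 := by
  subst hm
  rw [RingQuot.mkAlgHom_rel KK (URel.serre i j hij r t), map_zero]

theorem dC_ne_zero (i : ℕ) : (dC n i : ℤ) ≠ 0 := by unfold dC; split_ifs <;> norm_num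

theorem ug_comm (i j : Fin n) (h : i.1 + 1 < j.1 ∨ j.1 + 1 < i.1) (r t : ℤ) :
    ug n (aC n) (dC n) i r * ug n (aC n) (dC n) j t =
      ug n (aC n) (dC n) j t * ug n (aC n) (dC n) i r := by
  have h1 := mk_serreElt i j (by rintro rfl; omega) 1
    (by unfold aC; rw [if_neg (by omega), if_neg (by omega), if_neg (by omega)]; rfl)
    (fun _ => r) t
  rw [serreElt_one n (dC n) i j (dC_ne_zero _), map_sub, map_mul, map_mul] at h1
  exact (sub_eq_zero.1 h1).symm

theorem ug_serre2 (i j : Fin n) (h : i.1 + 1 = j.1 ∨ j.1 + 1 = i.1)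
    (h' : ¬(i.1 + 2 = n ∧ j.1 + 1 = n)) (r t : ℤ) :
    serre2 (vpow (dC n (i.1 + 1)) + (vpow (dC n (i.1 + 1)))⁻¹) (ug n (aC n) (dC n) i r)
      (ug n (aC n) (dC n) i r) (ug n (aC n) (dC n) j t) = 0 := by
  have h1 := mk_serreElt i j (by rintro rfl; omega) 2
    (by unfold aC; rw [if_neg (by omega), if_neg (by omega), if_pos (by omega)]; rfl)
    (fun _ => r) t
  rw [serreElt_two n (dC n) i j (dC_ne_zero _), Finset.sum_const, map_nsmul] at h1
  have h2 := (smul_eq_zero.1 (((Nat.cast_smul_eq_nsmul KK _ _).trans h1))).resolve_left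
    (Nat.cast_ne_zero.2 (by simp))
  unfold serre2 at h2 ⊢
  simp only [map_add, map_sub, map_mul, map_smul] at h2
  exact h2

theorem ug_serre3 (i j : Fin n) (h : i.1 + 2 = n) (h' : j.1 + 1 = n) (r t : ℤ) :
    serre3 (vpow (dC n (i.1 + 1)) ^ 2 + 1 + (vpow (dC n (i.1 + 1)))⁻¹ ^ 2)
      (ug n (aC n) (dC n) i r) (ug n (aC n) (dC n) i r) (ug n (aC n) (dC n) i r)
      (ug n (aC n) (dC n) j t) = 0 := by
  have h1 := mk_serreElt i j (by rintro rfl; omega) 3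
    (by unfold aC; rw [if_neg (by omega), if_pos (by omega)]; rfl)
    (fun _ => r) t
  rw [serreElt_three n (dC n) i j (dC_ne_zero _), Finset.sum_const, map_nsmul] at h1
  have h2 := (smul_eq_zero.1 (((Nat.cast_smul_eq_nsmul KK _ _).trans h1))).resolve_left
    (Nat.cast_ne_zero.2 (by simp))
  unfold serre3 at h2 ⊢
  simp only [map_add, map_sub, map_mul, map_smul] at h2
  exact h2

theorem vpow_neg_eq_inv (m : ℤ) : vpow (-m) = (vpow m)⁻¹ := zpow_neg _ _

theorem genC_of_not {i : ℕ} (h : ¬(1 ≤ i ∧ i ≤ n)) (r : ℤ) : genC n i r = 0 := dif_neg h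

theorem genC_of {i : ℕ} (h : 1 ≤ i ∧ i ≤ n) (r : ℤ) :
    genC n i r = ug n (aC n) (dC n) ⟨i - 1, by omega⟩ r := dif_pos h

theorem qrel_genC (b : ℤ) : QRel n fun i k => genC n i ((k : ℤ) + b) where
  loop i j := by
    by_cases hi : 1 ≤ i ∧ i ≤ n
    · by_cases hj : 1 ≤ j ∧ j ≤ n
      · refine ⟨(dC n (i - 1 + 1) : ℤ) * aC n (i - 1 + 1) (j - 1 + 1), fun r s => ?_⟩
        simp only [genC_of hi, genC_of hj, Nat.cast_succ, add_right_comm _ (1 : ℤ) b]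
        exact ug_loop _ _ _ _
      · exact ⟨0, fun r s => by simp only [genC_of_not hj, mul_zero, zero_mul, smul_zero]⟩
    · exact ⟨0, fun r s => by simp only [genC_of_not hi, mul_zero, zero_mul, smul_zero]⟩
  comm i j r s h := by
    by_cases hi : 1 ≤ i ∧ i ≤ n
    · by_cases hj : 1 ≤ j ∧ j ≤ n
      · rw [genC_of hi, genC_of hj]
        exact ug_comm _ _ (by dsimp only; omega) _ _
      · rw [genC_of_not hj, mul_zero, zero_mul]
    · rw [genC_of_not hi, mul_zero, zero_mul]
  serre i j t h h' := by
    by_cases hi : 1 ≤ i ∧ i ≤ n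
    · by_cases hj : 1 ≤ j ∧ j ≤ n
      · refine ⟨dC n (i - 1 + 1), ?_⟩
        rw [genC_of hi, genC_of hj, vpow_neg_eq_inv]
        exact ug_serre2 _ _ (by dsimp only; omega) (by dsimp only; omega) _ _
      · refine ⟨0, ?_⟩
        unfold serre2
        simp only [genC_of_not hj, mul_zero, zero_mul, smul_zero, sub_zero, add_zero]
    · refine ⟨0, ?_⟩
      unfold serre2
      simp only [genC_of_not hi, mul_zero, zero_mul, smul_zero, sub_zero, add_zero]
  serre_last i t h := by
    by_cases hi : 1 ≤ i ∧ i ≤ n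
    · refine ⟨dC n (i - 1 + 1) + dC n (i - 1 + 1), ?_⟩
      rw [genC_of hi, genC_of (i := n) (by omega), vpow_neg_eq_inv, vpow_add, mul_inv, ← pow_two,
        ← pow_two]
      exact ug_serre3 _ _ (by dsimp only; omega) (by dsimp only; omega) _ _
    · refine ⟨0, ?_⟩
      unfold serre3
      simp only [genC_of_not hi, mul_zero, zero_mul, smul_zero, sub_zero, add_zero]

attribute [local instance] LieRing.ofAssociativeRing

theorem ch_eq_chainE (b k : ℤ) {i : ℕ} (hi : i ≤ n) (m : ℕ) :
    ch n (fun j => genC n j b) i (genC n i k) m =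
      chainE (genC n) ((List.range' i (m + 1)).map (pcol n)) (k :: List.replicate m b)
        (List.replicate m 1) := by
  have h1 : pcol n i = i := by unfold pcol; rw [if_pos hi]
  rw [List.range'_succ, List.map_cons, h1]
  change _ = List.foldl _ _ _
  induction m with
  | zero => rfl
  | succ m ih =>
    rw [List.range'_1_concat, List.map_append, List.replicate_succ', List.replicate_succ',
      List.zip_append (by simp), List.zip_append (by simp), List.foldl_append]
    change ⁅_, _⁆ = _
    rw [ih, Ring.lie_def, show i + m + 1 = i + 1 + m by omega]
    simp only [List.map_cons, List.map_nil, List.zip_cons_cons, List.zip_nil_right,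
      List.foldl_cons, List.foldl_nil]
    exact congrArg _ (one_smul KK _).symm

theorem isVpow_one : IsVpow 1 := ⟨0, vpow_zero.symm⟩

theorem isRVCchain_ch (b k : ℤ) {β : PosRootC n} (h : ¬isINI β) {m : ℕ} (hm : rend β = ri β + m) :
    IsRVCchain β (k + m * b) (ch n (fun j => genC n j b) (ri β) (genC n (ri β) k) m) := by
  have h1 : wordC β = (List.range' (ri β) (m + 1)).map (pcol n) := by
    rw [wordC_of_not_isINI h, hm, show ri β + m + 1 - ri β = m + 1 by omega]
  refine ⟨k :: List.replicate m b, List.replicate m 1, ?_, ?_, ?_, ?_, ?_⟩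
  · rw [h1]; simp
  · rw [h1]; simp
  · simp
  · intro l hl
    rw [List.eq_of_mem_replicate hl]
    exact isVpow_one
  · rw [h1]
    exact ch_eq_chainE b k (ri_le β) m

theorem isRVC_rvec (b k : ℤ) (β : PosRootC n) :
    IsRVC β (k + ((heightC β : ℤ) - 1) * b)
      (rvec (fun j => genC n j b) (genC n (ri β) k) β) := by
  have h0 := ri_pos β
  have h1 := ri_le_rend β
  unfold IsRVC rvec heightC
  split_ifs with h
  · have h' := h
    unfold isINI at h'
    let β₁ : PosRootC n := ⟨toLex (⟨ri β, by omega⟩, ⟨n - 1 - ri β, by omega⟩), by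
      refine ⟨h0, fun h => ?_, ?_⟩
      · change ri β = n at h
        omega
      · change n - 1 - ri β + 2 * ri β ≤ 2 * n
        omega⟩
    let β₂ : PosRootC n := ⟨toLex (⟨ri β, by omega⟩, ⟨n + 1 - ri β, by omega⟩), by
      refine ⟨h0, fun h => ?_, ?_⟩
      · change ri β = n at h
        omega
      · change n + 1 - ri β + 2 * ri β ≤ 2 * n
        omega⟩
    have e1 : ri β₁ = ri β := rfl
    have e2 : rt β₁ = n - 1 - ri β := rfl
    have e3 : ri β₂ = ri β := rfl
    have e4 : rt β₂ = n + 1 - ri β := rfl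
    refine ⟨β₁, β₂, _, _, 1, _, _, ⟨e1, by omega⟩, ⟨e3, by omega⟩, isVpow_one,
      isRVCchain_ch b b (m := n - 1 - ri β) (by unfold isINI; omega) ?_,
      isRVCchain_ch b k (m := n - ri β) (by unfold isINI; omega) ?_, ?_, ?_⟩
    · unfold rend; split_ifs <;> omega
    · unfold rend; split_ifs <;> omega
    · rw [wordC_of_isINI h]
      simp only [List.length_append, List.length_range', List.length_singleton]
      push_cast [Nat.sub_sub, show 1 + ri β ≤ n by omega, show ri β ≤ n by omega]
      ring
    · rw [Ring.lie_def]
      unfold qcm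
      exact congrArg _ (one_smul KK _).symm
  · convert isRVCchain_ch b k h (m := rend β - ri β) (by omega) using 3
    rw [wordC_of_not_isINI h]
    simp only [List.length_map, List.length_range']
    omega

/-- the root vectors with all but the first mode equal to `b` and with trivial parameters. -/
def fam (b : ℤ) (x : Ix n) : UC n :=
  rvec (fun j => genC n j b)
    (genC n (ri (ofLex x).1) ((ofLex x).2 - ((heightC (ofLex x).1 : ℤ) - 1) * b)) (ofLex x).1

theorem isFam_fam (b : ℤ) : IsFam (fam (n := n) b) := fun x => by
  have h := isRVC_rvec (n := n) b ((ofLex x).2 - ((heightC (ofLex x).1 : ℤ) - 1) * b) (ofLex x).1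
  rwa [sub_add_cancel] at h

/-- the index of the root vector with given nonnegative first mode relative to `b`. -/
def shiftIx (b : ℤ) (x : Lex (PosRootC n × ℕ)) : Ix n :=
  toLex ((ofLex x).1, (ofLex x).2 + (heightC (ofLex x).1 : ℤ) * b)

theorem shiftIx_mono (b : ℤ) {x y : Lex (PosRootC n × ℕ)} (h : x ≤ y) :
    shiftIx b x ≤ shiftIx b y := by
  rw [Prod.Lex.le_iff] at h ⊢
  rcases h with h | ⟨h, h'⟩
  · exact Or.inl h
  · refine Or.inr ⟨h, ?_⟩
    change ((ofLex x).2 : ℤ) + (heightC (ofLex x).1 : ℤ) * b ≤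
      (ofLex y).2 + (heightC (ofLex y).1 : ℤ) * b
    rw [h]
    exact add_le_add_left (Int.ofNat_le.2 h') _

theorem fam_shiftIx (b : ℤ) (x : Lex (PosRootC n × ℕ)) :
    fam b (shiftIx b x) = crv (fun i k => genC n i ((k : ℤ) + b)) (ofLex x) := by
  have h1 : ((ofLex x).2 : ℤ) + (heightC (ofLex x).1 : ℤ) * b -
      ((heightC (ofLex x).1 : ℤ) - 1) * b = ((ofLex x).2 : ℤ) + b := by ring
  unfold fam crv shiftIx
  simp only [ofLex_toLex, h1, Nat.cast_zero, zero_add]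

theorem sortedProds_subset (b : ℤ) (m : ℕ) :
    sortedProds n (fun i k => genC n i ((k : ℤ) + b)) m ⊆ monSpan (fam (n := n) b) m := by
  rintro _ ⟨l, hl, hm, rfl⟩
  refine Submodule.subset_span ⟨l.map (shiftIx b), ⟨?_, ?_⟩, ?_⟩
  · exact List.Pairwise.map _ (fun _ _ => shiftIx_mono b) hl
  · unfold types
    rw [List.map_map]
    exact hm
  · dsimp only
    rw [List.map_map]
    exact congrArg List.prod (List.map_congr_left fun x _ => fam_shiftIx b x)

theorem word_mem_monSpan (b : ℤ) (l : List (Fin n × ℤ)) (h : ∀ p ∈ l, b ≤ p.2) :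
    (l.map fun p => ug n (aC n) (dC n) p.1 p.2).prod ∈ monSpan (fam (n := n) b) l.length := by
  have h1 := (qrel_genC (n := n) b).word_mem_span (fun i k hi => genC_of_not hi _)
    (l.map fun p => (p.1, (p.2 - b).toNat))
  rw [List.map_map, List.length_map] at h1
  have h2 : l.map ((fun p : Fin n × ℕ => genC n (p.1.1 + 1) ((p.2 : ℤ) + b)) ∘
      fun p => (p.1, (p.2 - b).toNat)) = l.map fun p => ug n (aC n) (dC n) p.1 p.2 := by
    refine List.map_congr_left fun p hp => ?_
    change genC n (p.1.1 + 1) (((p.2 - b).toNat : ℤ) + b) = _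
    rw [Int.toNat_of_nonneg (sub_nonneg.2 (h p hp)), sub_add_cancel, genC_of (by omega)]
    rfl
  rw [h2] at h1
  exact Submodule.span_le.2 (sortedProds_subset b _) h1

theorem exists_mem_monSpan (m : ℕ) {x : UC n} (hx : x ∈ Wd n m) :
    ∃ E : Ix n → UC n, IsFam E ∧ x ∈ monSpan E m := by
  have key : ∃ b₀ : ℤ, ∀ b ≤ b₀, x ∈ monSpan (fam (n := n) b) m := by
    unfold Wd at hx
    rw [Submodule.span_pow] at hx
    induction hx using Submodule.span_induction with
    | mem x hx =>
      obtain ⟨f, rfl⟩ := Set.mem_pow.1 hx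
      choose p hp using fun k => (f k).2
      obtain ⟨b₀, hb⟩ := (Set.finite_range fun k => (p k).2).bddBelow
      refine ⟨b₀, fun b hbb => ?_⟩
      have h1 := word_mem_monSpan b (List.ofFn p) (fun q hq => by
        obtain ⟨k, rfl⟩ := List.mem_ofFn.1 hq
        exact hbb.trans (hb ⟨k, rfl⟩))
      rw [List.map_ofFn, List.length_ofFn] at h1
      have h2 : (fun k => ((f k : UC n))) =
          (fun q : Fin n × ℤ => ug n (aC n) (dC n) q.1 q.2) ∘ p := funext fun k => (hp k).symm
      rwa [h2]
    | zero => exact ⟨0, fun _ _ => zero_mem _⟩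
    | add x y _ _ hx hy =>
      obtain ⟨b₀, hx⟩ := hx
      obtain ⟨b₁, hy⟩ := hy
      exact ⟨min b₀ b₁, fun b hb => add_mem (hx b (hb.trans (min_le_left _ _)))
        (hy b (hb.trans (min_le_right _ _)))⟩
    | smul c x _ hx =>
      obtain ⟨b₀, hx⟩ := hx
      exact ⟨b₀, fun b hb => Submodule.smul_mem _ c (hx b hb)⟩
  obtain ⟨b₀, h⟩ := key
  exact ⟨_, isFam_fam b₀, h b₀ le_rfl⟩

end Spanning

end PBWD

/-- **PBWD basis of `U_v^>(Lsp_{2n})` (type `C_n`)**: for any choice of the parameters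
`λ_k ∈ v^ℤ` and of the decompositions used in the definition of the quantum root vectors
`E_{β,s}`, the ordered PBWD monomials `{E_h}_{h∈H}` form a `ℚ(v)`-basis of `U_v^>(Lsp_{2n})`. -/
theorem pbwd_basis_typeC (n : ℕ) (hn : 2 ≤ n)
    (E : PosRootC n × ℤ → UC n) (hE : ∀ p, IsRVC p.1 p.2 (E p)) :
    LinearIndependent KK
      (fun h : Lex (PosRootC n × ℤ) →₀ ℕ => ordMon (fun p => E (ofLex p)) h) ∧
    Submodule.span KK
      (Set.range (fun h : Lex (PosRootC n × ℤ) →₀ ℕ => ordMon (fun p => E (ofLex p)) h)) = ⊤ := by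
  have hE' : PBWD.IsFam fun p => E (ofLex p) := fun x => hE (ofLex x)
  exact ⟨PBWD.linearIndependent_ordMon hn hE',
    PBWD.span_ordMon hn (fun m _ hx => PBWD.exists_mem_monSpan m hx) hE'⟩
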